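/- Under the blow-up setup, with D_α(x) := |x − x_α| + μ_α for x ∈ Ω, one has D_α(x)^{(n−2)/2} |v_α(x) − ΠB_α(x) ∓ v_∞(x)| → 0 uniformly for x ∈ Ω̄ as α → +∞. -/

import Mathlib

open MeasureTheory Filter Topology Metric
open scoped RealInnerProductSpace

noncomputable section

/-- Euclidean space ℝⁿ. -/
abbrev En (n : ℕ) := EuclideanSpace ℝ (Fin n)

/-- The Laplacian of `f` at `x`, computed as the sum of the second partial derivatives
in the coordinate directions. -/
def lap {n : ℕ} (f : En n → ℝ) (x : En n) : ℝ :=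
  ∑ i : Fin n, fderiv ℝ (fun y => fderiv ℝ f y (EuclideanSpace.single i 1)) x
    (EuclideanSpace.single i 1)

/-- The critical Sobolev exponent `2* = 2n/(n-2)`. -/
def twoStar (n : ℕ) : ℝ := 2 * n / (n - 2)

/-- Smooth compactly supported test functions in `Ω` (a dense subspace of `H¹₀(Ω)`). -/
def TestFun {n : ℕ} (Ω : Set (En n)) (v : En n → ℝ) : Prop :=
  ContDiff ℝ (⊤ : ℕ∞) v ∧ HasCompactSupport v ∧ tsupport v ⊆ Ω

/-- The quadratic form `∫_Ω (|∇v|² + h v²) dx` of the operator `-Δ + h`. -/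
def energy {n : ℕ} (Ω : Set (En n)) (h v : En n → ℝ) : ℝ :=
  ∫ x in Ω, (‖fderiv ℝ v x‖ ^ 2 + h x * v x ^ 2)

/-- Coercivity of `-Δ + h` on `H¹₀(Ω)`. -/
def Coercive {n : ℕ} (Ω : Set (En n)) (h : En n → ℝ) : Prop :=
  ∃ C > 0, ∀ v, TestFun Ω v → C * ∫ x in Ω, ‖fderiv ℝ v x‖ ^ 2 ≤ energy Ω h v

/-- The Rayleigh–Sobolev quotient associated with `-Δ + h` on `Ω`. -/
def rayleigh {n : ℕ} (Ω : Set (En n)) (h v : En n → ℝ) : ℝ :=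
  energy Ω h v / (∫ x in Ω, |v x| ^ twoStar n) ^ (2 / twoStar n)

/-- `I_h(Ω)`: the infimum of the Rayleigh–Sobolev quotient over nonzero functions. -/
def Ih {n : ℕ} (Ω : Set (En n)) (h : En n → ℝ) : ℝ :=
  sInf (rayleigh Ω h '' {v | TestFun Ω v ∧ v ≠ 0})

/-- `K_n^{-2}`: the best constant in the Sobolev inequality on `ℝⁿ`. -/
def KnInvSq (n : ℕ) : ℝ :=
  sInf ((fun v : En n → ℝ =>
      (∫ x, ‖fderiv ℝ v x‖ ^ 2) / (∫ x, |v x| ^ twoStar n) ^ (2 / twoStar n)) ''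
    {v : En n → ℝ | ContDiff ℝ (⊤ : ℕ∞) v ∧ HasCompactSupport v ∧ v ≠ 0})

/-- `v` is a (classical) solution of `-Δv + h v = |v|^{2*-2} v` in `Ω`, `v = 0` on `∂Ω`. -/
def IsSolution {n : ℕ} (Ω : Set (En n)) (h v : En n → ℝ) : Prop :=
  ContDiffOn ℝ 2 v (closure Ω) ∧
  (∀ x ∈ Ω, -lap v x + h x * v x = |v x| ^ (twoStar n - 2) * v x) ∧
  ∀ x ∈ frontier Ω, v x = 0

/-- `v` changes sign in `Ω`: both its positive and negative parts are nonzero. -/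
def SignChanging {n : ℕ} (Ω : Set (En n)) (v : En n → ℝ) : Prop :=
  (∃ x ∈ Ω, 0 < v x) ∧ ∃ x ∈ Ω, v x < 0

/-- The sup norm of `v` on `Ω̄`. -/
def supNorm {n : ℕ} (Ω : Set (En n)) (v : En n → ℝ) : ℝ :=
  ⨆ x ∈ closure Ω, |v x|

/-- Convergence in `C⁰(s)`: uniform convergence on `s`. -/
def TendstoC0On {n : ℕ} (v : ℕ → En n → ℝ) (w : En n → ℝ) (s : Set (En n)) : Prop :=
  TendstoUniformlyOn (fun α x => v α x) w atTop s

/-- Convergence in `C¹(s)`. -/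
def TendstoC1On {n : ℕ} (v : ℕ → En n → ℝ) (w : En n → ℝ) (s : Set (En n)) : Prop :=
  TendstoUniformlyOn (fun α x => v α x) w atTop s ∧
  TendstoUniformlyOn (fun α x => fderiv ℝ (v α) x) (fderiv ℝ w) atTop s

/-- Convergence in `C²(s)`. -/
def TendstoC2On {n : ℕ} (v : ℕ → En n → ℝ) (w : En n → ℝ) (s : Set (En n)) : Prop :=
  TendstoUniformlyOn (fun α x => v α x) w atTop s ∧
  TendstoUniformlyOn (fun α x => fderiv ℝ (v α) x) (fderiv ℝ w) atTop s ∧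
  TendstoUniformlyOn (fun α x => iteratedFDeriv ℝ 2 (v α) x) (iteratedFDeriv ℝ 2 w) atTop s

/-- Convergence in `C²_loc` on the region `s`: `C²` convergence on every compact subset. -/
def TendstoC2Loc {n : ℕ} (v : ℕ → En n → ℝ) (w : En n → ℝ) (s : Set (En n)) : Prop :=
  ∀ K, K ⊆ s → IsCompact K → TendstoC2On v w K

/-- The standard bubble `B₀(x) = (1 + |x|²/(n(n-2)))^{-(n-2)/2}`. -/
def B0 (n : ℕ) (x : En n) : ℝ :=
  (1 + ‖x‖ ^ 2 / ((n : ℝ) * ((n : ℝ) - 2))) ^ (-(((n : ℝ) - 2) / 2))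

/-- The rescaled bubble `B_α` centered at `x0` with concentration scale `μ`. -/
def bubble (n : ℕ) (μ : ℝ) (x0 : En n) (x : En n) : ℝ :=
  μ ^ (-(((n : ℝ) - 2) / 2)) * B0 n (μ⁻¹ • (x - x0))

/-- `w = ΠB`: `w` solves `(-Δ + h) w = B^{2*-1}` in `Ω` with zero boundary values. -/
def IsBubbleProj {n : ℕ} (Ω : Set (En n)) (h : En n → ℝ) (μ : ℝ) (x0 : En n)
    (w : En n → ℝ) : Prop :=
  ContDiffOn ℝ 2 w (closure Ω) ∧
  (∀ x ∈ Ω, -lap w x + h x * w x = bubble n μ x0 x ^ (twoStar n - 1)) ∧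
  ∀ x ∈ frontier Ω, w x = 0

/-- Weak `H¹₀(Ω)` convergence, tested against gradients of smooth test functions. -/
def WeakH10Tendsto {n : ℕ} (Ω : Set (En n)) (v : ℕ → En n → ℝ) (w : En n → ℝ) : Prop :=
  ∀ ψ, TestFun Ω ψ →
    Tendsto (fun α => ∫ x in Ω, ⟪gradient (v α) x, gradient ψ x⟫)
      atTop (𝓝 (∫ x in Ω, ⟪gradient w x, gradient ψ x⟫))

/-- Strong `H¹₀(Ω)` convergence. -/
def StrongH10Tendsto {n : ℕ} (Ω : Set (En n)) (v : ℕ → En n → ℝ) (w : En n → ℝ) : Prop :=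
  Tendsto (fun α => ∫ x in Ω, ‖gradient (v α) x - gradient w x‖ ^ 2) atTop (𝓝 0)



/-- the coordinate vector -/
abbrev ee {n : ℕ} (i : Fin n) : En n := EuclideanSpace.single i 1

lemma norm_ee {n : ℕ} (i : Fin n) : ‖(ee i : En n)‖ = 1 := by simp [ee]

lemma dual_sum_sq {n : ℕ} (L : En n →L[ℝ] ℝ) : ∑ i, (L (ee i)) ^ 2 = ‖L‖ ^ 2 := by
  have h := (EuclideanSpace.basisFun (Fin n) ℝ).norm_dual L
  rw [h]
  refine Finset.sum_congr rfl fun i _ => ?_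
  simp [ee]

lemma dual_sum_mul {n : ℕ} (L : En n →L[ℝ] ℝ) (x : En n) : ∑ i, L (ee i) * x i = L x := by
  have : x = ∑ i, x i • (ee i : En n) := by
    have := (EuclideanSpace.basisFun (Fin n) ℝ).sum_repr x
    simpa [ee] using this.symm
  conv_rhs => rw [this]
  simp [mul_comm]

lemma fderiv_c1_of_c2 {n : ℕ} {f : En n → ℝ} {x : En n} (hf : ContDiffAt ℝ 2 f x) :
    ContDiffAt ℝ 1 (fderiv ℝ f) x := hf.fderiv_right (by norm_num)

lemma diff_dir {n : ℕ} {f : En n → ℝ} {x : En n} (hf : ContDiffAt ℝ 2 f x) (e : En n) :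
    DifferentiableAt ℝ (fun y => fderiv ℝ f y e) x :=
  ((fderiv_c1_of_c2 hf).differentiableAt (by norm_num)).clm_apply (differentiableAt_const _)

lemma ev_diff {n : ℕ} {f : En n → ℝ} {x : En n} (hf : ContDiffAt ℝ 2 f x) :
    ∀ᶠ y in 𝓝 x, DifferentiableAt ℝ f y := by
  filter_upwards [hf.eventually (by simp)] with y hy using hy.differentiableAt (by norm_num)

lemma lap_congr {n : ℕ} {f g : En n → ℝ} {x : En n} (h : f =ᶠ[𝓝 x] g) : lap f x = lap g x := by
  unfold lap
  refine Finset.sum_congr rfl fun i _ => ?_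
  have : (fun y => fderiv ℝ f y (EuclideanSpace.single i 1)) =ᶠ[𝓝 x]
      fun y => fderiv ℝ g y (EuclideanSpace.single i 1) := by
    filter_upwards [h.eventuallyEq_nhds] with y hy
    rw [hy.fderiv_eq]
  rw [this.fderiv_eq]

lemma lap_eq_dd {n : ℕ} {f : En n → ℝ} {x : En n} (hf : ContDiffAt ℝ 2 f x) :
    lap f x = ∑ i, fderiv ℝ (fderiv ℝ f) x (ee i) (ee i) := by
  unfold lap
  refine Finset.sum_congr rfl fun i _ => ?_
  have h1 : DifferentiableAt ℝ (fderiv ℝ f) x :=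
    (fderiv_c1_of_c2 hf).differentiableAt (by norm_num)
  rw [fderiv_clm_apply h1 (differentiableAt_const _)]
  simp

lemma lap_add {n : ℕ} {f g : En n → ℝ} {x : En n} (hf : ContDiffAt ℝ 2 f x)
    (hg : ContDiffAt ℝ 2 g x) : lap (fun y => f y + g y) x = lap f x + lap g x := by
  unfold lap
  rw [← Finset.sum_add_distrib]
  refine Finset.sum_congr rfl fun i _ => ?_
  have : (fun y => fderiv ℝ (fun z => f z + g z) y (ee i)) =ᶠ[𝓝 x]
      fun y => fderiv ℝ f y (ee i) + fderiv ℝ g y (ee i) := by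
    filter_upwards [ev_diff hf, ev_diff hg] with y h1 h2
    rw [fderiv_fun_add h1 h2]; rfl
  rw [this.fderiv_eq, fderiv_fun_add (diff_dir hf _) (diff_dir hg _)]; rfl

lemma lap_const_mul {n : ℕ} {f : En n → ℝ} {x : En n} (c : ℝ) (hf : ContDiffAt ℝ 2 f x) :
    lap (fun y => c * f y) x = c * lap f x := by
  unfold lap
  rw [Finset.mul_sum]
  refine Finset.sum_congr rfl fun i _ => ?_
  have : (fun y => fderiv ℝ (fun z => c * f z) y (ee i)) =ᶠ[𝓝 x]
      fun y => c * fderiv ℝ f y (ee i) := by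
    filter_upwards [ev_diff hf] with y h1
    rw [fderiv_const_mul h1]; simp
  rw [this.fderiv_eq, fderiv_const_mul (diff_dir hf _)]; simp

lemma lap_sub {n : ℕ} {f g : En n → ℝ} {x : En n} (hf : ContDiffAt ℝ 2 f x)
    (hg : ContDiffAt ℝ 2 g x) : lap (fun y => f y - g y) x = lap f x - lap g x := by
  have h := lap_add hf (contDiffAt_const.mul hg : ContDiffAt ℝ 2 (fun y => (-1:ℝ) * g y) x)
  rw [lap_const_mul (-1) hg] at h
  have e : (fun y => f y - g y) = fun y => f y + (-1) * g y := by funext y; ring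
  rw [e, h]; ring

lemma lap_neg {n : ℕ} {f : En n → ℝ} {x : En n} (hf : ContDiffAt ℝ 2 f x) :
    lap (fun y => - f y) x = - lap f x := by
  have h := lap_const_mul (-1) hf
  have e : (fun y => - f y) = fun y => (-1) * f y := by funext y; ring
  rw [e, h]; ring

lemma lap_comp {n : ℕ} {f : En n → ℝ} {x : En n} {T T' : ℝ → ℝ} {T'' : ℝ}
    (hf : ContDiffAt ℝ 2 f x)
    (h1 : ∀ᶠ t in 𝓝 (f x), HasDerivAt T (T' t) t) (h2 : HasDerivAt T' T'' (f x)) :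
    lap (fun y => T (f y)) x = T'' * ‖fderiv ℝ f x‖ ^ 2 + T' (f x) * lap f x := by
  unfold lap
  rw [← dual_sum_sq, Finset.mul_sum, Finset.mul_sum, ← Finset.sum_add_distrib]
  refine Finset.sum_congr rfl fun i _ => ?_
  have hd : DifferentiableAt ℝ f x := hf.differentiableAt (by norm_num)
  have : (fun y => fderiv ℝ (fun z => T (f z)) y (ee i)) =ᶠ[𝓝 x]
      fun y => T' (f y) * fderiv ℝ f y (ee i) := by
    filter_upwards [ev_diff hf, hd.continuousAt.eventually h1] with y h3 h4
    have h5 : HasFDerivAt (fun z => T (f z)) (T' (f y) • fderiv ℝ f y) y :=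
      h4.comp_hasFDerivAt y h3.hasFDerivAt
    rw [h5.fderiv]; simp
  rw [this.fderiv_eq]
  have h5 : HasFDerivAt (fun y => T' (f y)) (T'' • fderiv ℝ f x) x :=
    h2.comp_hasFDerivAt x hd.hasFDerivAt
  rw [(h5.fun_mul (diff_dir hf (ee i)).hasFDerivAt).fderiv]
  simp; ring

lemma deriv2_nonpos {g g' : ℝ → ℝ} {c : ℝ} (hm : IsLocalMax g 0)
    (h1 : ∀ᶠ t in 𝓝 0, HasDerivAt g (g' t) t) (h2 : HasDerivAt g' c 0) : c ≤ 0 := by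
  by_contra hc
  push Not at hc
  have e1 : deriv g =ᶠ[𝓝 0] g' := by filter_upwards [h1] with t ht using ht.deriv
  have e2 : deriv (deriv g) 0 = c := by rw [e1.deriv_eq, h2.deriv]
  have h0 : deriv g 0 = 0 := hm.deriv_eq_zero
  have hmin := isLocalMin_of_deriv_deriv_pos (by rw [e2]; exact hc) h0
    h1.self_of_nhds.continuousAt
  have hconst : g =ᶠ[𝓝 0] fun _ => g 0 := by
    filter_upwards [hm, hmin] with t a b using le_antisymm a b
  have : deriv g =ᶠ[𝓝 0] fun _ => 0 := by
    filter_upwards [hconst.eventuallyEq_nhds] with t ht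
    rw [ht.deriv_eq]; simp
  rw [this.deriv_eq] at e2
  simp at e2; linarith

lemma lap_nonpos_of_max {n : ℕ} {f : En n → ℝ} {x : En n} (hf : ContDiffAt ℝ 2 f x)
    (hm : IsLocalMax f x) : lap f x ≤ 0 := by
  unfold lap
  refine Finset.sum_nonpos fun i _ => ?_
  have hl : ∀ t : ℝ, HasDerivAt (fun t : ℝ => x + t • (ee i : En n)) (ee i) t := by
    intro t
    simpa using ((hasDerivAt_id t).smul_const (ee i : En n)).const_add x
  have hc : Tendsto (fun t : ℝ => x + t • (ee i : En n)) (𝓝 0) (𝓝 x) := by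
    have := (hl 0).continuousAt.tendsto
    simpa using this
  refine deriv2_nonpos (g := fun t : ℝ => f (x + t • ee i))
    (g' := fun t => fderiv ℝ f (x + t • ee i) (ee i)) ?_ ?_ ?_
  · have := hc.eventually hm
    simpa [IsLocalMax, IsMaxFilter] using this
  · filter_upwards [hc.eventually (ev_diff hf)] with t ht
    exact ht.hasFDerivAt.comp_hasDerivAt t (hl t)
  · have h : HasFDerivAt (fun y => fderiv ℝ f y (ee i)) (fderiv ℝ (fun y => fderiv ℝ f y (ee i)) x)
      (x + (0:ℝ) • ee i) := by
      simpa using (diff_dir hf (ee i)).hasFDerivAt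
    exact h.comp_hasDerivAt (0:ℝ) (hl 0)

lemma lap_le_of_touch {n : ℕ} {f g : En n → ℝ} {x : En n} (hf : ContDiffAt ℝ 2 f x)
    (hg : ContDiffAt ℝ 2 g x) (h : ∀ᶠ y in 𝓝 x, f y ≤ g y) (h0 : f x = g x) :
    lap f x ≤ lap g x := by
  have := lap_nonpos_of_max (f := fun y => f y - g y) (hf.sub hg) (by
    filter_upwards [h] with y hy
    simp [h0]; exact hy)
  rw [lap_sub hf hg] at this
  linarith

/-- zero-boundary class -/
structure XX {n : ℕ} (Ω : Set (En n)) (φ : En n → ℝ) : Prop where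
  c2 : ContDiffOn ℝ 2 φ (closure Ω)
  bd : ∀ x ∈ frontier Ω, φ x = 0

lemma XX.at {n : ℕ} {Ω : Set (En n)} {φ : En n → ℝ} (h : XX Ω φ) (ho : IsOpen Ω)
    {x : En n} (hx : x ∈ Ω) : ContDiffAt ℝ 2 φ x :=
  (h.c2 x (subset_closure hx)).contDiffAt
    (mem_of_superset (ho.mem_nhds hx) subset_closure)

lemma c2_bound {n : ℕ} {Ω : Set (En n)} {φ : En n → ℝ} (ho : IsOpen Ω)
    (hb : Bornology.IsBounded Ω) (h : ContDiffOn ℝ 2 φ (closure Ω)) :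
    ∃ K, 0 < K ∧ ∀ x ∈ Ω, |φ x| ≤ K ∧ ‖fderiv ℝ φ x‖ ≤ K ∧ |lap φ x| ≤ K := by
  have hK : IsCompact (closure Ω) := hb.isCompact_closure
  have key : ∃ K, ∀ x ∈ closure Ω ∩ Ω, |φ x| ≤ K ∧ ‖fderiv ℝ φ x‖ ≤ K ∧
      ‖fderiv ℝ (fderiv ℝ φ) x‖ ≤ K := by
    refine hK.induction_on (p := fun s => ∃ K, ∀ x ∈ s ∩ Ω, |φ x| ≤ K ∧ ‖fderiv ℝ φ x‖ ≤ K ∧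
      ‖fderiv ℝ (fderiv ℝ φ) x‖ ≤ K) ⟨0, by simp⟩ ?_ ?_ ?_
    · rintro s t hst ⟨K, hK⟩
      exact ⟨K, fun x hx => hK x ⟨hst hx.1, hx.2⟩⟩
    · rintro s t ⟨K, hK⟩ ⟨K', hK'⟩
      refine ⟨max K K', fun x hx => ?_⟩
      rcases hx.1 with hx1 | hx1
      · obtain ⟨a, b, c⟩ := hK x ⟨hx1, hx.2⟩
        exact ⟨a.trans (le_max_left _ _), b.trans (le_max_left _ _), c.trans (le_max_left _ _)⟩
      · obtain ⟨a, b, c⟩ := hK' x ⟨hx1, hx.2⟩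
        exact ⟨a.trans (le_max_right _ _), b.trans (le_max_right _ _), c.trans (le_max_right _ _)⟩
    · intro x hx
      have h2 : ContDiffWithinAt ℝ (1 + 1) φ (closure Ω) x := by
        have := h x hx
        norm_num
        exact this
      obtain ⟨u, hu, -, -, f', hf', hf'c⟩ :=
        (contDiffWithinAt_succ_iff_hasFDerivWithinAt' (by norm_num)).1 h2
      have h3 : ContDiffWithinAt ℝ (0 + 1) f' (closure Ω) x := by simpa using hf'c
      obtain ⟨u2, hu2, -, -, f'', hf'', hf''c⟩ :=
        (contDiffWithinAt_succ_iff_hasFDerivWithinAt' (by norm_num)).1 h3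
      rw [Set.insert_eq_of_mem hx] at hu hu2
      have c0 := (h x hx).continuousWithinAt.norm
      have c1 := hf'c.continuousWithinAt.norm
      have c2 := hf''c.continuousWithinAt.norm
      have b0 : ∀ᶠ y in 𝓝[closure Ω] x, ‖φ y‖ < ‖φ x‖ + 1 :=
        c0.eventually (gt_mem_nhds (by linarith))
      have b1 : ∀ᶠ y in 𝓝[closure Ω] x, ‖f' y‖ < ‖f' x‖ + 1 :=
        c1.eventually (gt_mem_nhds (by linarith))
      have b2 : ∀ᶠ y in 𝓝[closure Ω] x, ‖f'' y‖ < ‖f'' x‖ + 1 :=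
        c2.eventually (gt_mem_nhds (by linarith))
      have hu' : ∀ᶠ y in 𝓝[closure Ω] x, y ∈ u := hu
      have hu2' : ∀ᶠ y in 𝓝[closure Ω] x, y ∈ u2 := hu2
      have hall := ((b0.and b1).and b2).and (hu'.and hu2')
      obtain ⟨W, hWo, hxW, hW⟩ := mem_nhdsWithin.1 hall
      refine ⟨W ∩ closure Ω, ?_, max (‖φ x‖ + 1) (max (‖f' x‖ + 1) (‖f'' x‖ + 1)), ?_⟩
      · exact mem_nhdsWithin.2 ⟨W, hWo, hxW, subset_rfl⟩
      · rintro y ⟨⟨hyW, -⟩, hyΩ⟩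
        have hloc : ∀ z ∈ W ∩ Ω, fderiv ℝ φ z = f' z := by
          rintro z ⟨hzW, hzΩ⟩
          have := (hW ⟨hzW, subset_closure hzΩ⟩).2.1
          exact ((hf' z this).hasFDerivAt
            (mem_of_superset (ho.mem_nhds hzΩ) subset_closure)).fderiv
        have hy := hW ⟨hyW, subset_closure hyΩ⟩
        have e1 := hloc y ⟨hyW, hyΩ⟩
        have e2 : fderiv ℝ (fderiv ℝ φ) y = f'' y := by
          have : fderiv ℝ φ =ᶠ[𝓝 y] f' :=
            mem_of_superset ((hWo.inter ho).mem_nhds ⟨hyW, hyΩ⟩) hloc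
          rw [this.fderiv_eq]
          exact ((hf'' y hy.2.2).hasFDerivAt
            (mem_of_superset (ho.mem_nhds hyΩ) subset_closure)).fderiv
        rw [e1, e2]
        refine ⟨?_, ?_, ?_⟩
        · exact (hy.1.1.1.le).trans (le_max_left _ _)
        · exact (hy.1.1.2.le).trans ((le_max_left _ _).trans (le_max_right _ _))
        · exact (hy.1.2.le).trans ((le_max_right _ _).trans (le_max_right _ _))
  obtain ⟨K, hK⟩ := key
  refine ⟨max 1 (max K (n * K)), by positivity, fun x hx => ?_⟩
  obtain ⟨a, b, c⟩ := hK x ⟨subset_closure hx, hx⟩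
  refine ⟨a.trans ((le_max_left _ _).trans (le_max_right _ _)),
    b.trans ((le_max_left _ _).trans (le_max_right _ _)), ?_⟩
  have hφ : ContDiffAt ℝ 2 φ x := (h x (subset_closure hx)).contDiffAt
    (mem_of_superset (ho.mem_nhds hx) subset_closure)
  rw [lap_eq_dd hφ]
  refine ((Finset.abs_sum_le_sum_abs _ _).trans ?_).trans
    ((le_max_right _ _).trans (le_max_right _ _))
  have : ∀ i ∈ (Finset.univ : Finset (Fin n)), |fderiv ℝ (fderiv ℝ φ) x (ee i) (ee i)| ≤ K := by
    intro i _
    have h1 := (fderiv ℝ (fderiv ℝ φ) x (ee i)).le_opNorm (ee i)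
    have h2 := (fderiv ℝ (fderiv ℝ φ) x).le_opNorm (ee i)
    rw [norm_ee, mul_one] at h1 h2
    exact (h1.trans h2).trans c
  simpa using Finset.sum_le_card_nsmul _ _ _ this


lemma hasDerivAt_maxpow (k : ℕ) (t : ℝ) :
    HasDerivAt (fun t : ℝ => max t 0 ^ (k + 2)) (((k : ℝ) + 2) * max t 0 ^ (k + 1)) t := by
  rcases lt_trichotomy t 0 with h | h | h
  · have e : (fun t : ℝ => max t 0 ^ (k + 2)) =ᶠ[𝓝 t] fun _ => 0 := by
      filter_upwards [gt_mem_nhds h] with s hs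
      rw [max_eq_right hs.le]; simp
    rw [max_eq_right h.le]
    simpa using (hasDerivAt_const t (0:ℝ)).congr_of_eventuallyEq e
  · subst h
    have h2 : HasDerivAt (fun t : ℝ => t ^ 2) 0 0 := by simpa using hasDerivAt_pow 2 (0:ℝ)
    simp only [max_self]
    rw [hasDerivAt_iff_isLittleO] at h2 ⊢
    simp at h2 ⊢
    refine Asymptotics.IsBigO.trans_isLittleO ?_ h2
    refine Asymptotics.IsBigO.of_bound 1 ?_
    filter_upwards [gt_mem_nhds (zero_lt_one : (0:ℝ) < 1)] with s hs
    have h3 : 0 ≤ max s 0 := le_max_right _ _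
    have h4 : max s 0 ≤ 1 := max_le hs.le zero_le_one
    rw [Real.norm_of_nonneg (by positivity), Real.norm_of_nonneg (by positivity), one_mul]
    calc max s 0 ^ (k + 2) = max s 0 ^ k * max s 0 ^ 2 := by ring
      _ ≤ 1 * max s 0 ^ 2 := by gcongr; exact pow_le_one₀ h3 h4
      _ ≤ s ^ 2 := by
        rw [one_mul]
        rcases le_total s 0 with h | h
        · rw [max_eq_right h]; nlinarith [sq_nonneg s]
        · rw [max_eq_left h]
  · have e : (fun t : ℝ => max t 0 ^ (k + 2)) =ᶠ[𝓝 t] fun t => t ^ (k + 2) := by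
      filter_upwards [lt_mem_nhds h] with s hs
      rw [max_eq_left hs.le]
    rw [max_eq_left h.le]
    have := (hasDerivAt_pow (k + 2) t).congr_of_eventuallyEq e
    simpa using this

lemma hasDerivAt_maxpow' (k : ℕ) (ε t : ℝ) :
    HasDerivAt (fun t : ℝ => max (t - ε) 0 ^ (k + 2)) (((k : ℝ) + 2) * max (t - ε) 0 ^ (k + 1)) t := by
  have := (hasDerivAt_maxpow k (t - ε)).comp t ((hasDerivAt_id t).sub_const ε)
  rw [mul_one] at this
  exact this

def T1 (ε t : ℝ) : ℝ := √(max (t - ε) 0 ^ 2 + ε ^ 2) - ε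
def T1' (ε t : ℝ) : ℝ := max (t - ε) 0 / √(max (t - ε) 0 ^ 2 + ε ^ 2)
def T3 (ε t : ℝ) : ℝ := max (t - ε) 0 ^ 3
def T3' (ε t : ℝ) : ℝ := 3 * max (t - ε) 0 ^ 2

lemma T1_deriv {ε : ℝ} (hε : 0 < ε) (t : ℝ) : HasDerivAt (T1 ε) (T1' ε t) t := by
  have h := (hasDerivAt_maxpow' 0 ε t).add_const (ε ^ 2)
  have h2 := (h.sqrt (by positivity)).sub_const ε
  refine h2.congr_deriv ?_
  unfold T1'
  norm_num
  field_simp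

lemma T1'_cont {ε : ℝ} (hε : 0 < ε) : Continuous (T1' ε) := by
  unfold T1'
  refine Continuous.div (by fun_prop) (by fun_prop) fun t => ?_
  positivity

lemma T1_c1 {ε : ℝ} (hε : 0 < ε) : ContDiff ℝ 1 (T1 ε) := by
  rw [contDiff_one_iff_deriv]
  refine ⟨fun t => (T1_deriv hε t).differentiableAt, ?_⟩
  rw [show deriv (T1 ε) = T1' ε from funext fun t => (T1_deriv hε t).deriv]
  exact T1'_cont hε

lemma T1_zero {ε : ℝ} (hε : 0 < ε) {t : ℝ} (h : t ≤ ε) : T1 ε t = 0 := by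
  unfold T1
  rw [max_eq_right (by linarith)]
  simp [Real.sqrt_sq hε.le]

lemma T1'_zero {ε : ℝ} {t : ℝ} (h : t ≤ ε) : T1' ε t = 0 := by
  unfold T1'
  rw [max_eq_right (by linarith)]
  simp

lemma T1'_nonneg {ε : ℝ} (t : ℝ) : 0 ≤ T1' ε t := by unfold T1'; positivity

lemma T1'_le_one {ε : ℝ} (t : ℝ) : T1' ε t ≤ 1 := by
  unfold T1'
  refine div_le_one_of_le₀ ?_ (Real.sqrt_nonneg _)
  refine Real.le_sqrt_of_sq_le ?_
  nlinarith [sq_nonneg ε]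

lemma T1_nonneg {ε : ℝ} (hε : 0 < ε) (t : ℝ) : 0 ≤ T1 ε t := by
  unfold T1
  have : ε ≤ √(max (t - ε) 0 ^ 2 + ε ^ 2) := Real.le_sqrt_of_sq_le (by nlinarith [sq_nonneg (max (t - ε) 0)])
  linarith

lemma T1_le {ε : ℝ} (hε : 0 < ε) (t : ℝ) : T1 ε t ≤ max t 0 := by
  unfold T1
  have hm : 0 ≤ max (t - ε) 0 := le_max_right _ _
  have h1 : √(max (t - ε) 0 ^ 2 + ε ^ 2) ≤ max (t - ε) 0 + ε := by
    refine Real.sqrt_le_iff.2 ⟨by positivity, by nlinarith⟩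
  have h2 : max (t - ε) 0 ≤ max t 0 := max_le_max (by linarith) le_rfl
  linarith

lemma T1_ge {ε : ℝ} (hε : 0 < ε) (t : ℝ) : max t 0 - 2 * ε ≤ T1 ε t := by
  unfold T1
  have h1 : max (t - ε) 0 ≤ √(max (t - ε) 0 ^ 2 + ε ^ 2) :=
    Real.le_sqrt_of_sq_le (by nlinarith [sq_nonneg ε])
  have h2 : max t 0 ≤ max (t - ε) 0 + ε := by
    refine max_le ?_ ?_
    · linarith [le_max_left (t - ε) 0]
    · linarith [le_max_right (t - ε) 0]
  linarith

lemma T3_deriv (ε t : ℝ) : HasDerivAt (T3 ε) (T3' ε t) t := by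
  have := hasDerivAt_maxpow' 1 ε t
  refine this.congr_deriv ?_
  unfold T3'; norm_num

lemma T3'_deriv (ε t : ℝ) : HasDerivAt (T3' ε) (6 * max (t - ε) 0) t := by
  have := (hasDerivAt_maxpow' 0 ε t).const_mul 3
  refine this.congr_deriv ?_
  norm_num; ring

lemma T3_c2 (ε : ℝ) : ContDiff ℝ 2 (T3 ε) := by
  have h1 : ContDiff ℝ 1 (T3' ε) := by
    rw [contDiff_one_iff_deriv]
    refine ⟨fun t => (T3'_deriv ε t).differentiableAt, ?_⟩
    rw [show deriv (T3' ε) = fun t => 6 * max (t - ε) 0 from funext fun t => (T3'_deriv ε t).deriv]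
    fun_prop
  rw [show (2 : WithTop ℕ∞) = 1 + 1 by norm_num, contDiff_succ_iff_deriv]
  refine ⟨fun t => (T3_deriv ε t).differentiableAt, by simp, ?_⟩
  rw [show deriv (T3 ε) = T3' ε from funext fun t => (T3_deriv ε t).deriv]
  exact h1

lemma T3_zero {ε t : ℝ} (h : t ≤ ε) : T3 ε t = 0 := by
  unfold T3
  rw [max_eq_right (by linarith)]; simp

/-- truncation extended by zero -/
def tr {n : ℕ} (Ω : Set (En n)) (T : ℝ → ℝ) (φ : En n → ℝ) : En n → ℝ :=
  Ω.indicator (fun x => T (φ x))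

section
variable {n : ℕ} {Ω : Set (En n)} {φ : En n → ℝ} {T : ℝ → ℝ} {ε : ℝ}

lemma tr_mem {x : En n} (hx : x ∈ Ω) : tr Ω T φ x = T (φ x) := Set.indicator_of_mem hx _
lemma tr_not {x : En n} (hx : x ∉ Ω) : tr Ω T φ x = 0 := Set.indicator_of_notMem hx _

lemma tr_ev_mem (ho : IsOpen Ω) {x : En n} (hx : x ∈ Ω) :
    tr Ω T φ =ᶠ[𝓝 x] fun y => T (φ y) := by
  filter_upwards [ho.mem_nhds hx] with y hy using tr_mem hy

lemma tr_compact (hb : Bornology.IsBounded Ω) (hc : ContinuousOn φ (closure Ω)) :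
    IsCompact {x ∈ closure Ω | ε ≤ |φ x|} := by
  have := hc.abs.preimage_isClosed_of_isClosed isClosed_closure (isClosed_Ici (a := ε))
  exact hb.isCompact_closure.of_isClosed_subset this (fun x hx => hx.1)

lemma tr_sub (ho : IsOpen Ω) (bd : ∀ x ∈ frontier Ω, φ x = 0) (hε : 0 < ε) :
    {x ∈ closure Ω | ε ≤ |φ x|} ⊆ Ω := by
  rintro x ⟨h1, h2⟩
  by_contra h
  have : x ∈ frontier Ω := by rw [ho.frontier_eq]; exact ⟨h1, h⟩
  rw [bd x this] at h2; simp at h2; linarith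

lemma tr_zero_off (hT : ∀ t, |t| ≤ ε → T t = 0) {x : En n}
    (hx : x ∉ {x ∈ closure Ω | ε ≤ |φ x|}) : tr Ω T φ x = 0 := by
  by_cases h : x ∈ Ω
  · rw [tr_mem h]
    refine hT _ ?_
    by_contra h2
    exact hx ⟨subset_closure h, by linarith⟩
  · exact tr_not h

lemma tr_tsupport (hb : Bornology.IsBounded Ω) (hc : ContinuousOn φ (closure Ω))
    (hT : ∀ t, |t| ≤ ε → T t = 0) : tsupport (tr Ω T φ) ⊆ {x ∈ closure Ω | ε ≤ |φ x|} := by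
  refine closure_minimal ?_ (tr_compact hb hc).isClosed
  intro x hx
  by_contra h
  exact hx (tr_zero_off hT h)

lemma tr_hcs (hb : Bornology.IsBounded Ω) (hc : ContinuousOn φ (closure Ω))
    (hT : ∀ t, |t| ≤ ε → T t = 0) : HasCompactSupport (tr Ω T φ) :=
  (tr_compact hb hc).of_isClosed_subset (isClosed_tsupport _) (tr_tsupport hb hc hT)

lemma tr_tsupport' (ho : IsOpen Ω) (hb : Bornology.IsBounded Ω) (hc : ContinuousOn φ (closure Ω))
    (bd : ∀ x ∈ frontier Ω, φ x = 0) (hε : 0 < ε)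
    (hT : ∀ t, |t| ≤ ε → T t = 0) : tsupport (tr Ω T φ) ⊆ Ω :=
  (tr_tsupport hb hc hT).trans (tr_sub ho bd hε)

lemma tr_contDiff {k : WithTop ℕ∞} (ho : IsOpen Ω) (hb : Bornology.IsBounded Ω)
    (hc : ContinuousOn φ (closure Ω)) (hφ : ∀ x ∈ Ω, ContDiffAt ℝ k φ x)
    (bd : ∀ x ∈ frontier Ω, φ x = 0) (hε : 0 < ε) (hTc : ContDiff ℝ k T)
    (hT : ∀ t, |t| ≤ ε → T t = 0) : ContDiff ℝ k (tr Ω T φ) := by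
  rw [contDiff_iff_contDiffAt]
  intro x
  by_cases h : x ∈ {x ∈ closure Ω | ε ≤ |φ x|}
  · have hx := tr_sub ho bd hε h
    exact (hTc.contDiffAt.comp x (hφ x hx)).congr_of_eventuallyEq (tr_ev_mem ho hx)
  · have : tr Ω T φ =ᶠ[𝓝 x] fun _ => 0 := by
      filter_upwards [(tr_compact hb hc).isClosed.isOpen_compl.mem_nhds h] with y hy
      exact tr_zero_off hT hy
    exact contDiffAt_const.congr_of_eventuallyEq this

lemma tr_fderiv_mem (ho : IsOpen Ω) {x : En n} (hx : x ∈ Ω) (hφ : DifferentiableAt ℝ φ x) {T' : ℝ}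
    (hT : HasDerivAt T T' (φ x)) : fderiv ℝ (tr Ω T φ) x = T' • fderiv ℝ φ x := by
  rw [(tr_ev_mem ho hx).fderiv_eq]
  exact (hT.comp_hasFDerivAt x hφ.hasFDerivAt).fderiv

lemma fderiv_off {τ : En n → ℝ} (hs : tsupport τ ⊆ Ω) {x : En n} (hx : x ∉ Ω) :
    fderiv ℝ τ x = 0 :=
  fderiv_of_notMem_tsupport ℝ (fun h => hx (hs h))

end

lemma T1_zero_abs {ε : ℝ} (hε : 0 < ε) (t : ℝ) (h : |t| ≤ ε) : T1 ε t = 0 :=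
  T1_zero hε ((le_abs_self t).trans h)

lemma T3_zero_abs {ε : ℝ} (t : ℝ) (h : |t| ≤ ε) : T3 ε t = 0 :=
  T3_zero ((le_abs_self t).trans h)

lemma XX.cont {n : ℕ} {Ω : Set (En n)} {φ : En n → ℝ} (h : XX Ω φ) : ContinuousOn φ (closure Ω) :=
  h.c2.continuousOn

/-- integral of a directional derivative of a compactly supported function vanishes -/
lemma integral_dir_zero {n : ℕ} {F : En n → ℝ} (hF : ContDiff ℝ 1 F) (hs : HasCompactSupport F)
    (e : En n) : ∫ x, fderiv ℝ F x e = 0 := by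
  have hc : Continuous (fun x => fderiv ℝ F x e) :=
    (hF.continuous_fderiv (by norm_num)).clm_apply continuous_const
  have hcs : HasCompactSupport (fun x => fderiv ℝ F x e) := hs.fderiv_apply ℝ e
  have := integral_mul_fderiv_eq_neg_fderiv_mul_of_integrable (μ := (volume : Measure (En n)))
    (f := fun _ : En n => (1:ℝ)) (g := F) (v := e) (by simp) ?_ ?_
    (by fun_prop) (fun x _ => hF.differentiable (by norm_num) x)
  · simpa using this
  · simpa using hc.integrable_of_hasCompactSupport hcs
  · simpa using hF.continuous.integrable_of_hasCompactSupport hs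

lemma tsup_mul_contDiff {n : ℕ} {Ω : Set (En n)} {τ g : En n → ℝ}
    (hτ : ContDiff ℝ 1 τ) (hs : tsupport τ ⊆ Ω) (hg : ∀ x ∈ Ω, ContDiffAt ℝ 1 g x) :
    ContDiff ℝ 1 (fun x => τ x * g x) := by
  rw [contDiff_iff_contDiffAt]
  intro x
  by_cases h : x ∈ tsupport τ
  · exact hτ.contDiffAt.mul (hg x (hs h))
  · have : (fun x => τ x * g x) =ᶠ[𝓝 x] fun _ => 0 := by
      filter_upwards [(isClosed_tsupport τ).isOpen_compl.mem_nhds h] with y hy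
      rw [image_eq_zero_of_notMem_tsupport hy, zero_mul]
    exact contDiffAt_const.congr_of_eventuallyEq this

lemma ibp_dir {n : ℕ} {Ω : Set (En n)} {τ g : En n → ℝ}
    (hτ : ContDiff ℝ 1 τ) (hcs : HasCompactSupport τ) (hs : tsupport τ ⊆ Ω)
    (hg : ∀ x ∈ Ω, ContDiffAt ℝ 1 g x) (e : En n) :
    Integrable (fun x => fderiv ℝ τ x e * g x) ∧ Integrable (fun x => τ x * fderiv ℝ g x e) ∧
    ∫ x, fderiv ℝ τ x e * g x = - ∫ x, τ x * fderiv ℝ g x e := by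
  have hF := tsup_mul_contDiff hτ hs hg
  have hFs : HasCompactSupport (fun x => τ x * g x) := hcs.mul_right
  have h0 := integral_dir_zero hF hFs e
  have key : ∀ x, fderiv ℝ (fun x => τ x * g x) x e = fderiv ℝ τ x e * g x + τ x * fderiv ℝ g x e := by
    intro x
    by_cases h : x ∈ tsupport τ
    · rw [fderiv_fun_mul (hτ.differentiable (by norm_num) x)
        ((hg x (hs h)).differentiableAt (by norm_num))]
      simp; ring
    · have h1 : (fun x => τ x * g x) =ᶠ[𝓝 x] fun _ => 0 := by
        filter_upwards [(isClosed_tsupport τ).isOpen_compl.mem_nhds h] with y hy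
        rw [image_eq_zero_of_notMem_tsupport hy, zero_mul]
      rw [h1.fderiv_eq, fderiv_of_notMem_tsupport ℝ h, image_eq_zero_of_notMem_tsupport h]; simp
  have hI1 : Integrable (fun x => fderiv ℝ τ x e * g x) := by
    refine Continuous.integrable_of_hasCompactSupport ?_ (hcs.fderiv_apply ℝ e).mul_right
    rw [continuous_iff_continuousAt]
    intro x
    by_cases h : x ∈ tsupport τ
    · exact ((hτ.continuous_fderiv (by norm_num)).clm_apply continuous_const).continuousAt.mul
        (hg x (hs h)).continuousAt
    · have h1 : (fun x => fderiv ℝ τ x e * g x) =ᶠ[𝓝 x] fun _ => 0 := by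
        filter_upwards [(isClosed_tsupport τ).isOpen_compl.mem_nhds h] with y hy
        rw [fderiv_of_notMem_tsupport ℝ hy]; simp
      exact continuousAt_const.congr h1.symm
  have hI2 : Integrable (fun x => τ x * fderiv ℝ g x e) := by
    refine Continuous.integrable_of_hasCompactSupport ?_ hcs.mul_right
    rw [continuous_iff_continuousAt]
    intro x
    by_cases h : x ∈ tsupport τ
    · exact hτ.continuous.continuousAt.mul
        (((hg x (hs h)).fderiv_right (m := 0) (by norm_num)).continuousAt.clm_apply continuousAt_const)
    · have h1 : (fun x => τ x * fderiv ℝ g x e) =ᶠ[𝓝 x] fun _ => 0 := by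
        filter_upwards [(isClosed_tsupport τ).isOpen_compl.mem_nhds h] with y hy
        rw [image_eq_zero_of_notMem_tsupport hy, zero_mul]
      exact continuousAt_const.congr h1.symm
  refine ⟨hI1, hI2, ?_⟩
  simp_rw [key] at h0
  rw [integral_add hI1 hI2] at h0
  linarith

/-- integration by parts against a compactly supported function -/
lemma ibp {n : ℕ} {Ω : Set (En n)} {τ φ : En n → ℝ}
    (hτ : ContDiff ℝ 1 τ) (hcs : HasCompactSupport τ) (hs : tsupport τ ⊆ Ω)
    (hφ : ∀ x ∈ Ω, ContDiffAt ℝ 2 φ x) :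
    Integrable (fun x => τ x * lap φ x) ∧
    Integrable (fun x => ∑ i, fderiv ℝ τ x (ee i) * fderiv ℝ φ x (ee i)) ∧
    ∫ x, ∑ i, fderiv ℝ τ x (ee i) * fderiv ℝ φ x (ee i) = - ∫ x, τ x * lap φ x := by
  have hg : ∀ i : Fin n, ∀ x ∈ Ω, ContDiffAt ℝ 1 (fun y => fderiv ℝ φ y (ee i)) x := fun i x hx =>
    (fderiv_c1_of_c2 (hφ x hx)).clm_apply contDiffAt_const
  have h := fun i => ibp_dir hτ hcs hs (hg i) (ee i)
  have e : (fun x => τ x * lap φ x) = fun x => ∑ i, τ x * fderiv ℝ (fun y => fderiv ℝ φ y (ee i)) x (ee i) := by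
    funext x; unfold lap; rw [Finset.mul_sum]
  refine ⟨?_, integrable_finsetSum _ fun i _ => (h i).1, ?_⟩
  · rw [e]; exact integrable_finsetSum _ fun i _ => (h i).2.1
  · rw [e, integral_finsetSum _ fun i _ => (h i).1, integral_finsetSum _ fun i _ => (h i).2.1,
      ← Finset.sum_neg_distrib]
    exact Finset.sum_congr rfl fun i _ => (h i).2.2


lemma twoStar_pos {n : ℕ} (hn : 3 ≤ n) : 2 < twoStar n := by
  have h : (3:ℝ) ≤ n := by exact_mod_cast hn
  unfold twoStar
  rw [lt_div_iff₀ (by linarith)]; linarith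

lemma sobolev {n : ℕ} (hn : 3 ≤ n) : ∃ Cs : ℝ, 0 < Cs ∧ ∀ τ : En n → ℝ, ContDiff ℝ 1 τ →
    HasCompactSupport τ →
    (∫ x, |τ x| ^ twoStar n) ^ (2 / twoStar n) ≤ Cs * ∫ x, ‖fderiv ℝ τ x‖ ^ 2 := by
  have h : (3:ℝ) ≤ n := by exact_mod_cast hn
  have h2 := twoStar_pos hn
  set C := SNormLESNormFDerivOfEqConst ℝ (volume : Measure (En n)) (2:NNReal) with hC
  refine ⟨(C:ℝ) ^ 2 + 1, by positivity, fun τ hτ hcs => ?_⟩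
  have hcd := hτ.continuous_fderiv (by norm_num : (1:WithTop ℕ∞) ≠ 0)
  set p' : NNReal := ⟨twoStar n, by linarith⟩ with hp'
  have hp'c : (p' : ℝ) = twoStar n := rfl
  have key := eLpNorm_le_eLpNorm_fderiv_of_eq (volume : Measure (En n)) hτ hcs (p := 2) (p' := p')
    (by norm_num) (by simp; omega) (by
      rw [hp'c]; simp [twoStar]; field_simp; )
  have m1 : MemLp τ p' := hτ.continuous.memLp_of_hasCompactSupport hcs
  have m2 : MemLp (fderiv ℝ τ) (2:NNReal) := hcd.memLp_of_hasCompactSupport (hcs.fderiv ℝ)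
  have hp0 : (p' : ENNReal) ≠ 0 := by
    have : p' ≠ 0 := by
      intro h0; rw [h0] at hp'c; simp at hp'c; linarith
    exact_mod_cast this
  rw [m1.eLpNorm_eq_integral_rpow_norm hp0 ENNReal.coe_ne_top,
    m2.eLpNorm_eq_integral_rpow_norm (by norm_num) ENNReal.coe_ne_top, ← hC,
    ← ENNReal.ofReal_coe_nnreal (p := C), ← ENNReal.ofReal_mul (by positivity),
    ENNReal.ofReal_le_ofReal_iff (by positivity)] at key
  simp only [ENNReal.coe_toReal, hp'c] at key
  set A := ∫ x, |τ x| ^ twoStar n with hA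
  have hA' : ∫ a, ‖τ a‖ ^ twoStar n = A := rfl
  have hB' : ∫ a, ‖fderiv ℝ τ a‖ ^ ((2:NNReal):ℝ) = ∫ x, ‖fderiv ℝ τ x‖ ^ 2 := by
    congr 1; funext a
    rw [show ((2:NNReal):ℝ) = ((2:ℕ):ℝ) by norm_num, Real.rpow_natCast]
  rw [hA', hB'] at key
  set B := ∫ x, ‖fderiv ℝ τ x‖ ^ 2 with hB
  have hB0 : 0 ≤ B := by positivity
  have hA0 : 0 ≤ A := by positivity
  have k2 : (A ^ (twoStar n)⁻¹) ^ 2 ≤ (C * B ^ (((2:NNReal):ℝ))⁻¹) ^ 2 := by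
    gcongr
  have e1 : (A ^ (twoStar n)⁻¹) ^ 2 = A ^ (2 / twoStar n) := by
    rw [← Real.rpow_natCast, ← Real.rpow_mul hA0]; congr 1; push_cast; field_simp
  have e2 : (B ^ (((2:NNReal):ℝ))⁻¹) ^ 2 = B := by
    rw [← Real.rpow_natCast, ← Real.rpow_mul hB0]; norm_num
  rw [e1, mul_pow, e2] at k2
  nlinarith

lemma poincare {n : ℕ} (hn : 3 ≤ n) {Ω : Set (En n)} (hb : Bornology.IsBounded Ω) :
    ∃ Cp : ℝ, 0 < Cp ∧ ∀ τ : En n → ℝ, ContDiff ℝ 1 τ → HasCompactSupport τ →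
      tsupport τ ⊆ Ω → ∫ x, τ x ^ 2 ≤ Cp * ∫ x, ‖fderiv ℝ τ x‖ ^ 2 := by
  have h : (3:ℝ) ≤ n := by exact_mod_cast hn
  set C := eLpNormLESNormFDerivOfLeConst ℝ (volume : Measure (En n)) Ω (2:NNReal) (2:NNReal) with hC
  refine ⟨(C:ℝ) ^ 2 + 1, by positivity, fun τ hτ hcs hs => ?_⟩
  have hcd := hτ.continuous_fderiv (by norm_num : (1:WithTop ℕ∞) ≠ 0)
  have key := eLpNorm_le_eLpNorm_fderiv_of_le (volume : Measure (En n)) hτ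
    ((subset_tsupport τ).trans hs) (p := 2) (q := 2)
    (by norm_num) (by simp; exact_mod_cast (by omega : 2 < n)) (by simp) hb
  have m1 : MemLp τ (2:NNReal) := hτ.continuous.memLp_of_hasCompactSupport hcs
  have m2 : MemLp (fderiv ℝ τ) (2:NNReal) := hcd.memLp_of_hasCompactSupport (hcs.fderiv ℝ)
  rw [m1.eLpNorm_eq_integral_rpow_norm (by norm_num) ENNReal.coe_ne_top,
    m2.eLpNorm_eq_integral_rpow_norm (by norm_num) ENNReal.coe_ne_top, ← hC,
    ← ENNReal.ofReal_coe_nnreal (p := C), ← ENNReal.ofReal_mul (by positivity),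
    ENNReal.ofReal_le_ofReal_iff (by positivity)] at key
  simp only [ENNReal.coe_toReal] at key
  have hA' : ∫ a, ‖τ a‖ ^ ((2:NNReal):ℝ) = ∫ x, τ x ^ 2 := by
    congr 1; funext a; norm_cast; simp
  have hB' : ∫ a, ‖fderiv ℝ τ a‖ ^ ((2:NNReal):ℝ) = ∫ x, ‖fderiv ℝ τ x‖ ^ 2 := by
    congr 1; funext a
    rw [show ((2:NNReal):ℝ) = ((2:ℕ):ℝ) by norm_num, Real.rpow_natCast]
  rw [hA', hB'] at key
  set A := ∫ x, τ x ^ 2 with hA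
  set B := ∫ x, ‖fderiv ℝ τ x‖ ^ 2 with hB
  have hB0 : 0 ≤ B := by positivity
  have hA0 : 0 ≤ A := by positivity
  have k2 : (A ^ (((2:NNReal):ℝ))⁻¹) ^ 2 ≤ (C * B ^ (((2:NNReal):ℝ))⁻¹) ^ 2 := by
    gcongr
  have e1 : (A ^ (((2:NNReal):ℝ))⁻¹) ^ 2 = A := by
    rw [← Real.rpow_natCast, ← Real.rpow_mul hA0]; norm_num
  have e2 : (B ^ (((2:NNReal):ℝ))⁻¹) ^ 2 = B := by
    rw [← Real.rpow_natCast, ← Real.rpow_mul hB0]; norm_num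
  rw [e1, mul_pow, e2] at k2
  nlinarith

lemma mollify {n : ℕ} {Ω : Set (En n)} (ho : IsOpen Ω) {τ : En n → ℝ}
    (hτ : ContDiff ℝ 1 τ) (hcs : HasCompactSupport τ) (hs : tsupport τ ⊆ Ω) :
    ∃ K : Set (En n), IsCompact K ∧ K ⊆ Ω ∧ tsupport τ ⊆ K ∧ ∀ δ > 0, ∃ σ, TestFun Ω σ ∧ tsupport σ ⊆ K ∧
      ∀ x, |σ x - τ x| ≤ δ ∧ ‖fderiv ℝ σ x - fderiv ℝ τ x‖ ≤ δ := by
  obtain ⟨d, hd, hdΩ⟩ := IsCompact.exists_cthickening_subset_open hcs ho hs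
  refine ⟨cthickening d (tsupport τ), IsCompact.cthickening hcs, hdΩ, self_subset_cthickening _,
    fun δ hδ => ?_⟩
  have hcd := hτ.continuous_fderiv (by norm_num : (1:WithTop ℕ∞) ≠ 0)
  have u1 : UniformContinuous τ := hcs.uniformContinuous_of_continuous hτ.continuous
  have u2 : UniformContinuous (fderiv ℝ τ) := (hcs.fderiv ℝ).uniformContinuous_of_continuous hcd
  obtain ⟨d1, hd1, h1⟩ := Metric.uniformContinuous_iff.1 u1 δ hδ
  obtain ⟨d2, hd2, h2⟩ := Metric.uniformContinuous_iff.1 u2 δ hδ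
  set r := min d (min d1 d2) with hr
  have hr0 : 0 < r := by positivity
  let φ : ContDiffBump (0 : En n) := ⟨r / 2, r, by linarith, by linarith⟩
  set σ : En n → ℝ := convolution (φ.normed volume) τ (ContinuousLinearMap.lsmul ℝ ℝ) volume with hσ
  have hli : LocallyIntegrable (φ.normed volume) (volume : Measure (En n)) :=
    φ.continuous_normed.locallyIntegrable
  have hsup : tsupport σ ⊆ cthickening d (tsupport τ) := by
    refine closure_minimal ?_ isClosed_cthickening
    refine (support_convolution_subset (ContinuousLinearMap.lsmul ℝ ℝ)).trans ?_
    rw [φ.support_normed_eq]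
    rintro _ ⟨a, ha, b, hb, rfl⟩
    refine mem_cthickening_of_dist_le _ b d _ (subset_tsupport τ hb) ?_
    have : ‖a‖ < r := by simpa using ha
    simp [dist_eq_norm]
    exact this.le.trans (min_le_left _ _)
  refine ⟨σ, ⟨?_, ?_, hsup.trans hdΩ⟩, hsup, fun x => ⟨?_, ?_⟩⟩
  · exact φ.hasCompactSupport_normed.contDiff_convolution_left _ φ.contDiff_normed
      hτ.continuous.locallyIntegrable
  · exact φ.hasCompactSupport_normed.convolution _ hcs
  · refine φ.dist_normed_convolution_le hτ.continuous.aestronglyMeasurable ?_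
    intro y hy
    exact (h1 ((mem_ball.1 hy).trans_le ((min_le_right _ _).trans (min_le_left _ _)))).le
  · have hfd := (hcs.hasFDerivAt_convolution_right (ContinuousLinearMap.lsmul ℝ ℝ) hli hτ x).fderiv
    rw [← hσ] at hfd
    rw [hfd, ← dist_eq_norm]
    have e : convolution (φ.normed volume) (fderiv ℝ τ)
        ((ContinuousLinearMap.lsmul ℝ ℝ).precompR (En n)) volume x =
        convolution (φ.normed volume) (fderiv ℝ τ) (ContinuousLinearMap.lsmul ℝ ℝ) volume x := by
      simp only [convolution_def]
      congr 1
    rw [e]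
    refine φ.dist_normed_convolution_le hcd.aestronglyMeasurable ?_
    intro y hy
    exact (h2 ((mem_ball.1 hy).trans_le ((min_le_right _ _).trans (min_le_right _ _)))).le


lemma sint_eq {n : ℕ} {Ω : Set (En n)} {f : En n → ℝ} (h : ∀ x, x ∉ Ω → f x = 0) :
    ∫ x in Ω, f x = ∫ x, f x := setIntegral_eq_integral_of_forall_compl_eq_zero h

lemma exists_notMem_bdd {n : ℕ} (hn : 3 ≤ n) {Ω : Set (En n)} (hb : Bornology.IsBounded Ω) :
    ∃ y, y ∉ Ω := by
  haveI : Nontrivial (En n) := by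
    haveI : Nonempty (Fin n) := ⟨⟨0, by omega⟩⟩
    infer_instance
  obtain ⟨R, hR⟩ := hb.exists_norm_le
  obtain ⟨y, hy⟩ := NormedSpace.exists_lt_norm ℝ (En n) R
  exact ⟨y, fun h => by linarith [hR y h]⟩

lemma test_integrable {n : ℕ} (hn : 3 ≤ n) {Ω : Set (En n)} (hb : Bornology.IsBounded Ω)
    {h : En n → ℝ} (hc : Coercive Ω h) {φ : En n → ℝ} (hφ : TestFun Ω φ) :
    IntegrableOn (fun x => h x * φ x ^ 2) Ω := by
  obtain ⟨C, hC, hcoer⟩ := hc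
  have hφ1 : ContDiff ℝ 1 φ := hφ.1.of_le (by exact_mod_cast le_top)
  have hcd := hφ1.continuous_fderiv (by norm_num : (1:WithTop ℕ∞) ≠ 0)
  have hcsd : HasCompactSupport (fun x => ‖fderiv ℝ φ x‖ ^ 2) := by
    have := (hφ.2.1.fderiv ℝ).norm
    refine this.mono' ?_
    intro x hx
    apply subset_tsupport
    simp at hx ⊢; exact hx
  have hg : Integrable (fun x => ‖fderiv ℝ φ x‖ ^ 2) :=
    (hcd.norm.pow 2).integrable_of_hasCompactSupport hcsd
  by_cases hI : IntegrableOn (fun x => ‖fderiv ℝ φ x‖ ^ 2 + h x * φ x ^ 2) Ω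
  · have := Integrable.sub hI hg.integrableOn
    refine this.congr (Eventually.of_forall fun x => ?_)
    simp
  · have h0 : energy Ω h φ = 0 := integral_undef hI
    have h1 := hcoer φ hφ
    rw [h0, sint_eq (fun x hx => by rw [fderiv_off hφ.2.2 hx]; simp)] at h1
    have h2 : ∫ x, ‖fderiv ℝ φ x‖ ^ 2 = 0 := by
      have : 0 ≤ ∫ x, ‖fderiv ℝ φ x‖ ^ 2 := by positivity
      nlinarith
    rw [integral_eq_zero_iff_of_nonneg (fun x => by positivity) hg] at h2
    have h3 : (fun x => ‖fderiv ℝ φ x‖ ^ 2) = fun _ => 0 :=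
      (hcd.norm.pow 2).ae_eq_iff_eq _ continuous_const |>.1 h2
    have h4 : ∀ x, fderiv ℝ φ x = 0 := fun x => by simpa using congrFun h3 x
    obtain ⟨y, hy⟩ := exists_notMem_bdd hn hb
    have h5 : ∀ x, φ x = 0 := fun x => by
      rw [is_const_of_fderiv_eq_zero (hφ1.differentiable (by norm_num)) h4 x y]
      exact image_eq_zero_of_notMem_tsupport (fun h => hy (hφ.2.2 h))
    simp [h5]

lemma h_locInt {n : ℕ} (hn : 3 ≤ n) {Ω : Set (En n)} (ho : IsOpen Ω) (hb : Bornology.IsBounded Ω)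
    {h : En n → ℝ} (hc : Coercive Ω h) : LocallyIntegrableOn h Ω := by
  intro x hx
  obtain ⟨r, hr, hrΩ⟩ := Metric.isOpen_iff.1 ho x hx
  let f : ContDiffBump x := ⟨r / 4, r / 2, by linarith, by linarith⟩
  have hf : TestFun Ω f := by
    refine ⟨f.contDiff, f.hasCompactSupport, ?_⟩
    rw [f.tsupport_eq]
    exact (closedBall_subset_ball (by show r / 2 < r; linarith)).trans hrΩ
  have hI := test_integrable hn hb hc hf
  refine ⟨ball x (r / 4), mem_nhdsWithin_of_mem_nhds (ball_mem_nhds x (by linarith)), ?_⟩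
  refine (hI.mono_set ((ball_subset_ball (by linarith)).trans hrΩ)).congr_fun ?_ measurableSet_ball
  intro y hy
  have : f y = 1 := f.one_of_mem_closedBall (ball_subset_closedBall hy)
  simp [this]

/-- coercivity on `C¹` compactly supported functions -/
lemma coer_c1 {n : ℕ} (hn : 3 ≤ n) {Ω : Set (En n)} (ho : IsOpen Ω) (hb : Bornology.IsBounded Ω)
    {h : En n → ℝ} {C : ℝ} (hcoer : Coercive Ω h)
    (hC : ∀ v, TestFun Ω v → C * ∫ x in Ω, ‖fderiv ℝ v x‖ ^ 2 ≤ energy Ω h v)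
    {τ : En n → ℝ} (hτ : ContDiff ℝ 1 τ) (hcs : HasCompactSupport τ) (hs : tsupport τ ⊆ Ω) :
    Integrable (fun x => h x * τ x ^ 2) ∧
    C * ∫ x, ‖fderiv ℝ τ x‖ ^ 2 ≤ ∫ x, (‖fderiv ℝ τ x‖ ^ 2 + h x * τ x ^ 2) := by
  obtain ⟨K, hK, hKΩ, hτK, hm⟩ := mollify ho hτ hcs hs
  have hcd := hτ.continuous_fderiv (by norm_num : (1:WithTop ℕ∞) ≠ 0)
  have hhK : IntegrableOn h K := (h_locInt hn ho hb hcoer).integrableOn_compact_subset hKΩ hK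
  choose σ hσ1 hσ2 hσ3 using fun j : ℕ => hm (1 / ((j:ℝ) + 1)) (by positivity)
  have hlim : Tendsto (fun j : ℕ => 1 / ((j:ℝ) + 1)) atTop (𝓝 0) := tendsto_one_div_add_atTop_nhds_zero_nat
  have l1 : ∀ x, Tendsto (fun j => σ j x) atTop (𝓝 (τ x)) := fun x => by
    rw [tendsto_iff_norm_sub_tendsto_zero]
    exact squeeze_zero (fun _ => norm_nonneg _) (fun j => (hσ3 j x).1) hlim
  have l2 : ∀ x, Tendsto (fun j => fderiv ℝ (σ j) x) atTop (𝓝 (fderiv ℝ τ x)) := fun x => by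
    rw [tendsto_iff_norm_sub_tendsto_zero]
    exact squeeze_zero (fun _ => norm_nonneg _) (fun j => (hσ3 j x).2) hlim
  obtain ⟨M1, hM1⟩ := hcs.exists_bound_of_continuous hτ.continuous
  obtain ⟨M2, hM2⟩ := (hcs.fderiv ℝ).exists_bound_of_continuous hcd
  have b1 : ∀ j x, |σ j x| ≤ M1 + 1 := fun j x => by
    have h1 := (hσ3 j x).1
    have h2 := hM1 x
    have h3 : (1:ℝ) / ((j:ℝ) + 1) ≤ 1 := by
      rw [div_le_one (by positivity)]; linarith [Nat.cast_nonneg (α := ℝ) j]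
    have : |σ j x| ≤ |σ j x - τ x| + |τ x| := by
      simpa using abs_add_le (σ j x - τ x) (τ x)
    rw [Real.norm_eq_abs] at h2
    linarith
  have b2 : ∀ j x, ‖fderiv ℝ (σ j) x‖ ≤ M2 + 1 := fun j x => by
    have h1 := (hσ3 j x).2
    have h2 := hM2 x
    have h3 : (1:ℝ) / ((j:ℝ) + 1) ≤ 1 := by
      rw [div_le_one (by positivity)]; linarith [Nat.cast_nonneg (α := ℝ) j]
    have : ‖fderiv ℝ (σ j) x‖ ≤ ‖fderiv ℝ (σ j) x - fderiv ℝ τ x‖ + ‖fderiv ℝ τ x‖ := by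
      simpa using norm_add_le (fderiv ℝ (σ j) x - fderiv ℝ τ x) (fderiv ℝ τ x)
    linarith
  have hσc1 : ∀ j, ContDiff ℝ 1 (σ j) := fun j => (hσ1 j).1.of_le (by exact_mod_cast le_top)
  have red : ∀ f : En n → ℝ, (∀ x, x ∉ K → f x = 0) → ∫ x in K, f x = ∫ x, f x := fun f hf => sint_eq hf
  have z1 : ∀ j x, x ∉ K → σ j x = 0 := fun j x hx => image_eq_zero_of_notMem_tsupport fun h => hx (hσ2 j h)
  have z2 : ∀ j x, x ∉ K → fderiv ℝ (σ j) x = 0 := fun j x hx => fderiv_off (hσ2 j) hx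
  have t1 : ∀ x, x ∉ K → τ x = 0 := fun x hx => image_eq_zero_of_notMem_tsupport fun h => hx (hτK h)
  have t2 : ∀ x, x ∉ K → fderiv ℝ τ x = 0 := fun x hx => fderiv_off hτK hx
  have hKfin : volume K < ⊤ := hK.measure_lt_top
  -- measurability on K
  have mh := hhK.aestronglyMeasurable
  have A1 : Tendsto (fun j => ∫ x in K, ‖fderiv ℝ (σ j) x‖ ^ 2) atTop (𝓝 (∫ x in K, ‖fderiv ℝ τ x‖ ^ 2)) := by
    refine tendsto_integral_of_dominated_convergence (fun _ => (M2 + 1) ^ 2) ?_ ?_ ?_ ?_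
    · intro j
      exact (((hσc1 j).continuous_fderiv (by norm_num)).norm.pow 2).aestronglyMeasurable
    · exact integrableOn_const hKfin.ne
    · intro j
      refine Eventually.of_forall fun x => ?_
      rw [Real.norm_of_nonneg (by positivity)]
      have := b2 j x
      gcongr
    · exact Eventually.of_forall fun x => ((l2 x).norm.pow 2)
  have A2 : Tendsto (fun j => ∫ x in K, (‖fderiv ℝ (σ j) x‖ ^ 2 + h x * σ j x ^ 2)) atTop
      (𝓝 (∫ x in K, (‖fderiv ℝ τ x‖ ^ 2 + h x * τ x ^ 2))) := by
    refine tendsto_integral_of_dominated_convergence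
      (fun x => (M2 + 1) ^ 2 + |h x| * (M1 + 1) ^ 2) ?_ ?_ ?_ ?_
    · intro j
      exact (((hσc1 j).continuous_fderiv (by norm_num)).norm.pow 2).aestronglyMeasurable.add
        (mh.mul ((hσc1 j).continuous.pow 2).aestronglyMeasurable)
    · exact (integrableOn_const hKfin.ne).add (hhK.abs.mul_const _)
    · intro j
      refine Eventually.of_forall fun x => ?_
      refine (norm_add_le _ _).trans ?_
      rw [Real.norm_of_nonneg (by positivity : 0 ≤ ‖fderiv ℝ (σ j) x‖ ^ 2), norm_mul, Real.norm_eq_abs,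
        Real.norm_of_nonneg (by positivity : 0 ≤ σ j x ^ 2), ← sq_abs (σ j x)]
      have := b2 j x
      have := b1 j x
      gcongr
    · exact Eventually.of_forall fun x =>
        ((l2 x).norm.pow 2).add (((l1 x).pow 2).const_mul (h x))
  constructor
  · have : IntegrableOn (fun x => h x * τ x ^ 2) K := by
      refine Integrable.mono' (hhK.abs.mul_const (M1 ^ 2)) (mh.mul (hτ.continuous.pow 2).aestronglyMeasurable) ?_
      refine Eventually.of_forall fun x => ?_
      rw [norm_mul, Real.norm_eq_abs, Real.norm_of_nonneg (by positivity : 0 ≤ τ x ^ 2), ← sq_abs (τ x)]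
      have := hM1 x
      rw [Real.norm_eq_abs] at this
      gcongr
    rwa [integrableOn_iff_integrable_of_support_subset] at this
    intro x hx
    by_contra hxK
    exact hx (by simp [t1 x hxK])
  · have key : ∀ j, C * ∫ x in K, ‖fderiv ℝ (σ j) x‖ ^ 2 ≤
        ∫ x in K, (‖fderiv ℝ (σ j) x‖ ^ 2 + h x * σ j x ^ 2) := fun j => by
      have := hC (σ j) (hσ1 j)
      unfold energy at this
      rw [sint_eq (fun x hx => by rw [z2 j x (fun h => hx (hKΩ h))]; simp),
        sint_eq (fun x hx => by rw [z2 j x (fun h => hx (hKΩ h)), z1 j x (fun h => hx (hKΩ h))]; simp)] at this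
      rw [red _ (fun x hx => by rw [z2 j x hx]; simp),
        red _ (fun x hx => by rw [z2 j x hx, z1 j x hx]; simp)]
      exact this
    have := le_of_tendsto_of_tendsto' (A1.const_mul C) A2 key
    rw [red _ (fun x hx => by rw [t2 x hx]; simp),
        red _ (fun x hx => by rw [t2 x hx, t1 x hx]; simp)] at this
    exact this

/-- truncated energy inequality at level `ε` -/
lemma LP_eps {n : ℕ} (hn : 3 ≤ n) {Ω : Set (En n)} (ho : IsOpen Ω) (hb : Bornology.IsBounded Ω)
    {hinf : En n → ℝ} {C : ℝ} (hcoer : Coercive Ω hinf)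
    (hC : ∀ v, TestFun Ω v → C * ∫ x in Ω, ‖fderiv ℝ v x‖ ^ 2 ≤ energy Ω hinf v)
    {ε1 : ℝ} {h : En n → ℝ} (hh : ∀ x ∈ Ω, |h x - hinf x| ≤ ε1)
    {φ : En n → ℝ} (hφ : XX Ω φ) {Gb : En n → ℝ} (hG : AEStronglyMeasurable Gb (volume.restrict Ω))
    {K : ℝ} (hGK : ∀ x ∈ Ω, |Gb x| ≤ K)
    {K2 : ℝ} (hK2 : ∀ x ∈ Ω, |h x * φ x| ≤ K2)
    (hL : ∀ x ∈ Ω, 0 < φ x → -lap φ x + h x * φ x ≤ Gb x) {ε : ℝ} (hε : 0 < ε) :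
    C * ∫ x, ‖fderiv ℝ (tr Ω (T1 ε) φ) x‖ ^ 2 ≤ (∫ x in Ω, Gb x * tr Ω (T1 ε) φ x) +
      ε1 * (∫ x, tr Ω (T1 ε) φ x ^ 2) + 2 * ε * K2 * volume.real Ω := by
  set τ := tr Ω (T1 ε) φ with hτd
  have hat : ∀ x ∈ Ω, ContDiffAt ℝ 2 φ x := fun x hx => hφ.at ho hx
  have hτ : ContDiff ℝ 1 τ := tr_contDiff ho hb hφ.cont (fun x hx => (hat x hx).of_le (by norm_num))
    hφ.bd hε (T1_c1 hε) (T1_zero_abs hε)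
  have hcs : HasCompactSupport τ := tr_hcs hb hφ.cont (T1_zero_abs hε)
  have hs : tsupport τ ⊆ Ω := tr_tsupport' ho hb hφ.cont hφ.bd hε (T1_zero_abs hε)
  obtain ⟨i1, i2, i3⟩ := ibp hτ hcs hs hat
  obtain ⟨j1, j2⟩ := coer_c1 hn ho hb hcoer hC hτ hcs hs
  have hcd := hτ.continuous_fderiv (by norm_num : (1:WithTop ℕ∞) ≠ 0)
  have hfin : volume Ω < ⊤ := hb.measure_lt_top
  have ig : Integrable (fun x => ‖fderiv ℝ τ x‖ ^ 2) :=
    (hcd.norm.pow 2).integrable_of_hasCompactSupport (by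
      refine (hcs.fderiv ℝ).mono ?_
      intro x hx; simp at hx ⊢; exact hx)
  have it2 : Integrable (fun x => τ x ^ 2) :=
    (hτ.continuous.pow 2).integrable_of_hasCompactSupport (by
      refine hcs.mono ?_
      intro x hx; simp at hx ⊢; exact hx)
  have iτ : Integrable τ := hτ.continuous.integrable_of_hasCompactSupport hcs
  have iGτ : IntegrableOn (fun x => Gb x * τ x) Ω := by
    refine iτ.integrableOn.bdd_mul (c := K) hG ?_
    filter_upwards [ae_restrict_mem ho.measurableSet] with x hx using hGK x hx
  have z0 : ∀ x, x ∉ Ω → τ x = 0 := fun x hx => tr_not hx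
  have s1 : ∫ x, ‖fderiv ℝ τ x‖ ^ 2 ≤ - ∫ x, τ x * lap φ x := by
    rw [← i3]
    refine integral_mono ig i2 fun x => ?_
    by_cases hx : x ∈ Ω
    · have := tr_fderiv_mem ho hx ((hat x hx).differentiableAt (by norm_num)) (T1_deriv hε (φ x))
      simp only [hτd, this, smul_apply, smul_eq_mul, mul_assoc]
      rw [← Finset.mul_sum, norm_smul, mul_pow]
      have e : ∑ i, fderiv ℝ φ x (ee i) * fderiv ℝ φ x (ee i) = ‖fderiv ℝ φ x‖ ^ 2 := by
        rw [← dual_sum_sq]; exact Finset.sum_congr rfl fun i _ => (sq _).symm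
      rw [e, Real.norm_of_nonneg (T1'_nonneg _)]
      have := T1'_nonneg (ε := ε) (φ x)
      have := T1'_le_one (ε := ε) (φ x)
      have : T1' ε (φ x) ^ 2 ≤ T1' ε (φ x) := by nlinarith
      gcongr
    · simp [fderiv_off hs hx]
  have s2 : C * ∫ x, ‖fderiv ℝ τ x‖ ^ 2 ≤ ∫ x in Ω, (-(τ x * lap φ x) + hinf x * τ x ^ 2) := by
    rw [sint_eq (fun x hx => by simp [z0 x hx])]
    rw [integral_add ig j1] at j2
    have e : ∫ x, (-(τ x * lap φ x) + hinf x * τ x ^ 2) =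
        -(∫ x, τ x * lap φ x) + ∫ x, hinf x * τ x ^ 2 := by
      rw [← integral_neg]; exact integral_add i1.neg j1
    rw [e]
    linarith
  refine s2.trans ?_
  have e2 : ∫ x, τ x ^ 2 = ∫ x in Ω, τ x ^ 2 := (sint_eq (fun x hx => by simp [z0 x hx])).symm
  have e3 : 2 * ε * K2 * volume.real Ω = ∫ x in Ω, 2 * ε * K2 := by
    rw [setIntegral_const, smul_eq_mul, mul_comm]
  have iAB : IntegrableOn (fun x => Gb x * τ x + ε1 * τ x ^ 2) Ω :=
    iGτ.add (it2.const_mul ε1).integrableOn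
  rw [e2, e3, ← integral_const_mul, ← integral_add iGτ (it2.const_mul ε1).integrableOn,
    ← integral_add iAB (integrableOn_const hfin.ne)]
  refine setIntegral_mono_on (i1.neg.add j1).integrableOn
    (iAB.add (integrableOn_const hfin.ne)) ho.measurableSet ?_
  intro x hx
  have eτ : τ x = T1 ε (φ x) := tr_mem hx
  have hK := hK2 x hx
  by_cases hp : φ x ≤ 0
  · have : τ x = 0 := by rw [eτ, T1_zero hε (by linarith)]
    have hK0 : 0 ≤ K2 := (abs_nonneg _).trans hK
    simp only [Pi.add_apply, this]
    ring_nf; positivity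
  · push Not at hp
    have h1 := hL x hx hp
    have t0 : 0 ≤ τ x := by rw [eτ]; exact T1_nonneg hε _
    have t1 : τ x ≤ φ x := by
      have := T1_le hε (φ x); rw [max_eq_left hp.le] at this; rwa [eτ]
    have t2 : φ x - 2 * ε ≤ τ x := by
      have := T1_ge hε (φ x); rw [max_eq_left hp.le] at this; rwa [eτ]
    have hd : (hinf x - h x) * τ x ^ 2 ≤ ε1 * τ x ^ 2 := by
      have := hh x hx
      rw [abs_le] at this
      have : 0 ≤ τ x ^ 2 := by positivity
      nlinarith
    have hd2 : -(h x * τ x * (φ x - τ x)) ≤ 2 * ε * K2 := by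
      have a1 : |h x * τ x * (φ x - τ x)| = |h x| * τ x * (φ x - τ x) := by
        rw [abs_mul, abs_mul, abs_of_nonneg t0, abs_of_nonneg (by linarith : 0 ≤ φ x - τ x)]
      have a2 : |h x| * τ x * (φ x - τ x) ≤ |h x| * φ x * (2 * ε) := by
        have := abs_nonneg (h x)
        gcongr
        linarith
      rw [abs_mul, abs_of_pos hp] at hK
      have a3 := neg_le_abs (h x * τ x * (φ x - τ x))
      nlinarith
    have h3 := mul_le_mul_of_nonneg_left h1 t0
    nlinarith

lemma tr_T1_tendsto {n : ℕ} {Ω : Set (En n)} {φ : En n → ℝ} {x : En n} (hx : x ∈ Ω) :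
    Tendsto (fun j : ℕ => tr Ω (T1 (1 / ((j:ℝ) + 1))) φ x) atTop (𝓝 (max (φ x) 0)) := by
  have hlim : Tendsto (fun j : ℕ => 1 / ((j:ℝ) + 1)) atTop (𝓝 0) :=
    tendsto_one_div_add_atTop_nhds_zero_nat
  have h2 : Tendsto (fun j : ℕ => max (φ x) 0 - 2 * (1 / ((j:ℝ) + 1))) atTop (𝓝 (max (φ x) 0)) := by
    simpa using (hlim.const_mul 2).const_sub (max (φ x) 0)
  refine tendsto_of_tendsto_of_tendsto_of_le_of_le h2 tendsto_const_nhds (fun j => ?_) (fun j => ?_)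
  · rw [tr_mem hx]; exact T1_ge (by positivity) _
  · rw [tr_mem hx]; exact T1_le (by positivity) _

lemma LP {n : ℕ} (hn : 3 ≤ n) {Ω : Set (En n)} (ho : IsOpen Ω) (hb : Bornology.IsBounded Ω)
    {hinf : En n → ℝ} (hcoer : Coercive Ω hinf) : ∃ C0 ε1 : ℝ, 0 < C0 ∧ 0 < ε1 ∧ ε1 ≤ 1 ∧
    ∀ h : En n → ℝ, (∀ x ∈ Ω, |h x - hinf x| ≤ ε1) → ∀ φ : En n → ℝ, XX Ω φ →
    ∀ Gb : En n → ℝ, AEStronglyMeasurable Gb (volume.restrict Ω) →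
    (∃ K, ∀ x ∈ Ω, |Gb x| ≤ K) → (∃ K, ∀ x ∈ Ω, |-lap φ x + h x * φ x| ≤ K) →
    (∀ x ∈ Ω, 0 < φ x → -lap φ x + h x * φ x ≤ Gb x) →
    (∫ x in Ω, (max (φ x) 0) ^ twoStar n) ^ (2 / twoStar n) ≤ C0 * ∫ x in Ω, Gb x * max (φ x) 0 := by
  obtain ⟨C, hC0, hC⟩ := id hcoer
  obtain ⟨Cs, hCs0, hCs⟩ := sobolev hn
  obtain ⟨Cp, hCp0, hCp⟩ := poincare hn hb
  have h2 := twoStar_pos hn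
  refine ⟨Cs * (2 / C), min 1 (C / (2 * Cp)), by positivity, by positivity, min_le_left _ _, ?_⟩
  set ε1 := min 1 (C / (2 * Cp)) with hε1
  have hε1p : ε1 * Cp ≤ C / 2 := by
    have : ε1 ≤ C / (2 * Cp) := min_le_right _ _
    calc ε1 * Cp ≤ C / (2 * Cp) * Cp := by gcongr
      _ = C / 2 := by field_simp
  have hε10 : 0 < ε1 := by positivity
  intro h hh φ hφ Gb hG ⟨K, hK⟩ ⟨K', hK'⟩ hL
  obtain ⟨K3, hK30, hK3⟩ := c2_bound ho hb hφ.c2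
  have hK2 : ∀ x ∈ Ω, |h x * φ x| ≤ K' + K3 := fun x hx => by
    have h1 := hK' x hx
    have h2 := (hK3 x hx).2.2
    have := abs_add_le (-lap φ x + h x * φ x) (lap φ x)
    rw [show -lap φ x + h x * φ x + lap φ x = h x * φ x by ring] at this
    linarith
  have hfin : volume Ω < ⊤ := hb.measure_lt_top
  have key : ∀ j : ℕ, (∫ x in Ω, (tr Ω (T1 (1 / ((j:ℝ) + 1))) φ x) ^ twoStar n) ^ (2 / twoStar n) ≤
      Cs * (2 / C) * ((∫ x in Ω, Gb x * tr Ω (T1 (1 / ((j:ℝ) + 1))) φ x) +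
        2 * (1 / ((j:ℝ) + 1)) * (K' + K3) * volume.real Ω) := by
    intro j
    have hε : (0:ℝ) < 1 / ((j:ℝ) + 1) := by positivity
    set ε := 1 / ((j:ℝ) + 1)
    have k1 := LP_eps hn ho hb hcoer hC hh hφ hG hK hK2 hL hε
    set τ := tr Ω (T1 ε) φ with hτd
    have hat : ∀ x ∈ Ω, ContDiffAt ℝ 2 φ x := fun x hx => hφ.at ho hx
    have hτ : ContDiff ℝ 1 τ := tr_contDiff ho hb hφ.cont (fun x hx => (hat x hx).of_le (by norm_num))
      hφ.bd hε (T1_c1 hε) (T1_zero_abs hε)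
    have hcs : HasCompactSupport τ := tr_hcs hb hφ.cont (T1_zero_abs hε)
    have hs : tsupport τ ⊆ Ω := tr_tsupport' ho hb hφ.cont hφ.bd hε (T1_zero_abs hε)
    have k2 := hCp τ hτ hcs hs
    have k3 := hCs τ hτ hcs
    have z0 : ∀ x, x ∉ Ω → τ x = 0 := fun x hx => tr_not hx
    have t0 : ∀ x, 0 ≤ τ x := fun x => by
      by_cases hx : x ∈ Ω
      · rw [hτd, tr_mem hx]; exact T1_nonneg hε _
      · rw [z0 x hx]
    have e1 : ∫ x in Ω, (τ x) ^ twoStar n = ∫ x, |τ x| ^ twoStar n := by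
      rw [sint_eq (fun x hx => by rw [z0 x hx, Real.zero_rpow (by linarith)])]
      congr 1; funext x; rw [abs_of_nonneg (t0 x)]
    rw [e1]
    refine k3.trans ?_
    rw [mul_assoc]
    refine mul_le_mul_of_nonneg_left ?_ hCs0.le
    have k4 : ε1 * ∫ x, τ x ^ 2 ≤ C / 2 * ∫ x, ‖fderiv ℝ τ x‖ ^ 2 := by
      calc ε1 * ∫ x, τ x ^ 2 ≤ ε1 * (Cp * ∫ x, ‖fderiv ℝ τ x‖ ^ 2) := by gcongr
        _ = ε1 * Cp * ∫ x, ‖fderiv ℝ τ x‖ ^ 2 := by ring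
        _ ≤ _ := by gcongr
    have k5 : C / 2 * ∫ x, ‖fderiv ℝ τ x‖ ^ 2 ≤ (∫ x in Ω, Gb x * τ x) + 2 * ε * (K' + K3) * volume.real Ω := by
      linarith
    calc ∫ x, ‖fderiv ℝ τ x‖ ^ 2 = 2 / C * (C / 2 * ∫ x, ‖fderiv ℝ τ x‖ ^ 2) := by field_simp
      _ ≤ _ := by gcongr
  have hcont : ContinuousOn φ Ω := hφ.cont.mono subset_closure
  have mτ : ∀ j : ℕ, AEStronglyMeasurable (tr Ω (T1 (1 / ((j:ℝ) + 1))) φ) (volume.restrict Ω) := fun j => by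
    have hε : (0:ℝ) < 1 / ((j:ℝ) + 1) := by positivity
    refine (ContDiff.continuous (𝕜 := ℝ) (n := 1) ?_).aestronglyMeasurable
    exact tr_contDiff ho hb hφ.cont (fun x hx => (hφ.at ho hx).of_le (by norm_num))
      hφ.bd hε (T1_c1 hε) (T1_zero_abs hε)
  have bτ : ∀ (j : ℕ), ∀ x ∈ Ω, |tr Ω (T1 (1 / ((j:ℝ) + 1))) φ x| ≤ K3 := fun j x hx => by
    have hε : (0:ℝ) < 1 / ((j:ℝ) + 1) := by positivity
    rw [tr_mem hx, abs_of_nonneg (T1_nonneg hε _)]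
    refine (T1_le hε _).trans (max_le ?_ hK30.le)
    exact (le_abs_self _).trans (hK3 x hx).1
  have l1 : Tendsto (fun j : ℕ => ∫ x in Ω, (tr Ω (T1 (1 / ((j:ℝ) + 1))) φ x) ^ twoStar n) atTop
      (𝓝 (∫ x in Ω, (max (φ x) 0) ^ twoStar n)) := by
    refine tendsto_integral_of_dominated_convergence (fun _ => K3 ^ twoStar n) ?_ ?_ ?_ ?_
    · intro j
      exact ((mτ j).aemeasurable.pow_const _).aestronglyMeasurable
    · exact integrableOn_const hfin.ne
    · intro j
      filter_upwards [ae_restrict_mem ho.measurableSet] with x hx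
      refine (Real.abs_rpow_le_abs_rpow _ _).trans ?_
      have := bτ j x hx
      gcongr
    · filter_upwards [ae_restrict_mem ho.measurableSet] with x hx
      exact (tr_T1_tendsto hx).rpow_const (Or.inr (by linarith))
  have l2 : Tendsto (fun j : ℕ => ∫ x in Ω, Gb x * (tr Ω (T1 (1 / ((j:ℝ) + 1))) φ x)) atTop
      (𝓝 (∫ x in Ω, Gb x * (max (φ x) 0))) := by
    refine tendsto_integral_of_dominated_convergence (fun _ => K * K3) ?_ ?_ ?_ ?_
    · intro j
      exact hG.mul (mτ j)
    · exact integrableOn_const hfin.ne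
    · intro j
      filter_upwards [ae_restrict_mem ho.measurableSet] with x hx
      have h1 := bτ j x hx
      have h2 := hK x hx
      rw [norm_mul, Real.norm_eq_abs, Real.norm_eq_abs]
      have := (abs_nonneg _).trans h2
      gcongr
    · filter_upwards [ae_restrict_mem ho.measurableSet] with x hx
      exact (tr_T1_tendsto hx).const_mul _
  have hlim : Tendsto (fun j : ℕ => 1 / ((j:ℝ) + 1)) atTop (𝓝 0) :=
    tendsto_one_div_add_atTop_nhds_zero_nat
  have l3 := (l2.add (((hlim.const_mul 2).mul_const (K' + K3)).mul_const (volume.real Ω))).const_mul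
    (Cs * (2 / C))
  simp only [mul_zero, zero_mul, add_zero] at l3
  exact le_of_tendsto_of_tendsto' (l1.rpow_const (Or.inr (by positivity))) l3 key

/-- weak maximum principle -/
def WMP {n : ℕ} (Ω : Set (En n)) (h : En n → ℝ) : Prop :=
  ∀ φ : En n → ℝ, XX Ω φ → (∃ K, ∀ x ∈ Ω, |-lap φ x + h x * φ x| ≤ K) →
    (∀ x ∈ Ω, 0 < φ x → -lap φ x + h x * φ x ≤ 0) → ∀ x ∈ closure Ω, φ x ≤ 0

lemma wmp_of_LP {n : ℕ} (hn : 3 ≤ n) {Ω : Set (En n)} (ho : IsOpen Ω) (hb : Bornology.IsBounded Ω)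
    {h : En n → ℝ} {C0 : ℝ} (hLP : ∀ φ : En n → ℝ, XX Ω φ →
    ∀ Gb : En n → ℝ, AEStronglyMeasurable Gb (volume.restrict Ω) →
    (∃ K, ∀ x ∈ Ω, |Gb x| ≤ K) → (∃ K, ∀ x ∈ Ω, |-lap φ x + h x * φ x| ≤ K) →
    (∀ x ∈ Ω, 0 < φ x → -lap φ x + h x * φ x ≤ Gb x) →
    (∫ x in Ω, (max (φ x) 0) ^ twoStar n) ^ (2 / twoStar n) ≤ C0 * ∫ x in Ω, Gb x * max (φ x) 0) :
    WMP Ω h := by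
  intro φ hφ hK hL x hx
  have h2 := twoStar_pos hn
  by_cases hxΩ : x ∈ Ω
  · have := hLP φ hφ (fun _ => 0) aestronglyMeasurable_const ⟨0, by simp⟩ hK hL
    simp only [zero_mul, integral_zero, mul_zero] at this
    have hnn : ∀ y, 0 ≤ (max (φ y) 0) ^ twoStar n := fun y => Real.rpow_nonneg (le_max_right _ _) _
    have hI0 : 0 ≤ ∫ x in Ω, (max (φ x) 0) ^ twoStar n := integral_nonneg hnn
    have hI : ∫ x in Ω, (max (φ x) 0) ^ twoStar n = 0 := by
      by_contra hne
      have : 0 < (∫ x in Ω, (max (φ x) 0) ^ twoStar n) ^ (2 / twoStar n) :=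
        Real.rpow_pos_of_pos (lt_of_le_of_ne hI0 (Ne.symm hne)) _
      linarith
    obtain ⟨K3, hK30, hK3⟩ := c2_bound ho hb hφ.c2
    have hco : ContinuousOn (fun x => (max (φ x) 0) ^ twoStar n) Ω :=
      ((hφ.cont.mono subset_closure).sup continuousOn_const).rpow_const (fun _ _ => Or.inr (by linarith))
    have hintg : IntegrableOn (fun x => (max (φ x) 0) ^ twoStar n) Ω := by
      refine IntegrableOn.of_bound (hb.measure_lt_top) (hco.aestronglyMeasurable ho.measurableSet) (K3 ^ twoStar n) ?_
      filter_upwards [ae_restrict_mem ho.measurableSet] with y hy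
      rw [Real.norm_of_nonneg (hnn y)]
      have : max (φ y) 0 ≤ K3 := max_le ((le_abs_self _).trans (hK3 y hy).1) hK30.le
      have h0 : 0 ≤ max (φ y) 0 := le_max_right _ _
      gcongr
    rw [setIntegral_eq_zero_iff_of_nonneg_ae (Eventually.of_forall hnn) hintg] at hI
    have := Measure.eqOn_open_of_ae_eq hI ho hco continuousOn_const hxΩ
    simp only [Pi.zero_apply] at this
    have h0 := (Real.rpow_eq_zero (le_max_right _ _) (by linarith)).1 this
    exact max_eq_right_iff.1 h0
  · have : x ∈ frontier Ω := by rw [ho.frontier_eq]; exact ⟨hx, hxΩ⟩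
    exact (hφ.bd x this).le

lemma XX.neg {n : ℕ} {Ω : Set (En n)} {φ : En n → ℝ} (h : XX Ω φ) : XX Ω (fun x => - φ x) :=
  ⟨h.c2.neg, fun x hx => by simp [h.bd x hx]⟩

lemma XX.sub {n : ℕ} {Ω : Set (En n)} {φ χ : En n → ℝ} (h : XX Ω φ) (h' : XX Ω χ) :
    XX Ω (fun x => φ x - χ x) :=
  ⟨h.c2.sub h'.c2, fun x hx => by simp [h.bd x hx, h'.bd x hx]⟩

lemma XX.add {n : ℕ} {Ω : Set (En n)} {φ χ : En n → ℝ} (h : XX Ω φ) (h' : XX Ω χ) :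
    XX Ω (fun x => φ x + χ x) :=
  ⟨h.c2.add h'.c2, fun x hx => by simp [h.bd x hx, h'.bd x hx]⟩

lemma XX.const_mul {n : ℕ} {Ω : Set (En n)} {φ : En n → ℝ} (h : XX Ω φ) (c : ℝ) :
    XX Ω (fun x => c * φ x) :=
  ⟨contDiffOn_const.mul h.c2, fun x hx => by simp [h.bd x hx]⟩

lemma base_pos {n : ℕ} (hn : 3 ≤ n) (x : En n) :
    1 ≤ 1 + ‖x‖ ^ 2 / ((n : ℝ) * ((n : ℝ) - 2)) := by
  have h : (3:ℝ) ≤ n := by exact_mod_cast hn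
  have : 0 ≤ ‖x‖ ^ 2 / ((n : ℝ) * ((n : ℝ) - 2)) := by
    apply div_nonneg (by positivity)
    apply mul_nonneg <;> linarith
  linarith

lemma B0_pos {n : ℕ} (hn : 3 ≤ n) (x : En n) : 0 < B0 n x :=
  Real.rpow_pos_of_pos (by linarith [base_pos hn x]) _

lemma B0_le {n : ℕ} (hn : 3 ≤ n) (x : En n) : B0 n x ≤ 1 := by
  have h : (3:ℝ) ≤ n := by exact_mod_cast hn
  exact Real.rpow_le_one_of_one_le_of_nonpos (base_pos hn x) (by linarith)

lemma B0_contDiff {n : ℕ} (hn : 3 ≤ n) : ContDiff ℝ 2 (B0 n) := by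
  unfold B0
  refine ContDiff.rpow_const_of_ne ?_ (fun x => by linarith [base_pos hn x])
  exact contDiff_const.add ((contDiff_norm_sq ℝ).div_const _)

lemma bubble_contDiff {n : ℕ} (hn : 3 ≤ n) (μ : ℝ) (x0 : En n) : ContDiff ℝ 2 (bubble n μ x0) := by
  unfold bubble
  have h1 : ContDiff ℝ 2 (fun x : En n => μ⁻¹ • (x - x0)) := by fun_prop
  exact contDiff_const.mul ((B0_contDiff hn).comp h1)

lemma bubble_pos {n : ℕ} (hn : 3 ≤ n) {μ : ℝ} (hμ : 0 < μ) (x0 x : En n) : 0 < bubble n μ x0 x :=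
  mul_pos (Real.rpow_pos_of_pos hμ _) (B0_pos hn _)

lemma bubble_le {n : ℕ} (hn : 3 ≤ n) {μ : ℝ} (hμ : 0 < μ) (x0 x : En n) :
    bubble n μ x0 x ≤ μ ^ (-(((n : ℝ) - 2) / 2)) := by
  unfold bubble
  have := B0_le hn (μ⁻¹ • (x - x0))
  have h2 : 0 < μ ^ (-(((n : ℝ) - 2) / 2)) := Real.rpow_pos_of_pos hμ _
  nlinarith

lemma proj_nonneg {n : ℕ} (hn : 3 ≤ n) {Ω : Set (En n)} (ho : IsOpen Ω)
    {h : En n → ℝ} (hw : WMP Ω h) {μ : ℝ} (hμ : 0 < μ) {x0 : En n} {w : En n → ℝ}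
    (hp : IsBubbleProj Ω h μ x0 w) : ∀ x ∈ closure Ω, 0 ≤ w x := by
  have h2 := twoStar_pos hn
  have hx : XX Ω w := ⟨hp.1, hp.2.2⟩
  have key := hw (fun x => - w x) hx.neg ⟨(μ ^ (-(((n : ℝ) - 2) / 2))) ^ (twoStar n - 1), ?_⟩ ?_
  · intro x hx; have := key x hx; linarith
  · intro x hxΩ
    rw [lap_neg (hx.at ho hxΩ), show - -lap w x + h x * -w x = -(-lap w x + h x * w x) by ring,
      hp.2.1 x hxΩ, abs_neg, abs_of_pos (Real.rpow_pos_of_pos (bubble_pos hn hμ _ _) _)]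
    exact Real.rpow_le_rpow (bubble_pos hn hμ _ _).le (bubble_le hn hμ _ _) (by linarith)
  · intro x hxΩ _
    rw [lap_neg (hx.at ho hxΩ), show - -lap w x + h x * -w x = -(-lap w x + h x * w x) by ring,
      hp.2.1 x hxΩ]
    have := (Real.rpow_pos_of_pos (bubble_pos hn hμ x0 x) (twoStar n - 1))
    linarith

lemma proj_pos {n : ℕ} (hn : 3 ≤ n) {Ω : Set (En n)} (ho : IsOpen Ω)
    {h : En n → ℝ} (hw : WMP Ω h) {μ : ℝ} (hμ : 0 < μ) {x0 : En n} {w : En n → ℝ}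
    (hp : IsBubbleProj Ω h μ x0 w) : ∀ x ∈ Ω, 0 < w x := by
  intro x hxΩ
  have hnn := proj_nonneg hn ho hw hμ hp
  have hx : XX Ω w := ⟨hp.1, hp.2.2⟩
  by_contra hcon
  have h0 : w x = 0 := le_antisymm (not_lt.1 hcon) (hnn x (subset_closure hxΩ))
  have hm : IsLocalMax (fun y => - w y) x := by
    filter_upwards [ho.mem_nhds hxΩ] with y hy
    rw [h0]; have := hnn y (subset_closure hy); linarith
  have h1 := lap_nonpos_of_max (hx.at ho hxΩ).neg hm
  have e : lap (-w) x = - lap w x := lap_neg (hx.at ho hxΩ)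
  have h1' : - lap w x ≤ 0 := by rw [← e]; exact h1
  have h2 := hp.2.1 x hxΩ
  have := (Real.rpow_pos_of_pos (bubble_pos hn hμ x0 x) (twoStar n - 1))
  rw [h0] at h2
  linarith

/-- the comparison function -/
structure PsiD {n : ℕ} (Ω : Set (En n)) (ψ : En n → ℝ) (c1 C2 : ℝ) : Prop where
  xx : XX Ω ψ
  pos : ∀ x ∈ Ω, 0 < ψ x
  c1pos : 0 < c1
  C2pos : 0 < C2
  bd : ∀ x ∈ Ω, |ψ x| ≤ C2 ∧ ‖fderiv ℝ ψ x‖ ≤ C2 ∧ |lap ψ x| ≤ C2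

/-- admissible potentials -/
structure Adm {n : ℕ} (Ω : Set (En n)) (ψ : En n → ℝ) (c1 C4 : ℝ) (h : En n → ℝ) : Prop where
  low : ∀ x ∈ Ω, c1 + lap ψ x - 2 * ψ x ≤ h x * ψ x
  abs : ∀ x ∈ Ω, |h x| * ψ x ≤ C4

lemma exists_psi {n : ℕ} (hn : 3 ≤ n) {Ω : Set (En n)} (ho : IsOpen Ω) (hb : Bornology.IsBounded Ω)
    (hne : Ω.Nonempty) {h0 : En n → ℝ} (hw : WMP Ω h0) {μ : ℝ} (hμ : 0 < μ) {x0 : En n} {ψ : En n → ℝ}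
    (hp : IsBubbleProj Ω h0 μ x0 ψ) :
    ∃ c1 C2 C4 : ℝ, PsiD Ω ψ c1 C2 ∧ 0 < C4 ∧ (∀ x ∈ Ω, c1 ≤ -lap ψ x + h0 x * ψ x) ∧
      ∀ h : En n → ℝ, (∀ x ∈ Ω, |h x - h0 x| ≤ 2) → Adm Ω ψ c1 C4 h := by
  have hx : XX Ω ψ := ⟨hp.1, hp.2.2⟩
  have h2 := twoStar_pos hn
  have hK : IsCompact (closure Ω) := hb.isCompact_closure
  obtain ⟨z, hz, hzm⟩ := hK.exists_isMinOn (hne.mono subset_closure)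
    ((bubble_contDiff hn μ x0).continuous.continuousOn)
  obtain ⟨C2, hC2, hC2b⟩ := c2_bound ho hb hx.c2
  set c1 := bubble n μ x0 z ^ (twoStar n - 1) with hc1
  have hc1p : 0 < c1 := Real.rpow_pos_of_pos (bubble_pos hn hμ _ _) _
  have hpos := proj_pos hn ho hw hμ hp
  have low : ∀ x ∈ Ω, c1 ≤ -lap ψ x + h0 x * ψ x := fun x hxΩ => by
    rw [hp.2.1 x hxΩ]
    exact Real.rpow_le_rpow (bubble_pos hn hμ _ _).le (hzm (subset_closure hxΩ)) (by linarith)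
  set Bq := (μ ^ (-(((n : ℝ) - 2) / 2))) ^ (twoStar n - 1)
  have hBq : ∀ x ∈ Ω, -lap ψ x + h0 x * ψ x ≤ Bq := fun x hxΩ => by
    rw [hp.2.1 x hxΩ]
    exact Real.rpow_le_rpow (bubble_pos hn hμ _ _).le (bubble_le hn hμ _ _) (by linarith)
  have hBqp : 0 < Bq := by
    obtain ⟨x, hxΩ⟩ := hne
    exact hc1p.trans_le ((low x hxΩ).trans (hBq x hxΩ))
  refine ⟨c1, C2, Bq + C2 + 2 * C2, ⟨hx, hpos, hc1p, hC2, hC2b⟩, by positivity, low, fun h hh => ⟨?_, ?_⟩⟩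
  · intro x hxΩ
    have := low x hxΩ
    have h3 := abs_le.1 (hh x hxΩ)
    have h4 := hpos x hxΩ
    nlinarith
  · intro x hxΩ
    have l1 := low x hxΩ
    have l2 := hBq x hxΩ
    have h3 := abs_le.1 (hh x hxΩ)
    have h4 := hpos x hxΩ
    have h5 := hC2b x hxΩ
    have h6 := abs_le.1 h5.2.2
    have h7 := abs_le.1 h5.1
    rw [← abs_of_pos h4, ← abs_mul, abs_le]
    constructor <;> nlinarith

lemma compare_psi {n : ℕ} {Ω : Set (En n)} (ho : IsOpen Ω)
    {h0 : En n → ℝ} (hw : WMP Ω h0) {ψ : En n → ℝ} {c1 C2 : ℝ} (hψ : PsiD Ω ψ c1 C2)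
    (low : ∀ x ∈ Ω, c1 ≤ -lap ψ x + h0 x * ψ x) (hup : ∃ K, ∀ x ∈ Ω, -lap ψ x + h0 x * ψ x ≤ K)
    {w : En n → ℝ} (hwx : XX Ω w) (hwb : ∃ A, ∀ x ∈ Ω, |-lap w x + h0 x * w x| ≤ A) :
    ∃ K, 0 < K ∧ ∀ x ∈ closure Ω, |w x| ≤ K * ψ x := by
  obtain ⟨A, hA⟩ := hwb
  obtain ⟨U, hU⟩ := hup
  have hc1 := hψ.c1pos
  set K := (|A| + 1) / c1 with hK
  have hKp : 0 < K := by positivity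
  have hKc : K * c1 = |A| + 1 := by rw [hK]; field_simp
  have gen : ∀ w : En n → ℝ, XX Ω w → (∀ x ∈ Ω, |-lap w x + h0 x * w x| ≤ A) →
      ∀ x ∈ closure Ω, w x - K * ψ x ≤ 0 := by
    intro w hwx hA
    have e : ∀ x ∈ Ω, -lap (fun y => w y - K * ψ y) x + h0 x * (w x - K * ψ x) =
        (-lap w x + h0 x * w x) - K * (-lap ψ x + h0 x * ψ x) := fun x hx => by
      rw [lap_sub (hwx.at ho hx) ((hψ.xx.const_mul K).at ho hx), lap_const_mul K (hψ.xx.at ho hx)]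
      ring
    refine hw _ (hwx.sub (hψ.xx.const_mul K)) ⟨A + K * |U|, ?_⟩ ?_
    · intro x hx
      rw [e x hx]
      have h1 := abs_le.1 (hA x hx)
      have h2 := low x hx
      have h3 := (hU x hx).trans (le_abs_self U)
      rw [abs_le]
      constructor <;> nlinarith
    · intro x hx _
      rw [e x hx]
      have h1 := abs_le.1 (hA x hx)
      have h2 := low x hx
      have h3 := le_abs_self A
      nlinarith
  refine ⟨K, hKp, fun x hx => ?_⟩
  have g1 := gen w hwx hA x hx
  have g2 := gen (fun x => - w x) hwx.neg (fun x hx => by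
    rw [lap_neg (hwx.at ho hx), show - -lap w x + h0 x * -w x = -(-lap w x + h0 x * w x) by ring, abs_neg]
    exact hA x hx) x hx
  rw [abs_le]; constructor <;> linarith

/-- the bump `1 - |x-y|²/λ²` -/
def gg {n : ℕ} (y : En n) (l : ℝ) (x : En n) : ℝ := 1 - ‖x - y‖ ^ 2 / l ^ 2

lemma gg_contDiff {n : ℕ} (y : En n) (l : ℝ) : ContDiff ℝ 2 (gg y l) := by
  unfold gg
  exact contDiff_const.sub (((contDiff_id.sub contDiff_const).norm_sq ℝ).div_const _)

lemma gg_hasFDerivAt {n : ℕ} (y : En n) (l : ℝ) (x : En n) :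
    HasFDerivAt (gg y l) (-((2 / l ^ 2) • innerSL ℝ (x - y))) x := by
  have h1 : HasFDerivAt (fun x : En n => x - y) (ContinuousLinearMap.id ℝ (En n)) x :=
    (hasFDerivAt_id x).sub_const y
  have h2 := h1.norm_sq
  have h3 := (h2.mul_const (1 / l ^ 2)).const_sub 1
  have e : gg y l = fun x => 1 - ‖x - y‖ ^ 2 * (1 / l ^ 2) := by
    funext x; unfold gg; ring
  rw [e]
  refine h3.congr_fderiv ?_
  ext v
  simp
  ring

lemma gg_fderiv {n : ℕ} (y : En n) (l : ℝ) (x v : En n) :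
    fderiv ℝ (gg y l) x v = -(2 / l ^ 2 * inner ℝ (x - y) v) := by
  rw [(gg_hasFDerivAt y l x).fderiv]; simp [inner_sub_left]

lemma gg_fderiv_norm {n : ℕ} (y : En n) (l : ℝ) (x : En n) :
    ‖fderiv ℝ (gg y l) x‖ = 2 / l ^ 2 * ‖x - y‖ := by
  rw [(gg_hasFDerivAt y l x).fderiv, norm_neg, norm_smul, innerSL_apply_norm,
    Real.norm_of_nonneg (by positivity)]

lemma gg_lap {n : ℕ} (y : En n) (l : ℝ) (x : En n) : lap (gg y l) x = -(2 * n / l ^ 2) := by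
  unfold lap
  have : ∀ i : Fin n, fderiv ℝ (fun z => fderiv ℝ (gg y l) z (EuclideanSpace.single i 1)) x
      (EuclideanSpace.single i 1) = -(2 / l ^ 2) := by
    intro i
    have e : (fun z => fderiv ℝ (gg y l) z (EuclideanSpace.single i 1)) =
        fun z => -(2 / l ^ 2) * (innerSL ℝ (EuclideanSpace.single i (1:ℝ)) z) + (2 / l ^ 2) * (innerSL ℝ (EuclideanSpace.single i (1:ℝ)) y) := by
      funext z
      rw [gg_fderiv, innerSL_apply_apply, innerSL_apply_apply, inner_sub_left, real_inner_comm z, real_inner_comm y]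
      ring
    rw [e]
    have h1 : HasFDerivAt (fun z : En n => -(2 / l ^ 2) * (innerSL ℝ (EuclideanSpace.single i (1:ℝ)) z) +
        (2 / l ^ 2) * (innerSL ℝ (EuclideanSpace.single i (1:ℝ)) y))
        (-(2 / l ^ 2) • innerSL ℝ (EuclideanSpace.single i (1:ℝ))) x :=
      ((innerSL ℝ (EuclideanSpace.single i (1:ℝ))).hasFDerivAt.const_mul _).add_const _
    rw [h1.fderiv]
    simp
  rw [Finset.sum_congr rfl (fun i _ => this i)]
  simp; ring

lemma gg_pos {n : ℕ} {y : En n} {l : ℝ} (hl : 0 < l) {x : En n} (hx : x ∈ ball y l) : 0 < gg y l x := by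
  rw [mem_ball, dist_eq_norm] at hx
  unfold gg
  have : ‖x - y‖ ^ 2 < l ^ 2 := by
    have := norm_nonneg (x - y); nlinarith
  rw [sub_pos, div_lt_one (by positivity)]; exact this

lemma gg_le {n : ℕ} (y : En n) (l : ℝ) (x : En n) : gg y l x ≤ 1 := by
  unfold gg
  have : 0 ≤ ‖x - y‖ ^ 2 / l ^ 2 := by positivity
  linarith

lemma mem_ball_of_gg {n : ℕ} {y : En n} {l : ℝ} (hl : 0 < l) {x : En n} (hx : 0 < gg y l x) : x ∈ ball y l := by
  rw [mem_ball, dist_eq_norm]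
  unfold gg at hx
  rw [sub_pos, div_lt_one (by positivity)] at hx
  exact lt_of_pow_lt_pow_left₀ 2 hl.le hx

/-- the Laplacian of `exp (θ log ψ - 2θ log g)`. -/
lemma lap_barrier {n : ℕ} {ψ g : En n → ℝ} {x : En n} (hψ : ContDiffAt ℝ 2 ψ x)
    (hg : ContDiffAt ℝ 2 g x) (hψ0 : 0 < ψ x) (hg0 : 0 < g x) {θ : ℝ} (hθ0 : 0 < θ) (hθ1 : θ < 1) :
    ContDiffAt ℝ 2 (fun y => Real.exp (θ * Real.log (ψ y) - 2 * θ * Real.log (g y))) x ∧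
    lap (fun y => Real.exp (θ * Real.log (ψ y) - 2 * θ * Real.log (g y))) x ≤
      Real.exp (θ * Real.log (ψ x) - 2 * θ * Real.log (g x)) *
      (θ * lap ψ x / ψ x - 2 * θ * lap g x / g x +
        (2 * θ + 4 * θ ^ 2 / (1 - θ)) * (‖fderiv ℝ g x‖ / g x) ^ 2) := by
  have hlψ : ContDiffAt ℝ 2 (fun y => Real.log (ψ y)) x := hψ.log hψ0.ne'
  have hlg : ContDiffAt ℝ 2 (fun y => Real.log (g y)) x := hg.log hg0.ne'
  have lapl : ∀ f : En n → ℝ, ContDiffAt ℝ 2 f x → 0 < f x →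
      lap (fun y => Real.log (f y)) x = lap f x / f x - (‖fderiv ℝ f x‖ / f x) ^ 2 := by
    intro f hf hf0
    have := lap_comp (T := Real.log) (T' := fun t => t⁻¹) (T'' := -((f x) ^ 2)⁻¹) hf ?_ ?_
    · rw [this]; field_simp; ring
    · filter_upwards [lt_mem_nhds hf0] with t ht using Real.hasDerivAt_log ht.ne'
    · exact hasDerivAt_inv hf0.ne'
  have h1 : ContDiffAt ℝ 2 (fun y => θ * Real.log (ψ y)) x := contDiffAt_const.mul hlψ
  have h2 : ContDiffAt ℝ 2 (fun y => 2 * θ * Real.log (g y)) x := contDiffAt_const.mul hlg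
  have hf : ContDiffAt ℝ 2 (fun y => θ * Real.log (ψ y) - 2 * θ * Real.log (g y)) x := h1.sub h2
  refine ⟨hf.exp, ?_⟩
  rw [lap_comp (T := Real.exp) (T' := Real.exp) hf (Eventually.of_forall fun t => Real.hasDerivAt_exp t)
    (Real.hasDerivAt_exp _), ← mul_add]
  refine mul_le_mul_of_nonneg_left ?_ (Real.exp_pos _).le
  rw [lap_sub h1 h2, lap_const_mul _ hlψ, lap_const_mul _ hlg, lapl ψ hψ hψ0, lapl g hg hg0]
  have hd : fderiv ℝ (fun y => θ * Real.log (ψ y) - 2 * θ * Real.log (g y)) x =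
      θ • ((ψ x)⁻¹ • fderiv ℝ ψ x) - (2 * θ) • ((g x)⁻¹ • fderiv ℝ g x) := by
    have d1 := ((hψ.differentiableAt (by norm_num)).hasFDerivAt.log hψ0.ne').const_mul θ
    have d2 := ((hg.differentiableAt (by norm_num)).hasFDerivAt.log hg0.ne').const_mul (2 * θ)
    exact (d1.sub d2).fderiv
  set A := ‖fderiv ℝ ψ x‖ / ψ x with hA
  set B := ‖fderiv ℝ g x‖ / g x with hB
  have hA0 : 0 ≤ A := by positivity
  have hB0 : 0 ≤ B := by positivity
  have hn : ‖fderiv ℝ (fun y => θ * Real.log (ψ y) - 2 * θ * Real.log (g y)) x‖ ≤ θ * A + 2 * θ * B := by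
    rw [hd]
    refine (norm_sub_le _ _).trans (le_of_eq ?_)
    rw [norm_smul, norm_smul, norm_smul, norm_smul, Real.norm_of_nonneg hθ0.le,
      Real.norm_of_nonneg (by positivity : 0 ≤ 2 * θ), Real.norm_of_nonneg (by positivity : 0 ≤ (ψ x)⁻¹),
      Real.norm_of_nonneg (by positivity : 0 ≤ (g x)⁻¹), hA, hB]
    ring
  have hn2 : ‖fderiv ℝ (fun y => θ * Real.log (ψ y) - 2 * θ * Real.log (g y)) x‖ ^ 2 ≤ (θ * A + 2 * θ * B) ^ 2 := by
    gcongr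
  have hk : (θ * A + 2 * θ * B) ^ 2 ≤ θ * A ^ 2 + 4 * θ ^ 2 / (1 - θ) * B ^ 2 := by
    have h1θ : 0 < 1 - θ := by linarith
    have e : θ * A ^ 2 + 4 * θ ^ 2 / (1 - θ) * B ^ 2 - (θ * A + 2 * θ * B) ^ 2 =
        θ * ((1 - θ) * A - 2 * θ * B) ^ 2 / (1 - θ) := by
      field_simp; ring
    have : 0 ≤ θ * ((1 - θ) * A - 2 * θ * B) ^ 2 / (1 - θ) := by positivity
    linarith
  have e1 : θ * lap ψ x / ψ x = θ * (lap ψ x / ψ x) := by ring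
  have e2 : 2 * θ * lap g x / g x = 2 * θ * (lap g x / g x) := by ring
  rw [e1, e2]
  nlinarith

set_option maxHeartbeats 1600000 in
lemma barrier {n : ℕ} {Ω : Set (En n)} (ho : IsOpen Ω) (hb : Bornology.IsBounded Ω)
    {ψ : En n → ℝ} {c1 C2 : ℝ} (hψ : PsiD Ω ψ c1 C2) :
    ∃ θ Cb : ℝ, 0 < θ ∧ θ < 1 ∧ 0 < Cb ∧ ∀ (h : En n → ℝ),
      (∀ x ∈ Ω, c1 + lap ψ x - 2 * ψ x ≤ h x * ψ x) →
      ∀ (y : En n) (l : ℝ), 0 < l → l ≤ 1 → ∀ w : En n → ℝ, XX Ω w →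
      (∃ K, 0 < K ∧ ∀ x ∈ closure Ω, |w x| ≤ K * ψ x) → ∀ M : ℝ, 0 < M →
      (∀ x ∈ Ω ∩ ball y l, 0 < w x → w x ≤ M ∧ -lap w x + h x * w x ≤ M / l ^ 2) →
      ∀ x ∈ Ω ∩ ball y l, 0 < w x → w x * (gg y l x) ^ (2 * θ) ≤ Cb * M * (ψ x / l ^ 2) ^ θ := by
  have hc1 := hψ.c1pos
  have hC2 := hψ.C2pos
  obtain ⟨θ, hθ0, hθ1, hθc⟩ : ∃ θ : ℝ, 0 < θ ∧ θ < 1 ∧ (1 - θ) * C2 ≤ c1 / 2 := by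
    refine ⟨1 - c1 / (2 * (c1 + C2)), ?_, ?_, ?_⟩
    · rw [sub_pos, div_lt_one (by positivity)]; linarith
    · have : 0 < c1 / (2 * (c1 + C2)) := by positivity
      linarith
    · rw [sub_sub_cancel, div_mul_eq_mul_div, div_le_div_iff₀ (by positivity) (by norm_num)]
      nlinarith
  have h1θ : 0 < 1 - θ := by linarith
  set C' : ℝ := 2 + 4 * n + 4 * (2 * θ + 4 * θ ^ 2 / (1 - θ)) with hC'
  have hC'0 : 0 < C' := by positivity
  refine ⟨θ, (4 * (1 + C') / c1) ^ θ, hθ0, hθ1, by positivity, ?_⟩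
  intro h hlow y l hl hl1 w hwx ⟨K, hK0, hK⟩ M hM hw x1 hx1 hw1
  set g := gg y l with hgd
  set q : En n → ℝ := fun x => w x * Real.exp (2 * θ * Real.log (g x) - θ * Real.log (ψ x)) with hq
  set δ := q x1 with hδ
  have hδ0 : 0 < δ := by rw [hδ, hq]; positivity
  have hgx1 : 0 < g x1 := gg_pos hl hx1.2
  set k1 := Real.exp (Real.log (δ / K) / (1 - θ)) with hk1
  set k2 := Real.exp ((Real.log (δ / K) - (1 - θ) * Real.log C2) / (2 * θ)) with hk2
  have hk1p : 0 < k1 := Real.exp_pos _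
  have hk2p : 0 < k2 := Real.exp_pos _
  set S := {x ∈ closure Ω | k1 ≤ ψ x ∧ k2 ≤ g x} with hS
  have hgc : Continuous g := (gg_contDiff y l).continuous
  have hSU : S ⊆ Ω ∩ ball y l := by
    rintro x ⟨hxc, h1, h2⟩
    refine ⟨?_, mem_ball_of_gg hl (hk2p.trans_le h2)⟩
    by_contra hxΩ
    have : ψ x = 0 := hψ.xx.bd x (by rw [ho.frontier_eq]; exact ⟨hxc, hxΩ⟩)
    linarith
  have hScp : IsCompact S := by
    have hcc : IsCompact (closure Ω) := hb.isCompact_closure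
    have hcl : IsClosed (closure Ω ∩ (fun x => (ψ x, g x)) ⁻¹' (Set.Ici k1 ×ˢ Set.Ici k2)) :=
      (hψ.xx.cont.prodMk hgc.continuousOn).preimage_isClosed_of_isClosed isClosed_closure
        (isClosed_Ici.prod isClosed_Ici)
    exact hcc.of_isClosed_subset hcl Set.inter_subset_left
  have hqbig : ∀ x ∈ Ω ∩ ball y l, δ ≤ q x → x ∈ S := by
    intro x hx hqx
    have hgx : 0 < g x := gg_pos hl hx.2
    have hψx := hψ.pos x hx.1
    have a1 : q x ≤ K * ψ x * Real.exp (2 * θ * Real.log (g x) - θ * Real.log (ψ x)) := by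
      have := (le_abs_self _).trans (hK x (subset_closure hx.1))
      exact mul_le_mul_of_nonneg_right this (Real.exp_pos _).le
    have a2 : δ / K ≤ Real.exp (2 * θ * Real.log (g x) + (1 - θ) * Real.log (ψ x)) := by
      rw [div_le_iff₀ hK0]
      refine hqx.trans (a1.trans (le_of_eq ?_))
      have : ψ x = Real.exp (Real.log (ψ x)) := (Real.exp_log hψx).symm
      rw [mul_assoc]
      nth_rewrite 1 [this]
      rw [← Real.exp_add, mul_comm]
      congr 2
      ring
    have a3 : Real.log (δ / K) ≤ 2 * θ * Real.log (g x) + (1 - θ) * Real.log (ψ x) := by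
      rw [Real.log_le_iff_le_exp (by positivity)]; exact a2
    have a4 : Real.log (g x) ≤ 0 := Real.log_nonpos hgx.le (gg_le y l x)
    have a5 : Real.log (ψ x) ≤ Real.log C2 :=
      Real.log_le_log hψx ((le_abs_self _).trans (hψ.bd x hx.1).1)
    refine ⟨subset_closure hx.1, ?_, ?_⟩
    · rw [hk1, ← Real.le_log_iff_exp_le hψx, div_le_iff₀ h1θ]
      nlinarith
    · rw [hk2, ← Real.le_log_iff_exp_le hgx, div_le_iff₀ (by positivity)]
      nlinarith
  have hx1S : x1 ∈ S := hqbig x1 hx1 le_rfl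
  have hqc : ContinuousOn q S := by
    refine ContinuousOn.mul (hwx.cont.mono fun x hx => hx.1) (Real.continuous_exp.comp_continuousOn ?_)
    refine ContinuousOn.sub ?_ ?_
    · exact continuousOn_const.mul (hgc.continuousOn.log fun x hx => (hk2p.trans_le hx.2.2).ne')
    · exact continuousOn_const.mul ((hψ.xx.cont.mono fun x hx => hx.1).log fun x hx => (hk1p.trans_le hx.2.1).ne')
  obtain ⟨x, hxS, hxm⟩ := hScp.exists_isMaxOn ⟨x1, hx1S⟩ hqc
  have hxU := hSU hxS
  have hgx : 0 < g x := gg_pos hl hxU.2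
  have hψx := hψ.pos x hxU.1
  have hqx : δ ≤ q x := hxm hx1S
  have hmax : ∀ z ∈ Ω ∩ ball y l, q z ≤ q x := by
    intro z hz
    by_cases hz2 : δ ≤ q z
    · exact hxm (hqbig z hz hz2)
    · push Not at hz2; linarith
  have hwpos : 0 < w x := by
    by_contra hcon
    have : q x ≤ 0 := mul_nonpos_of_nonpos_of_nonneg (not_lt.1 hcon) (Real.exp_pos _).le
    linarith
  -- touching
  have hwat := hwx.at ho hxU.1
  have hψat := hψ.xx.at ho hxU.1
  have hgat : ContDiffAt ℝ 2 g x := (gg_contDiff y l).contDiffAt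
  obtain ⟨b1, b2⟩ := lap_barrier hψat hgat hψx hgx hθ0 hθ1
  have inv : ∀ z, Real.exp (2 * θ * Real.log (g z) - θ * Real.log (ψ z)) *
      Real.exp (θ * Real.log (ψ z) - 2 * θ * Real.log (g z)) = 1 := fun z => by
    rw [← Real.exp_add]; simp
  have touch0 : ∀ z, w z = q z * Real.exp (θ * Real.log (ψ z) - 2 * θ * Real.log (g z)) := fun z => by
    rw [hq, mul_assoc, inv, mul_one]
  have hl2 := lap_le_of_touch hwat (contDiffAt_const (c := q x) |>.mul b1) (by
    filter_upwards [(ho.inter isOpen_ball).mem_nhds hxU] with z hz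
    rw [touch0 z]
    exact mul_le_mul_of_nonneg_right (hmax z hz) (Real.exp_pos _).le) (touch0 x)
  rw [lap_const_mul _ b1] at hl2
  have hqx0 : 0 < q x := hδ0.trans_le hqx
  have hl3 : lap w x ≤ w x * (θ * lap ψ x / ψ x - 2 * θ * lap g x / g x +
        (2 * θ + 4 * θ ^ 2 / (1 - θ)) * (‖fderiv ℝ g x‖ / g x) ^ 2) := by
    refine hl2.trans ?_
    have e0 : ∀ r : ℝ, w x * r = q x * (Real.exp (θ * Real.log (ψ x) - 2 * θ * Real.log (g x)) * r) := by
      intro r; rw [← mul_assoc, ← touch0 x]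
    rw [e0]
    exact mul_le_mul_of_nonneg_left b2 hqx0.le
  obtain ⟨hwM, hpde⟩ := hw x hxU hwpos
  set P := ψ x / l ^ 2 with hP
  have hP0 : 0 < P := by positivity
  have main : c1 / 2 ≤ P * (M / w x) + P * (C' / g x ^ 2) := by
    have l1 := hlow x hxU.1
    have hg1 : g x ≤ 1 := gg_le y l x
    have hb2 : (‖fderiv ℝ g x‖ / g x) ^ 2 ≤ 4 / (l ^ 2 * g x ^ 2) := by
      rw [hgd, gg_fderiv_norm, ← hgd]
      have hd : ‖x - y‖ < l := by have := hxU.2; rwa [mem_ball, dist_eq_norm] at this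
      have : 2 / l ^ 2 * ‖x - y‖ / g x ≤ 2 / (l * g x) := by
        have : 2 / l ^ 2 * ‖x - y‖ ≤ 2 / l ^ 2 * l := by gcongr
        calc 2 / l ^ 2 * ‖x - y‖ / g x ≤ 2 / l ^ 2 * l / g x := by gcongr
          _ = 2 / (l * g x) := by field_simp
      calc (2 / l ^ 2 * ‖x - y‖ / g x) ^ 2 ≤ (2 / (l * g x)) ^ 2 := by gcongr
        _ = 4 / (l ^ 2 * g x ^ 2) := by field_simp; norm_num
    have hlg : -(2 * θ * lap g x / g x) ≤ 4 * n / (l ^ 2 * g x ^ 2) := by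
      rw [hgd, gg_lap, ← hgd]
      have e : -(2 * θ * -(2 * (n:ℝ) / l ^ 2) / g x) = θ * g x * (4 * n / (l ^ 2 * g x ^ 2)) := by
        field_simp; ring
      rw [e]
      have : θ * g x ≤ 1 := by nlinarith
      exact mul_le_of_le_one_left (by positivity) this
    set D := 1 / (l ^ 2 * g x ^ 2) with hD
    have hD1 : 1 ≤ D := by
      rw [hD, one_le_div (by positivity)]
      have this_l : l ^ 2 ≤ 1 := pow_le_one₀ hl.le hl1
      have : g x ^ 2 ≤ 1 := pow_le_one₀ hgx.le hg1
      exact mul_le_one₀ this_l (by positivity) this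
    have hb2' : (‖fderiv ℝ g x‖ / g x) ^ 2 ≤ 4 * D := by rw [hD]; rw [mul_one_div]; exact hb2
    have hlg' : -(2 * θ * lap g x / g x) ≤ 4 * n * D := by rw [hD]; rw [mul_one_div]; exact hlg
    -- multiply the pde by ψ / w
    have p1 : h x * ψ x ≤ P * (M / w x) + ψ x * (lap w x / w x) := by
      have : h x * w x ≤ M / l ^ 2 + lap w x := by linarith
      have h3 := mul_le_mul_of_nonneg_left this (by positivity : 0 ≤ ψ x / w x)
      have e1 : ψ x / w x * (h x * w x) = h x * ψ x := by field_simp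
      have e2 : ψ x / w x * (M / l ^ 2 + lap w x) = P * (M / w x) + ψ x * (lap w x / w x) := by
        rw [hP]; field_simp
      rwa [e1, e2] at h3
    have p2 : lap w x / w x ≤ θ * lap ψ x / ψ x + (4 * n + 4 * (2 * θ + 4 * θ ^ 2 / (1 - θ))) * D := by
      rw [div_le_iff₀ hwpos, mul_comm]
      refine hl3.trans (mul_le_mul_of_nonneg_left ?_ hwpos.le)
      have : (2 * θ + 4 * θ ^ 2 / (1 - θ)) * (‖fderiv ℝ g x‖ / g x) ^ 2 ≤ (2 * θ + 4 * θ ^ 2 / (1 - θ)) * (4 * D) := by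
        gcongr
      linarith
    have p3 := mul_le_mul_of_nonneg_left p2 hψx.le
    have e3 : ψ x * (θ * lap ψ x / ψ x + (4 * n + 4 * (2 * θ + 4 * θ ^ 2 / (1 - θ))) * D) =
        θ * lap ψ x + ψ x * ((C' - 2) * D) := by
      rw [hC']; field_simp; ring
    rw [e3] at p3
    have e4 : P * (C' / g x ^ 2) = ψ x * (C' * D) := by rw [hP, hD]; field_simp
    rw [e4]
    have p4 : -(c1 / 2) ≤ (1 - θ) * lap ψ x := by
      have := (abs_le.1 (hψ.bd x hxU.1).2.2).1
      nlinarith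
    have p5 : 2 * ψ x ≤ ψ x * (2 * D) := by nlinarith
    have e5 : ψ x * ((C' - 2) * D) + ψ x * (2 * D) = ψ x * (C' * D) := by ring
    have e6 : (1 - θ) * lap ψ x = lap ψ x - θ * lap ψ x := by ring
    linarith
  -- bound on q x
  have hPθ : q x * l ^ (2 * θ) = w x * g x ^ (2 * θ) / P ^ θ := by
    have e1 : Real.exp (2 * θ * Real.log (g x) - θ * Real.log (ψ x)) = g x ^ (2 * θ) / ψ x ^ θ := by
      rw [Real.exp_sub, Real.rpow_def_of_pos hgx, Real.rpow_def_of_pos hψx]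
      ring_nf
    rw [hq]
    simp only
    rw [e1, hP, Real.div_rpow hψx.le (by positivity), ← Real.rpow_natCast, ← Real.rpow_mul hl.le]
    push_cast
    field_simp
  have hbound : q x * l ^ (2 * θ) ≤ (4 * (1 + C') / c1) ^ θ * M := by
    rw [hPθ, div_le_iff₀ (by positivity)]
    have hg1 : g x ^ (2 * θ) ≤ 1 := Real.rpow_le_one hgx.le (gg_le y l x) (by positivity)
    have hmul : (4 * (1 + C') / c1) ^ θ * P ^ θ = (4 * (1 + C') / c1 * P) ^ θ :=
      (Real.mul_rpow (by positivity) hP0.le).symm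
    have goal' : (4 * (1 + C') / c1) ^ θ * M * P ^ θ = M * (4 * (1 + C') / c1 * P) ^ θ := by
      rw [← hmul]; ring
    rw [goal']
    by_cases hcase : c1 / 4 ≤ P * (M / w x)
    · have a1 : w x / M ≤ 4 * (1 + C') / c1 * P := by
        have : c1 / 4 * w x ≤ P * M := by
          have := mul_le_mul_of_nonneg_right hcase hwpos.le
          have e : P * (M / w x) * w x = P * M := by field_simp
          linarith
        rw [div_le_iff₀ hM]
        have e : 4 * (1 + C') / c1 * P * M = 4 * (1 + C') / c1 * (P * M) := by ring
        rw [e]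
        calc w x = 4 / c1 * (c1 / 4 * w x) := by field_simp
          _ ≤ 4 / c1 * (P * M) := by gcongr
          _ ≤ 4 * (1 + C') / c1 * (P * M) := by gcongr; linarith
      have a2 : w x / M ≤ (w x / M) ^ θ := by
        have : w x / M ≤ 1 := by rw [div_le_one hM]; exact hwM
        calc w x / M = (w x / M) ^ (1:ℝ) := (Real.rpow_one _).symm
          _ ≤ _ := Real.rpow_le_rpow_of_exponent_ge (by positivity) this hθ1.le
      have a3 : (w x / M) ^ θ ≤ (4 * (1 + C') / c1 * P) ^ θ := by gcongr
      calc w x * g x ^ (2 * θ) ≤ w x * 1 := by gcongr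
        _ = M * (w x / M) := by field_simp
        _ ≤ _ := by gcongr; exact a2.trans a3
    · have hcase2 : c1 / 4 ≤ P * (C' / g x ^ 2) := by push Not at hcase; linarith
      have a1 : g x ^ 2 ≤ 4 * (1 + C') / c1 * P := by
        have : c1 / 4 * g x ^ 2 ≤ P * C' := by
          have := mul_le_mul_of_nonneg_right hcase2 (by positivity : 0 ≤ g x ^ 2)
          have e : P * (C' / g x ^ 2) * g x ^ 2 = P * C' := by field_simp
          linarith
        calc g x ^ 2 = 4 / c1 * (c1 / 4 * g x ^ 2) := by field_simp
          _ ≤ 4 / c1 * (P * C') := by gcongr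
          _ ≤ 4 / c1 * (P * (1 + C')) := by gcongr; linarith
          _ = _ := by ring
      have a2 : g x ^ (2 * θ) = (g x ^ 2) ^ θ := by
        rw [← Real.rpow_natCast (g x) 2, ← Real.rpow_mul hgx.le]; norm_num
      rw [a2]
      have : (g x ^ 2) ^ θ ≤ (4 * (1 + C') / c1 * P) ^ θ := by gcongr
      gcongr
  -- conclude at x1
  have hψ1 := hψ.pos x1 hx1.1
  have e1 : Real.exp (2 * θ * Real.log (g x1) - θ * Real.log (ψ x1)) = g x1 ^ (2 * θ) / ψ x1 ^ θ := by
    rw [Real.exp_sub, Real.rpow_def_of_pos hgx1, Real.rpow_def_of_pos hψ1]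
    ring_nf
  have f1 : q x1 * l ^ (2 * θ) ≤ (4 * (1 + C') / c1) ^ θ * M :=
    le_trans (mul_le_mul_of_nonneg_right hqx (by positivity)) hbound
  have f2 : q x1 * l ^ (2 * θ) = w x1 * g x1 ^ (2 * θ) / (ψ x1 / l ^ 2) ^ θ := by
    rw [hq]
    simp only
    rw [e1, Real.div_rpow hψ1.le (by positivity), ← Real.rpow_natCast, ← Real.rpow_mul hl.le]
    push_cast
    field_simp
  rw [f2, div_le_iff₀ (by positivity)] at f1
  exact f1

/-- the radial weight `(1-|x|²)₊²` -/
def eta {n : ℕ} (x : En n) : ℝ := max (gg 0 1 x) 0 ^ 2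

/-- the radial weight `(1-|x|²)₊³/6` -/
def zeta {n : ℕ} (x : En n) : ℝ := (1 / 6) * T3 0 (gg 0 1 x)

lemma eta_nonneg {n : ℕ} (x : En n) : 0 ≤ eta x := by unfold eta; positivity

lemma eta_le {n : ℕ} (x : En n) : eta x ≤ 1 := by
  unfold eta
  have : max (gg 0 1 x) 0 ≤ 1 := max_le (gg_le _ _ _) zero_le_one
  exact pow_le_one₀ (le_max_right _ _) this

lemma zeta_nonneg {n : ℕ} (x : En n) : 0 ≤ zeta x := by unfold zeta T3; positivity

lemma eta_cont {n : ℕ} : Continuous (eta : En n → ℝ) := by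
  unfold eta
  exact (((gg_contDiff 0 1).continuous).sup continuous_const).pow 2

lemma gg_nonpos {n : ℕ} {x : En n} (hx : x ∉ ball (0 : En n) 1) : gg 0 1 x ≤ 0 := by
  by_contra h
  exact hx (mem_ball_of_gg one_pos (not_le.1 h))

lemma eta_zero {n : ℕ} {x : En n} (hx : x ∉ ball (0 : En n) 1) : eta x = 0 := by
  unfold eta; rw [max_eq_right (gg_nonpos hx)]; norm_num

lemma zeta_zero {n : ℕ} {x : En n} (hx : x ∉ ball (0 : En n) 1) : zeta x = 0 := by
  unfold zeta T3; rw [sub_zero, max_eq_right (gg_nonpos hx)]; norm_num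

lemma hcs_of_zero {n : ℕ} {f : En n → ℝ} (h : ∀ x, x ∉ ball (0 : En n) 1 → f x = 0) : HasCompactSupport f :=
  HasCompactSupport.intro (isCompact_closedBall (0 : En n) 1) fun x hx =>
    h x fun h' => hx (ball_subset_closedBall h')

lemma zeta_contDiff {n : ℕ} : ContDiff ℝ 2 (zeta : En n → ℝ) := by
  unfold zeta
  exact contDiff_const.mul ((T3_c2 0).comp (gg_contDiff 0 1))

lemma zeta_fderiv {n : ℕ} (x e : En n) : fderiv ℝ zeta x e = -(inner ℝ x e * eta x) := by
  have h1 := ((T3_deriv 0 (gg 0 1 x)).comp_hasFDerivAt x (gg_hasFDerivAt 0 1 x)).const_mul (1 / 6)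
  have e0 : fderiv ℝ zeta x = (1 / 6 : ℝ) • (T3' 0 (gg 0 1 x) • -((2 / 1 ^ 2 : ℝ) • innerSL ℝ (x - 0))) := h1.fderiv
  rw [e0]
  simp [T3', eta]
  ring

lemma eta_integral_pos {n : ℕ} : 0 < ∫ x : En n, eta x := by
  refine (integral_pos_iff_support_of_nonneg eta_nonneg
    (eta_cont.integrable_of_hasCompactSupport (hcs_of_zero fun x => eta_zero))).2 ?_
  · refine (isOpen_ball (x := (0 : En n)) (ε := 1)).measure_pos volume ⟨0, by simp⟩ |>.trans_le (measure_mono ?_)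
    intro x hx
    have := gg_pos one_pos hx
    simp only [Function.mem_support, eta]
    rw [max_eq_left this.le]; positivity

lemma affine_hasFDerivAt {n : ℕ} (y : En n) (ρ : ℝ) (x : En n) :
    HasFDerivAt (fun x : En n => y + ρ • x) (ρ • ContinuousLinearMap.id ℝ (En n)) x :=
  ((hasFDerivAt_id x).const_smul ρ).const_add y

lemma fderiv_affine {n : ℕ} {f : En n → ℝ} (y : En n) (ρ : ℝ) (x e : En n)
    (hf : DifferentiableAt ℝ f (y + ρ • x)) :
    fderiv ℝ (fun x => f (y + ρ • x)) x e = ρ * fderiv ℝ f (y + ρ • x) e := by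
  have h1 := HasFDerivAt.comp (g := f) x hf.hasFDerivAt (affine_hasFDerivAt y ρ x)
  have h2 : fderiv ℝ (fun x => f (y + ρ • x)) x = (fderiv ℝ f (y + ρ • x)).comp (ρ • ContinuousLinearMap.id ℝ (En n)) :=
    h1.fderiv
  rw [h2]; simp

lemma lap_affine {n : ℕ} {f : En n → ℝ} (hf : ContDiff ℝ 2 f) (y : En n) (ρ : ℝ) (x : En n) :
    lap (fun x => f (y + ρ • x)) x = ρ ^ 2 * lap f (y + ρ • x) := by
  unfold lap
  rw [Finset.mul_sum]
  refine Finset.sum_congr rfl fun i _ => ?_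
  have e : (fun z => fderiv ℝ (fun x => f (y + ρ • x)) z (EuclideanSpace.single i 1)) =
      fun z => ρ * (fun u => fderiv ℝ f u (EuclideanSpace.single i 1)) (y + ρ • z) := by
    funext z; exact fderiv_affine y ρ z _ (hf.differentiable (by norm_num) _)
  have hd := diff_dir (hf.contDiffAt (x := y + ρ • x)) (EuclideanSpace.single i 1)
  rw [e, fderiv_const_mul]
  · have := fderiv_affine (f := fun u => fderiv ℝ f u (EuclideanSpace.single i 1)) y ρ x (EuclideanSpace.single i 1) hd
    simp only [smul_apply, smul_eq_mul]
    rw [this]; ring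
  · exact DifferentiableAt.comp x hd (affine_hasFDerivAt y ρ x).differentiableAt

lemma dil_hasDerivAt {n : ℕ} {f : En n → ℝ} (hf : ContDiff ℝ 1 f) (y : En n) (ρ : ℝ) :
    HasDerivAt (fun ρ : ℝ => ∫ x, f (y + ρ • x) * eta x) (∫ x, fderiv ℝ f (y + ρ • x) x * eta x) ρ := by
  have hcd := hf.continuous_fderiv (by norm_num : (1:WithTop ℕ∞) ≠ 0)
  -- bound of the derivative
  obtain ⟨Cb, hCb⟩ := (isCompact_closedBall y (|ρ| + 1)).exists_bound_of_continuousOn hcd.continuousOn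
  have hinn : ∀ r ∈ ball ρ 1, ∀ x ∈ ball (0 : En n) 1, y + r • x ∈ closedBall y (|ρ| + 1) := by
    intro r hr x hx
    rw [mem_closedBall, dist_eq_norm, add_sub_cancel_left, norm_smul]
    have h1 : ‖r‖ ≤ |ρ| + 1 := by
      rw [mem_ball, Real.dist_eq] at hr
      have : |r| ≤ |r - ρ| + |ρ| := by simpa using abs_add_le (r - ρ) ρ
      rw [Real.norm_eq_abs]; linarith
    have h2 : ‖x‖ ≤ 1 := by rw [mem_ball, dist_zero_right] at hx; exact hx.le
    calc ‖r‖ * ‖x‖ ≤ (|ρ| + 1) * 1 := by gcongr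
      _ = _ := mul_one _
  have hcont : ∀ r : ℝ, Continuous (fun x : En n => f (y + r • x) * eta x) := fun r =>
    (hf.continuous.comp (by fun_prop)).mul eta_cont
  refine (hasDerivAt_integral_of_dominated_loc_of_deriv_le (μ := volume)
    (F := fun r x => f (y + r • x) * eta x) (F' := fun r x => fderiv ℝ f (y + r • x) x * eta x)
    (s := ball ρ 1) (bound := fun x => |Cb| * eta x) (ball_mem_nhds ρ one_pos) ?_ ?_ ?_ ?_ ?_ ?_).2
  · exact Eventually.of_forall fun r => (hcont r).aestronglyMeasurable
  · refine (hcont ρ).integrable_of_hasCompactSupport (hcs_of_zero fun x hx => ?_)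
    rw [eta_zero hx, mul_zero]
  · refine Continuous.aestronglyMeasurable ?_
    exact ((hcd.comp (by fun_prop : Continuous fun x : En n => y + ρ • x)).clm_apply continuous_id).mul eta_cont
  · refine Eventually.of_forall fun x r hr => ?_
    by_cases hx : x ∈ ball (0 : En n) 1
    · rw [norm_mul, Real.norm_of_nonneg (eta_nonneg x)]
      refine mul_le_mul_of_nonneg_right ?_ (eta_nonneg x)
      refine (ContinuousLinearMap.le_opNorm _ _).trans ?_
      have h2 : ‖x‖ ≤ 1 := by rw [mem_ball, dist_zero_right] at hx; exact hx.le
      have h3 := (hCb _ (hinn r hr x hx)).trans (le_abs_self _)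
      calc ‖fderiv ℝ f (y + r • x)‖ * ‖x‖ ≤ |Cb| * 1 := by gcongr
        _ = _ := mul_one _
    · simp [eta_zero hx]
  · exact (eta_cont.integrable_of_hasCompactSupport (hcs_of_zero fun x hx => eta_zero hx)).const_mul _
  · refine Eventually.of_forall fun x r hr => ?_
    have h1 : HasDerivAt (fun r : ℝ => y + r • x) x r := by
      simpa using ((hasDerivAt_id r).smul_const x).const_add y
    exact ((hf.differentiable (by norm_num) _).hasFDerivAt.comp_hasDerivAt r h1).mul_const _

lemma dil_ibp {n : ℕ} {f : En n → ℝ} (hf : ContDiff ℝ 2 f) (y : En n) {ρ : ℝ} (hρ : ρ ≠ 0) :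
    Integrable (fun x => zeta x * lap f (y + ρ • x)) ∧
    ∫ x, fderiv ℝ f (y + ρ • x) x * eta x = ρ * ∫ x, zeta x * lap f (y + ρ • x) := by
  have hF : ContDiff ℝ 2 (fun x : En n => f (y + ρ • x)) := hf.comp (by fun_prop)
  obtain ⟨i1, i2, i3⟩ := ibp (Ω := Set.univ) (zeta_contDiff.of_le (by norm_num))
    (hcs_of_zero fun x => zeta_zero) (Set.subset_univ _) (fun x _ => hF.contDiffAt (x := x))
  have e1 : ∀ x, ∑ i, fderiv ℝ zeta x (ee i) * fderiv ℝ (fun x => f (y + ρ • x)) x (ee i) =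
      -ρ * (fderiv ℝ f (y + ρ • x) x * eta x) := by
    intro x
    have : ∀ i : Fin n, fderiv ℝ zeta x (ee i) * fderiv ℝ (fun x => f (y + ρ • x)) x (ee i) =
        -ρ * eta x * (fderiv ℝ f (y + ρ • x) (ee i) * x i) := fun i => by
      rw [zeta_fderiv, fderiv_affine y ρ x _ (hf.differentiable (by norm_num) _)]
      have : inner ℝ x (ee i) = x i := by
        rw [EuclideanSpace.inner_single_right]; simp
      rw [this]; ring
    rw [Finset.sum_congr rfl (fun i _ => this i), ← Finset.mul_sum, dual_sum_mul]
    ring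
  simp only [e1, lap_affine hf] at i1 i3
  rw [integral_const_mul] at i3
  have e2 : ∀ x, zeta x * (ρ ^ 2 * lap f (y + ρ • x)) = ρ ^ 2 * (zeta x * lap f (y + ρ • x)) := fun x => by ring
  simp only [e2] at i1 i3
  rw [integral_const_mul] at i3
  constructor
  · have := i1.const_mul ((ρ ^ 2)⁻¹)
    refine this.congr (Eventually.of_forall fun x => ?_)
    simp only
    rw [← mul_assoc, inv_mul_cancel₀ (by positivity), one_mul]
  · have : ρ * (∫ x, fderiv ℝ f (y + ρ • x) x * eta x) = ρ * (ρ * ∫ x, zeta x * lap f (y + ρ • x)) := by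
      nlinarith
    exact mul_left_cancel₀ hρ this

/-- sub-mean-value inequality -/
lemma dil_sub {n : ℕ} {f : En n → ℝ} (hf : ContDiff ℝ 2 f) (y : En n) {r A : ℝ} (hr : 0 ≤ r)
    (hA : ∀ x ∈ ball y r, -A ≤ lap f x) :
    (∫ x : En n, eta x) * f y ≤ (∫ x, f (y + r • x) * eta x) + (∫ x : En n, zeta x) * A * r ^ 2 / 2 := by
  set Z := ∫ x : En n, zeta x with hZ
  have hf1 : ContDiff ℝ 1 f := hf.of_le (by norm_num)
  have hd : ∀ ρ : ℝ, HasDerivAt (fun ρ : ℝ => (∫ x, f (y + ρ • x) * eta x) + Z * A * ρ ^ 2 / 2)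
      ((∫ x, fderiv ℝ f (y + ρ • x) x * eta x) + Z * A * ρ) ρ := fun ρ => by
    refine (dil_hasDerivAt hf1 y ρ).add ?_
    have := ((hasDerivAt_pow 2 ρ).const_mul (Z * A)).div_const 2
    exact this.congr_deriv (by push_cast; ring)
  have hmono : MonotoneOn (fun ρ : ℝ => (∫ x, f (y + ρ • x) * eta x) + Z * A * ρ ^ 2 / 2) (Set.Icc 0 r) := by
    refine monotoneOn_of_deriv_nonneg (convex_Icc 0 r)
      (fun ρ _ => (hd ρ).continuousAt.continuousWithinAt)
      (fun ρ _ => (hd ρ).differentiableAt.differentiableWithinAt) ?_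
    intro ρ hρ
    rw [interior_Icc] at hρ
    rw [(hd ρ).deriv]
    obtain ⟨i1, i2⟩ := dil_ibp hf y hρ.1.ne'
    rw [i2]
    have iz : Integrable (zeta : En n → ℝ) :=
      zeta_contDiff.continuous.integrable_of_hasCompactSupport (hcs_of_zero fun x => zeta_zero)
    have : -(Z * A) ≤ ∫ x, zeta x * lap f (y + ρ • x) := by
      rw [← mul_neg, hZ, ← integral_mul_const]
      refine integral_mono (iz.mul_const _) i1 fun x => ?_
      by_cases hx : x ∈ ball (0 : En n) 1
      · refine mul_le_mul_of_nonneg_left (hA _ ?_) (zeta_nonneg x)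
        rw [mem_ball, dist_eq_norm, add_sub_cancel_left, norm_smul, Real.norm_of_nonneg hρ.1.le]
        rw [mem_ball, dist_zero_right] at hx
        nlinarith [hρ.1, hρ.2, norm_nonneg x]
      · simp [zeta_zero hx]
    nlinarith [hρ.1]
  have := hmono (Set.left_mem_Icc.2 hr) (Set.right_mem_Icc.2 hr) hr
  simp only [zero_smul, add_zero] at this
  rw [integral_const_mul] at this
  linarith

structure Good {n : ℕ} (Ω : Set (En n)) (ψ h w : En n → ℝ) (y : En n) (l M : ℝ) : Prop where
  xx : XX Ω w
  dom : ∃ K, 0 < K ∧ ∀ x ∈ closure Ω, |w x| ≤ K * ψ x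
  sub : ∀ x ∈ Ω ∩ ball y l, 0 < w x → w x ≤ M ∧ -lap w x + h x * w x ≤ M / l ^ 2

lemma tr3_contDiff {n : ℕ} {Ω : Set (En n)} (ho : IsOpen Ω) (hb : Bornology.IsBounded Ω) {w : En n → ℝ}
    (hw : XX Ω w) {ε : ℝ} (hε : 0 < ε) : ContDiff ℝ 2 (tr Ω (T3 ε) w) :=
  tr_contDiff ho hb hw.cont (fun x hx => hw.at ho hx) hw.bd hε (T3_c2 ε) (fun t => T3_zero_abs t)

lemma Eprime {n : ℕ} {Ω : Set (En n)} (ho : IsOpen Ω) (hb : Bornology.IsBounded Ω)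
    {ψ : En n → ℝ} {c1 C2 C4 : ℝ} (hψ : PsiD Ω ψ c1 C2) (hC4 : 0 < C4) {M ε : ℝ} (hM : 0 < M) (hε : 0 < ε) :
    ∃ C : ℝ, 0 < C ∧ ∀ h, Adm Ω ψ c1 C4 h → ∀ (y : En n) (l : ℝ), 0 < l → l ≤ 1 → ∀ w, Good Ω ψ h w y l M →
      ∀ r, 0 ≤ r → r ≤ l / 2 →
      (∫ x : En n, eta x) * tr Ω (T3 ε) w y ≤ C * (r / l) ^ 2 + ∫ x, tr Ω (T3 ε) w (y + r • x) * eta x := by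
  obtain ⟨θ, Cb, hθ, -, hCb, hbar⟩ := barrier ho hb hψ
  set c := ε * (3 / 4 : ℝ) ^ (2 * θ) / (Cb * M) with hc
  have hcp : 0 < c := by positivity
  set κ := c ^ (1 / θ) with hκ
  have hκp : 0 < κ := by positivity
  set A0 := 3 * M ^ 2 * ((C4 / κ + 1) * M) with hA0
  have hA0p : 0 < A0 := by positivity
  have hZ : 0 ≤ ∫ x : En n, zeta x := integral_nonneg zeta_nonneg
  refine ⟨(∫ x : En n, zeta x) * A0 / 2 + 1, by positivity, ?_⟩
  intro h hA y l hl hl1 w hw r hr0 hr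
  have key : ∀ x ∈ ball y r, -(A0 / l ^ 2) ≤ lap (tr Ω (T3 ε) w) x := by
    intro x hx
    have hl2 : (0:ℝ) < l ^ 2 := by positivity
    by_cases hxΩ : x ∈ Ω
    · rw [lap_congr (tr_ev_mem ho hxΩ), lap_comp (hw.xx.at ho hxΩ)
        (Eventually.of_forall fun t => T3_deriv ε t) (T3'_deriv ε _)]
      have h1 : 0 ≤ 6 * max (w x - ε) 0 * ‖fderiv ℝ w x‖ ^ 2 := by positivity
      suffices -(A0 / l ^ 2) ≤ T3' ε (w x) * lap w x by linarith
      by_cases hwε : w x ≤ ε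
      · have : T3' ε (w x) = 0 := by
          unfold T3'; rw [max_eq_right (by linarith)]; norm_num
        rw [this, zero_mul]
        have : 0 ≤ A0 / l ^ 2 := by positivity
        linarith
      push Not at hwε
      have hw0 : 0 < w x := hε.trans hwε
      have hxl : x ∈ Ω ∩ ball y l := ⟨hxΩ, ball_subset_ball (by linarith) hx⟩
      obtain ⟨hwM, hLw⟩ := hw.sub x hxl hw0
      have hb1 := hbar h hA.low y l hl hl1 w hw.xx hw.dom M hM hw.sub x hxl hw0
      have hg : 3 / 4 ≤ gg y l x := by
        unfold gg
        have : ‖x - y‖ ≤ l / 2 := by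
          rw [mem_ball, dist_eq_norm] at hx; linarith
        have h2 : ‖x - y‖ ^ 2 / l ^ 2 ≤ 1 / 4 := by
          rw [div_le_iff₀ hl2]; nlinarith [norm_nonneg (x - y)]
        linarith
      have hb2 : ε * (3 / 4 : ℝ) ^ (2 * θ) ≤ Cb * M * (ψ x / l ^ 2) ^ θ := by
        refine le_trans ?_ hb1
        have := Real.rpow_le_rpow (by norm_num) hg (show 0 ≤ 2 * θ by positivity)
        gcongr
      have hψp := hψ.pos x hxΩ
      have hb3 : κ ≤ ψ x / l ^ 2 := by
        have h3 : c ≤ (ψ x / l ^ 2) ^ θ := by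
          rw [hc, div_le_iff₀ (by positivity)]; linarith
        have h4 := Real.rpow_le_rpow hcp.le h3 (show 0 ≤ 1 / θ by positivity)
        rwa [← Real.rpow_mul (by positivity), mul_one_div_cancel hθ.ne', Real.rpow_one] at h4
      rw [le_div_iff₀ hl2] at hb3
      have hh : |h x| ≤ C4 / κ / l ^ 2 := by
        rw [div_div, le_div_iff₀ (by positivity)]
        exact (mul_le_mul_of_nonneg_left hb3 (abs_nonneg _)).trans (hA.abs x hxΩ)
      have hlap : -((C4 / κ + 1) * M / l ^ 2) ≤ lap w x := by
        have h5 : -(|h x| * M) ≤ h x * w x := by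
          have := neg_abs_le (h x * w x)
          rw [abs_mul, abs_of_pos hw0] at this
          have := mul_le_mul_of_nonneg_left hwM (abs_nonneg (h x))
          linarith
        have h6 : |h x| * M ≤ C4 / κ / l ^ 2 * M := by gcongr
        have h7 : (C4 / κ + 1) * M / l ^ 2 = C4 / κ / l ^ 2 * M + M / l ^ 2 := by ring
        linarith
      have hT0 : 0 ≤ T3' ε (w x) := by unfold T3'; positivity
      have hT : T3' ε (w x) ≤ 3 * M ^ 2 := by
        unfold T3'
        have : max (w x - ε) 0 ≤ M := max_le (by linarith) hM.le
        have h0 : 0 ≤ max (w x - ε) 0 := le_max_right _ _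
        have : max (w x - ε) 0 ^ 2 ≤ M ^ 2 := by gcongr
        linarith
      have h8 : 0 ≤ (C4 / κ + 1) * M / l ^ 2 := by positivity
      calc -(A0 / l ^ 2) = -(3 * M ^ 2 * ((C4 / κ + 1) * M / l ^ 2)) := by rw [hA0]; ring
        _ ≤ -(T3' ε (w x) * ((C4 / κ + 1) * M / l ^ 2)) := by
            have := mul_le_mul_of_nonneg_right hT h8
            linarith
        _ ≤ _ := by
            have := mul_le_mul_of_nonneg_left hlap hT0
            linarith
    · have : x ∉ tsupport (tr Ω (T3 ε) w) := fun hx' =>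
        hxΩ (tr_tsupport' ho hb hw.xx.cont hw.xx.bd hε (fun t => T3_zero_abs t) hx')
      have h0 : tr Ω (T3 ε) w =ᶠ[𝓝 x] fun _ => (0:ℝ) := notMem_tsupport_iff_eventuallyEq.1 this
      rw [lap_congr h0]
      have : 0 ≤ A0 / l ^ 2 := by positivity
      simp [lap]
      exact this
  have := dil_sub (tr3_contDiff ho hb hw.xx hε) y hr0 key
  have h2 : (∫ x : En n, zeta x) * (A0 / l ^ 2) * r ^ 2 / 2 ≤ ((∫ x : En n, zeta x) * A0 / 2 + 1) * (r / l) ^ 2 := by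
    have : (∫ x : En n, zeta x) * (A0 / l ^ 2) * r ^ 2 / 2 = ((∫ x : En n, zeta x) * A0 / 2) * (r / l) ^ 2 := by
      ring
    rw [this]
    gcongr; linarith
  linarith

/-- smallness in average gives pointwise smallness -/
lemma Eone {n : ℕ} (hn : 3 ≤ n) {Ω : Set (En n)} (ho : IsOpen Ω) (hb : Bornology.IsBounded Ω)
    {ψ : En n → ℝ} {c1 C2 C4 : ℝ} (hψ : PsiD Ω ψ c1 C2) (hC4 : 0 < C4) {M ε : ℝ} (hM : 0 < M) (hε : 0 < ε) :
    ∃ δ : ℝ, 0 < δ ∧ ∀ h, Adm Ω ψ c1 C4 h → ∀ (y : En n) (l : ℝ), y ∈ Ω → 0 < l → l ≤ 1 →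
      ∀ w, Good Ω ψ h w y l M → (∫ x in Ω ∩ ball y l, |w x| ^ twoStar n) ≤ δ * l ^ n → w y ≤ 2 * ε := by
  obtain ⟨C, hC, hE⟩ := Eprime ho hb hψ hC4 hM hε
  have hη := eta_integral_pos (n := n)
  have h2 := twoStar_pos hn
  set c := ∫ x : En n, eta x with hc
  obtain ⟨d, hd0, hd1, hd⟩ : ∃ d : ℝ, 0 < d ∧ d ≤ 1 / 2 ∧ C * d ^ 2 ≤ c * ε ^ 3 / 2 := by
    refine ⟨min (1 / 2) (c * ε ^ 3 / (2 * C)), by positivity, min_le_left _ _, ?_⟩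
    set d := min (1 / 2) (c * ε ^ 3 / (2 * C)) with hd
    have h0 : 0 < d := by positivity
    have h3 : d ≤ 1 := (min_le_left _ _).trans (by norm_num)
    have h4 : d ≤ c * ε ^ 3 / (2 * C) := min_le_right _ _
    rw [le_div_iff₀ (by positivity)] at h4
    nlinarith [mul_pos hC h0]
  refine ⟨d ^ n * (ε ^ twoStar n / M ^ 3) * (c * ε ^ 3 / 4), by positivity, ?_⟩
  intro h hA y l hy hl hl1 w hw hintg
  by_contra hcon
  push Not at hcon
  have hr0 : 0 < d * l := by positivity
  have hr : d * l ≤ l / 2 := by nlinarith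
  have e1 := hE h hA y l hl hl1 w hw (d * l) hr0.le hr
  rw [mul_div_cancel_right₀ _ hl.ne', tr_mem hy] at e1
  have e2 : ε ^ 3 < T3 ε (w y) := by
    unfold T3
    rw [max_eq_left (by linarith)]
    gcongr; linarith
  -- bound the average
  have hpt : ∀ x, tr Ω (T3 ε) w (y + (d * l) • x) * eta x ≤
      (fun z => (M ^ 3 / ε ^ twoStar n) * (Ω ∩ ball y l).indicator (fun z => |w z| ^ twoStar n) z) (y + (d * l) • x) := by
    intro x
    have hR0 : ∀ z, 0 ≤ (M ^ 3 / ε ^ twoStar n) * (Ω ∩ ball y l).indicator (fun z => |w z| ^ twoStar n) z := by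
      intro z
      have : 0 ≤ (Ω ∩ ball y l).indicator (fun z => |w z| ^ twoStar n) z :=
        Set.indicator_nonneg (fun _ _ => by positivity) _
      positivity
    by_cases hx : x ∈ ball (0 : En n) 1
    swap
    · rw [eta_zero hx, mul_zero]; exact hR0 _
    set z := y + (d * l) • x with hz
    by_cases hzΩ : z ∈ Ω
    swap
    · rw [tr_not hzΩ, zero_mul]; exact hR0 _
    have hzb : z ∈ ball y l := by
      rw [mem_ball, dist_eq_norm, hz, add_sub_cancel_left, norm_smul, Real.norm_of_nonneg hr0.le]
      rw [mem_ball_zero_iff] at hx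
      nlinarith [norm_nonneg x]
    rw [tr_mem hzΩ]
    by_cases hwz : w z ≤ ε
    · rw [T3_zero hwz, zero_mul]; exact hR0 _
    push Not at hwz
    have hw0 := hε.trans hwz
    have hwM := (hw.sub z ⟨hzΩ, hzb⟩ hw0).1
    have hT : T3 ε (w z) ≤ M ^ 3 := by
      unfold T3
      have : max (w z - ε) 0 ≤ M := max_le (by linarith) hM.le
      have h0 : 0 ≤ max (w z - ε) 0 := le_max_right _ _
      gcongr
    have hT0 : 0 ≤ T3 ε (w z) := by unfold T3; positivity
    have h5 : T3 ε (w z) * eta x ≤ M ^ 3 :=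
      (mul_le_of_le_one_right hT0 (eta_le x)).trans hT
    refine h5.trans ?_
    simp only
    rw [Set.indicator_of_mem (show z ∈ Ω ∩ ball y l from ⟨hzΩ, hzb⟩), abs_of_pos hw0,
      div_mul_eq_mul_div, le_div_iff₀ (by positivity)]
    have := Real.rpow_le_rpow hε.le hwz.le (by linarith : 0 ≤ twoStar n)
    gcongr
  have hmeas : MeasurableSet (Ω ∩ ball y l) := (ho.inter isOpen_ball).measurableSet
  have hI : Integrable ((Ω ∩ ball y l).indicator (fun z => |w z| ^ twoStar n)) := by
    rw [integrable_indicator_iff hmeas]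
    have : ContinuousOn (fun z => |w z| ^ twoStar n) (closure Ω) :=
      hw.xx.cont.abs.rpow_const (fun _ _ => Or.inr (by linarith))
    exact (this.integrableOn_compact hb.isCompact_closure).mono_set
      (Set.inter_subset_left.trans subset_closure)
  have hI2 : Integrable (fun z => (M ^ 3 / ε ^ twoStar n) * (Ω ∩ ball y l).indicator (fun z => |w z| ^ twoStar n) z) :=
    hI.const_mul _
  have hI3 : Integrable (fun x : En n => (fun z => (M ^ 3 / ε ^ twoStar n) * (Ω ∩ ball y l).indicator (fun z => |w z| ^ twoStar n) z) (y + (d * l) • x)) := by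
    have := (hI2.comp_add_left y).comp_smul (R := d * l) hr0.ne'
    exact this
  have hI4 : Integrable (fun x : En n => tr Ω (T3 ε) w (y + (d * l) • x) * eta x) := by
    refine Continuous.integrable_of_hasCompactSupport ?_ (hcs_of_zero fun x hx => by rw [eta_zero hx, mul_zero])
    exact ((tr3_contDiff ho hb hw.xx hε).continuous.comp (by fun_prop)).mul eta_cont
  have e3 := integral_mono hI4 hI3 hpt
  have e4 : ∫ x : En n, (fun z => (M ^ 3 / ε ^ twoStar n) * (Ω ∩ ball y l).indicator (fun z => |w z| ^ twoStar n) z) (y + (d * l) • x)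
      = ((d * l) ^ n)⁻¹ * ((M ^ 3 / ε ^ twoStar n) * ∫ x in Ω ∩ ball y l, |w x| ^ twoStar n) := by
    have := Measure.integral_comp_smul (volume : Measure (En n)) (fun x => (fun z => (M ^ 3 / ε ^ twoStar n) * (Ω ∩ ball y l).indicator (fun z => |w z| ^ twoStar n) z) (y + x)) (d * l)
    rw [this, integral_add_left_eq_self (fun z => (M ^ 3 / ε ^ twoStar n) * (Ω ∩ ball y l).indicator (fun z => |w z| ^ twoStar n) z) y, integral_const_mul, integral_indicator hmeas]
    simp only [finrank_euclideanSpace, Fintype.card_fin, smul_eq_mul]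
    rw [abs_of_pos (by positivity)]
  rw [e4] at e3
  have e5 : ((d * l) ^ n)⁻¹ * ((M ^ 3 / ε ^ twoStar n) * ∫ x in Ω ∩ ball y l, |w x| ^ twoStar n) ≤ c * ε ^ 3 / 4 := by
    calc _ ≤ ((d * l) ^ n)⁻¹ * ((M ^ 3 / ε ^ twoStar n) * (d ^ n * (ε ^ twoStar n / M ^ 3) * (c * ε ^ 3 / 4) * l ^ n)) := by
          gcongr
      _ = c * ε ^ 3 / 4 := by
          rw [mul_pow]
          have : 0 < ε ^ twoStar n := by positivity
          field_simp
  have e6 : c * ε ^ 3 < c * T3 ε (w y) := by gcongr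
  have : 0 < c * ε ^ 3 := by positivity
  linarith

/-- the exponent `(n-2)/2` -/
def pp (n : ℕ) : ℝ := ((n : ℝ) - 2) / 2

lemma pp_pos {n : ℕ} (hn : 3 ≤ n) : 0 < pp n := by
  have h : (3:ℝ) ≤ n := by exact_mod_cast hn
  unfold pp; linarith

lemma pp_star {n : ℕ} (hn : 3 ≤ n) : pp n * twoStar n = n := by
  have h : (3:ℝ) ≤ n := by exact_mod_cast hn
  have : (n:ℝ) - 2 ≠ 0 := by linarith
  unfold pp twoStar; field_simp

lemma pp_two {n : ℕ} : 2 * pp n = (n:ℝ) - 2 := by unfold pp; ring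

lemma pp_star2 {n : ℕ} (hn : 3 ≤ n) : pp n * (twoStar n - 2) = 2 := by
  have := pp_star hn
  have := pp_two (n := n)
  nlinarith

lemma pp_star1 {n : ℕ} (hn : 3 ≤ n) : pp n * (twoStar n - 1) = pp n + 2 := by
  have := pp_star2 hn
  linarith

/-- the constant `1/(n(n-2))` -/
def aa (n : ℕ) : ℝ := 1 / ((n : ℝ) * ((n : ℝ) - 2))

lemma aa_pos {n : ℕ} (hn : 3 ≤ n) : 0 < aa n := by
  have h : (3:ℝ) ≤ n := by exact_mod_cast hn
  unfold aa
  have : 0 < (n:ℝ) - 2 := by linarith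
  positivity

lemma aa_le {n : ℕ} (hn : 3 ≤ n) : aa n ≤ 1 := by
  have h : (3:ℝ) ≤ n := by exact_mod_cast hn
  unfold aa
  rw [div_le_one (by nlinarith)]
  nlinarith

lemma B0_eq {n : ℕ} (x : En n) : B0 n x = (1 + aa n * ‖x‖ ^ 2) ^ (-pp n) := by
  unfold B0 aa pp
  congr 2
  ring

lemma bs_pos {n : ℕ} (hn : 3 ≤ n) (x : En n) : 1 ≤ 1 + aa n * ‖x‖ ^ 2 := by
  have := aa_pos hn
  have : 0 ≤ aa n * ‖x‖ ^ 2 := by positivity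
  linarith

lemma B0_fderiv {n : ℕ} (hn : 3 ≤ n) (x : En n) :
    fderiv ℝ (B0 n) x = (-(2 * pp n * aa n) * (1 + aa n * ‖x‖ ^ 2) ^ (-pp n - 1)) • innerSL ℝ x := by
  have h0 : B0 n = fun x => (1 + aa n * ‖x‖ ^ 2) ^ (-pp n) := funext B0_eq
  rw [h0]
  have h1 : HasFDerivAt (fun x : En n => 1 + aa n * ‖x‖ ^ 2) (aa n • (2 • innerSL ℝ x)) x :=
    (((hasStrictFDerivAt_norm_sq x).hasFDerivAt).const_mul (aa n)).const_add 1
  have h2 := (Real.hasDerivAt_rpow_const (x := 1 + aa n * ‖x‖ ^ 2) (p := -pp n)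
    (Or.inl (by linarith [bs_pos hn x]))).comp_hasFDerivAt x h1
  have h3 := h2.fderiv
  refine Eq.trans h3 ?_
  ext e
  simp
  ring

lemma B0_fderiv_self {n : ℕ} (hn : 3 ≤ n) (x : En n) : fderiv ℝ (B0 n) x x ≤ 0 := by
  rw [B0_fderiv hn]
  have := pp_pos hn
  have := aa_pos hn
  have := bs_pos hn x
  have h : 0 ≤ (2 * pp n * aa n) * (1 + aa n * ‖x‖ ^ 2) ^ (-pp n - 1) * ‖x‖ ^ 2 := by positivity
  simp
  nlinarith

lemma B0_fderiv_sq {n : ℕ} (hn : 3 ≤ n) (x : En n) :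
    ‖fderiv ℝ (B0 n) x‖ ^ 2 ≤ (4 * pp n ^ 2 * aa n) * (1 + aa n * ‖x‖ ^ 2) ^ (-((n:ℝ) - 1)) := by
  have hp := pp_pos hn
  have ha := aa_pos hn
  have hb := bs_pos hn x
  set b := 1 + aa n * ‖x‖ ^ 2 with hbd
  have hb0 : 0 < b := by linarith
  rw [B0_fderiv hn, norm_smul, innerSL_apply_norm, mul_pow, Real.norm_eq_abs, sq_abs, mul_pow]
  have e : (b ^ (-pp n - 1)) ^ 2 * b = b ^ (-((n:ℝ) - 1)) := by
    rw [← Real.rpow_natCast, ← Real.rpow_mul hb0.le, ← Real.rpow_add_one hb0.ne']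
    congr 1
    have := pp_two (n := n)
    push_cast; linarith
  have h : aa n * ‖x‖ ^ 2 ≤ b := by rw [hbd]; linarith
  calc _ = 4 * pp n ^ 2 * aa n * (b ^ (-pp n - 1)) ^ 2 * (aa n * ‖x‖ ^ 2) := by ring
    _ ≤ 4 * pp n ^ 2 * aa n * (b ^ (-pp n - 1)) ^ 2 * b := by gcongr
    _ = _ := by rw [← e]; ring

lemma B0_fderiv_le {n : ℕ} (hn : 3 ≤ n) (x : En n) :
    ‖fderiv ℝ (B0 n) x‖ ^ 2 ≤ (4 * pp n ^ 2 * aa n) * B0 n x ^ 2 := by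
  have hp := pp_pos hn
  have ha := aa_pos hn
  have hb := bs_pos hn x
  refine (B0_fderiv_sq hn x).trans ?_
  rw [B0_eq]
  have : ((1 + aa n * ‖x‖ ^ 2) ^ (-pp n)) ^ 2 = (1 + aa n * ‖x‖ ^ 2) ^ (-((n:ℝ) - 2)) := by
    rw [← Real.rpow_natCast, ← Real.rpow_mul (by linarith)]
    congr 1
    have := pp_two (n := n)
    push_cast; linarith
  rw [this]
  have := Real.rpow_le_rpow_of_exponent_le hb (show -((n:ℝ) - 1) ≤ -((n:ℝ) - 2) by linarith)
  gcongr

lemma bs_int {n : ℕ} (hn : 3 ≤ n) {k : ℝ} (hk : (n:ℝ) < 2 * k) :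
    Integrable (fun x : En n => (1 + aa n * ‖x‖ ^ 2) ^ (-k)) := by
  have ha := aa_pos hn
  have h1 : Integrable (fun x : En n => ((1 : ℝ) + ‖x‖ ^ 2) ^ (-(2 * k) / 2)) :=
    integrable_rpow_neg_one_add_norm_sq (by simpa using hk)
  refine (h1.const_mul ((aa n) ^ (-k))).mono' ?_ (Eventually.of_forall fun x => ?_)
  · apply Measurable.aestronglyMeasurable (by fun_prop)
  have hb := bs_pos hn x
  rw [Real.norm_of_nonneg (by positivity), show -(2 * k) / 2 = -k by ring,
    ← Real.mul_rpow ha.le (by positivity)]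
  have h2 : aa n * (1 + ‖x‖ ^ 2) ≤ 1 + aa n * ‖x‖ ^ 2 := by
    have := aa_le hn
    linarith
  have h3 : (0:ℝ) ≤ n := by positivity
  exact Real.rpow_le_rpow_of_nonpos (by positivity) h2 (by linarith)

lemma B0_grad_int {n : ℕ} (hn : 3 ≤ n) : Integrable (fun x : En n => ‖fderiv ℝ (B0 n) x‖ ^ 2) := by
  have h : (3:ℝ) ≤ n := by exact_mod_cast hn
  refine ((bs_int hn (k := (n:ℝ) - 1) (by linarith)).const_mul (4 * pp n ^ 2 * aa n)).mono' ?_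
    (Eventually.of_forall fun x => ?_)
  · exact (((B0_contDiff hn).continuous_fderiv (by norm_num)).norm.pow 2).aestronglyMeasurable
  rw [Real.norm_of_nonneg (by positivity)]
  exact B0_fderiv_sq hn x

lemma B0_star_int {n : ℕ} (hn : 3 ≤ n) : Integrable (fun x : En n => B0 n x ^ twoStar n) := by
  have h : (3:ℝ) ≤ n := by exact_mod_cast hn
  have e : (fun x : En n => B0 n x ^ twoStar n) = fun x => (1 + aa n * ‖x‖ ^ 2) ^ (-(n:ℝ)) := by
    funext x
    rw [B0_eq, ← Real.rpow_mul (by linarith [bs_pos hn x])]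
    congr 1
    have := pp_star hn
    linarith
  rw [e]
  exact bs_int hn (by linarith)

lemma bubble_at {n : ℕ} {μ : ℝ} (hμ : 0 < μ) (x0 x : En n) :
    bubble n μ x0 (x0 + μ • x) = μ ^ (-pp n) * B0 n x := by
  unfold bubble
  rw [add_sub_cancel_left, smul_smul, inv_mul_cancel₀ hμ.ne', one_smul]
  rfl

lemma bubble_fderiv_at {n : ℕ} (hn : 3 ≤ n) {μ : ℝ} (hμ : 0 < μ) (x0 x : En n) :
    fderiv ℝ (bubble n μ x0) (x0 + μ • x) = μ ^ (-pp n - 1) • fderiv ℝ (B0 n) x := by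
  ext e
  have h1 := fderiv_affine (f := bubble n μ x0) x0 μ x e
    ((bubble_contDiff hn μ x0).differentiable (by norm_num) _)
  have h2 : (fun x => bubble n μ x0 (x0 + μ • x)) = fun x => μ ^ (-pp n) * B0 n x :=
    funext fun x => bubble_at hμ x0 x
  rw [h2, fderiv_const_mul ((B0_contDiff hn).differentiable (by norm_num) _)] at h1
  simp only [ContinuousLinearMap.smul_apply, smul_eq_mul] at h1 ⊢
  rw [Real.rpow_sub_one hμ.ne', div_mul_eq_mul_div, h1]
  field_simp

/-- change of variables -/
lemma int_scale {n : ℕ} (f : En n → ℝ) (x0 : En n) {μ : ℝ} (hμ : 0 < μ) :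
    ∫ x, f (x0 + μ • x) = (μ ^ n)⁻¹ * ∫ x, f x := by
  have := Measure.integral_comp_smul (volume : Measure (En n)) (fun x => f (x0 + x)) μ
  rw [this, integral_add_left_eq_self f x0]
  simp only [finrank_euclideanSpace, Fintype.card_fin, smul_eq_mul]
  rw [abs_of_pos (by positivity)]

lemma integrable_scale {n : ℕ} {f : En n → ℝ} (x0 : En n) {μ : ℝ} (hμ : 0 < μ) (hf : Integrable f) :
    Integrable (fun x => f (x0 + μ • x)) :=
  (hf.comp_add_left x0).comp_smul (R := μ) hμ.ne'

lemma integrable_unscale {n : ℕ} {f : En n → ℝ} (x0 : En n) {μ : ℝ} (hμ : 0 < μ)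
    (hf : Integrable (fun x => f (x0 + μ • x))) : Integrable f := by
  have h1 := integrable_scale (-(μ⁻¹ • x0)) (inv_pos.2 hμ) hf
  refine h1.congr (Eventually.of_forall fun x => ?_)
  simp only [smul_add, smul_neg, smul_smul, mul_inv_cancel₀ hμ.ne', one_smul]
  congr 1
  abel

lemma bubble_star_int {n : ℕ} (hn : 3 ≤ n) {μ : ℝ} (hμ : 0 < μ) (x0 : En n) :
    Integrable (fun x => bubble n μ x0 x ^ twoStar n) ∧
      ∫ x, bubble n μ x0 x ^ twoStar n = ∫ x : En n, B0 n x ^ twoStar n := by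
  have e : ∀ x, bubble n μ x0 (x0 + μ • x) ^ twoStar n = (μ ^ n)⁻¹ * B0 n x ^ twoStar n := by
    intro x
    rw [bubble_at hμ, Real.mul_rpow (by positivity) (B0_pos hn x).le, ← Real.rpow_mul hμ.le]
    congr 1
    rw [show -pp n * twoStar n = -(n:ℝ) by linarith [pp_star hn], Real.rpow_neg hμ.le, Real.rpow_natCast]
  constructor
  · refine integrable_unscale x0 hμ ?_
    simp only [e]
    exact (B0_star_int hn).const_mul _
  · have h := int_scale (fun x => bubble n μ x0 x ^ twoStar n) x0 hμ
    simp only [e] at h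
    rw [integral_const_mul] at h
    exact (mul_left_cancel₀ (by positivity) h).symm

lemma grad_scale {n : ℕ} (hn : 3 ≤ n) {μ : ℝ} (hμ : 0 < μ) (x0 x : En n) :
    ‖fderiv ℝ (bubble n μ x0) (x0 + μ • x)‖ ^ 2 = (μ ^ n)⁻¹ * ‖fderiv ℝ (B0 n) x‖ ^ 2 := by
  rw [bubble_fderiv_at hn hμ, norm_smul, mul_pow, Real.norm_of_nonneg (by positivity)]
  congr 1
  rw [← Real.rpow_natCast, ← Real.rpow_mul hμ.le, ← Real.rpow_natCast μ n, ← Real.rpow_neg hμ.le]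
  congr 1
  have := pp_two (n := n)
  push_cast; linarith

lemma bubble_grad_int {n : ℕ} (hn : 3 ≤ n) {μ : ℝ} (hμ : 0 < μ) (x0 : En n) :
    Integrable (fun x => ‖fderiv ℝ (bubble n μ x0) x‖ ^ 2) := by
  refine integrable_unscale x0 hμ ?_
  simp only [grad_scale hn hμ]
  exact (B0_grad_int hn).const_mul _

lemma bubble_decay {n : ℕ} (hn : 3 ≤ n) {μ : ℝ} (hμ : 0 < μ) (x0 x : En n) :
    bubble n μ x0 x ≤ (aa n / 2) ^ (-pp n) * (‖x - x0‖ + μ) ^ (-pp n) := by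
  have ha := aa_pos hn
  have ha1 := aa_le hn
  have hp := pp_pos hn
  have e : bubble n μ x0 x = μ ^ (-pp n) * B0 n (μ⁻¹ • (x - x0)) := rfl
  rw [e, B0_eq, ← Real.mul_rpow hμ.le (by positivity), ← Real.mul_rpow (by positivity) (by positivity)]
  refine Real.rpow_le_rpow_of_nonpos (by positivity) ?_ (by linarith)
  rw [norm_smul, Real.norm_of_nonneg (by positivity)]
  set t := μ⁻¹ * ‖x - x0‖ with ht
  have h1 : ‖x - x0‖ = μ * t := by rw [ht]; field_simp
  rw [h1]
  have h2 : aa n / 2 * (t + 1) ≤ 1 + aa n * t ^ 2 := by nlinarith [mul_nonneg ha.le (sq_nonneg (t - 1 / 2))]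
  have := mul_le_mul_of_nonneg_left h2 hμ.le
  linarith

lemma transport {n : ℕ} {F g : En n → ℝ} (hF : ContDiff ℝ 1 F) (hg0 : ∀ x, 0 ≤ g x)
    (hgi : Integrable (fun x => g x ^ 2)) {ϑ : ℝ} (hϑ : 0 < ϑ) (hg : ∫ x, g x ^ 2 ≤ ϑ ^ 2)
    (hd : ∀ x, fderiv ℝ F x x ≤ 2 * g x * ‖x‖) {ρ R : ℝ} (hρ : 0 < ρ) (hR : ρ ≤ R) :
    ∫ x, F (R • x) * eta x ≤ (∫ x, F (ρ • x) * eta x) +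
      R * (ϑ * ((ρ ^ n)⁻¹ + ∫ x : En n, eta x)) := by
  set c := ∫ x : En n, eta x with hc
  set K := ϑ * ((ρ ^ n)⁻¹ + c) with hK
  have hc0 : 0 < c := eta_integral_pos
  have heta : Integrable (eta : En n → ℝ) :=
    eta_cont.integrable_of_hasCompactSupport (hcs_of_zero fun x => eta_zero)
  have hder : ∀ r : ℝ, HasDerivAt (fun r : ℝ => (∫ x, F (0 + r • x) * eta x) - K * r)
      ((∫ x, fderiv ℝ F (0 + r • x) x * eta x) - K) r := fun r => by
    have h2 := (hasDerivAt_id r).const_mul K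
    rw [mul_one] at h2
    exact (dil_hasDerivAt hF 0 r).sub h2
  have hanti : AntitoneOn (fun r : ℝ => (∫ x, F (0 + r • x) * eta x) - K * r) (Set.Icc ρ R) := by
    refine antitoneOn_of_deriv_nonpos (convex_Icc ρ R)
      (fun r _ => (hder r).continuousAt.continuousWithinAt)
      (fun r _ => (hder r).differentiableAt.differentiableWithinAt) ?_
    intro r hr
    rw [interior_Icc] at hr
    rw [(hder r).deriv]
    have hr0 : 0 < r := hρ.trans hr.1
    have hI1 : Integrable (fun x : En n => ϑ⁻¹ * g (0 + r • x) ^ 2 + ϑ * eta x) :=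
      ((integrable_scale (f := fun x => g x ^ 2) 0 hr0 hgi).const_mul _).add (heta.const_mul _)
    have hcd := hF.continuous_fderiv (by norm_num : (1:WithTop ℕ∞) ≠ 0)
    have hI2 : Integrable (fun x : En n => fderiv ℝ F (0 + r • x) x * eta x) := by
      refine Continuous.integrable_of_hasCompactSupport ?_ (hcs_of_zero fun x hx => by rw [eta_zero hx, mul_zero])
      exact ((hcd.comp (by fun_prop)).clm_apply continuous_id).mul eta_cont
    have h1 : ∫ x, fderiv ℝ F (0 + r • x) x * eta x ≤ ∫ x : En n, (ϑ⁻¹ * g (0 + r • x) ^ 2 + ϑ * eta x) := by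
      refine integral_mono hI2 hI1 fun x => ?_
      simp only
      set G := g (0 + r • x) with hG
      have hG0 : 0 ≤ G := hg0 _
      have hη0 := eta_nonneg x
      have hη1 := eta_le x
      have h3 : fderiv ℝ F (0 + r • x) x * eta x ≤ 2 * G * eta x := by
        by_cases hx : x ∈ ball (0 : En n) 1
        · have h4 := hd (0 + r • x)
          rw [zero_add] at h4
          rw [zero_add] at hG ⊢
          rw [map_smul, norm_smul, Real.norm_of_nonneg hr0.le, smul_eq_mul] at h4
          have h5 : fderiv ℝ F (r • x) x ≤ 2 * G * ‖x‖ := by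
            have : r * fderiv ℝ F (r • x) x ≤ r * (2 * G * ‖x‖) := by rw [hG]; linarith
            exact le_of_mul_le_mul_left this hr0
          rw [mem_ball_zero_iff] at hx
          have h6 : 2 * G * ‖x‖ ≤ 2 * G := by nlinarith
          exact mul_le_mul_of_nonneg_right (h5.trans h6) hη0
        · rw [eta_zero hx]; simp
      have h7 : 2 * G ≤ ϑ⁻¹ * G ^ 2 + ϑ := by
        have : ϑ⁻¹ * G ^ 2 + ϑ - 2 * G = ϑ⁻¹ * (G - ϑ) ^ 2 := by field_simp; ring
        have h8 : 0 ≤ ϑ⁻¹ * (G - ϑ) ^ 2 := by positivity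
        linarith
      have h9 := mul_le_mul_of_nonneg_right h7 hη0
      have h10 : ϑ⁻¹ * G ^ 2 * eta x ≤ ϑ⁻¹ * G ^ 2 := mul_le_of_le_one_right (by positivity) hη1
      nlinarith
    have h2 : ∫ x : En n, (ϑ⁻¹ * g (0 + r • x) ^ 2 + ϑ * eta x) = ϑ⁻¹ * ((r ^ n)⁻¹ * ∫ x, g x ^ 2) + ϑ * c := by
      rw [integral_add ((integrable_scale (f := fun x => g x ^ 2) 0 hr0 hgi).const_mul _) (heta.const_mul _),
        integral_const_mul, integral_const_mul, int_scale (fun x => g x ^ 2) 0 hr0]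
    have h3 : ϑ⁻¹ * ((r ^ n)⁻¹ * ∫ x, g x ^ 2) ≤ ϑ * (ρ ^ n)⁻¹ := by
      have hnn : 0 ≤ ∫ x, g x ^ 2 := integral_nonneg fun x => by positivity
      calc ϑ⁻¹ * ((r ^ n)⁻¹ * ∫ x, g x ^ 2) ≤ ϑ⁻¹ * ((ρ ^ n)⁻¹ * ϑ ^ 2) := by
            have := hr.1.le
            gcongr
        _ = _ := by field_simp
    rw [h2] at h1
    rw [hK]
    linarith
  have := hanti (Set.left_mem_Icc.2 hR) (Set.right_mem_Icc.2 hR) hR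
  simp only [zero_add] at this
  have hK0 : 0 < K := by positivity
  have : 0 ≤ K * ρ := by positivity
  linarith

lemma XX.fderiv_contOn {n : ℕ} {Ω : Set (En n)} (ho : IsOpen Ω) {z : En n → ℝ} (hz : XX Ω z) :
    ContinuousOn (fderiv ℝ z) Ω := fun x hx =>
  (((hz.at ho hx).fderiv_right (m := 1) (by norm_num)).continuousAt).continuousWithinAt

lemma grad_int {n : ℕ} (hn : 3 ≤ n) {Ω : Set (En n)} (ho : IsOpen Ω) (hb : Bornology.IsBounded Ω)
    {z : En n → ℝ} (hz : XX Ω z) {μ : ℝ} (hμ : 0 < μ) (x0 : En n) :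
    IntegrableOn (fun x => ‖fderiv ℝ z x - fderiv ℝ (bubble n μ x0) x‖ ^ 2) Ω ∧
      IntegrableOn (fun x => ‖fderiv ℝ z x‖ ^ 2) Ω := by
  obtain ⟨K, hK, hKb⟩ := c2_bound ho hb hz.c2
  have hfin : volume Ω ≠ ⊤ := hb.measure_lt_top.ne
  have hcB := (bubble_contDiff hn μ x0).continuous_fderiv (by norm_num)
  have h2 : IntegrableOn (fun x => ‖fderiv ℝ z x‖ ^ 2) Ω := by
    refine IntegrableOn.of_bound hb.measure_lt_top
      (((hz.fderiv_contOn ho).norm.pow 2).aestronglyMeasurable ho.measurableSet) (K ^ 2) ?_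
    filter_upwards [ae_restrict_mem ho.measurableSet] with x hx
    rw [Real.norm_of_nonneg (by positivity)]
    have := (hKb x hx).2.1
    gcongr
  refine ⟨?_, h2⟩
  refine ((h2.const_mul 2).add ((bubble_grad_int hn hμ x0).integrableOn.const_mul 2)).mono'
    ((((hz.fderiv_contOn ho).sub hcB.continuousOn).norm.pow 2).aestronglyMeasurable ho.measurableSet) ?_
  refine Eventually.of_forall fun x => ?_
  rw [Real.norm_of_nonneg (by positivity)]
  have h3 := norm_sub_le (fderiv ℝ z x) (fderiv ℝ (bubble n μ x0) x)
  have h4 := norm_nonneg (fderiv ℝ z x - fderiv ℝ (bubble n μ x0) x)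
  simp only [Pi.add_apply]
  nlinarith [sq_nonneg (‖fderiv ℝ z x‖ - ‖fderiv ℝ (bubble n μ x0) x‖)]

lemma star_bound {n : ℕ} (hn : 3 ≤ n) {l t K : ℝ} (hl : 0 < l) (ht : 0 ≤ t)
    (h : l ^ pp n * t ≤ K) : t ^ (twoStar n - 2) ≤ K ^ (twoStar n - 2) / l ^ 2 := by
  have h2 := twoStar_pos hn
  have h1 := Real.rpow_le_rpow (by positivity) h (show 0 ≤ twoStar n - 2 by linarith)
  rw [Real.mul_rpow (by positivity) ht, ← Real.rpow_mul hl.le, pp_star2 hn] at h1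
  rw [le_div_iff₀ (by positivity)]
  have : l ^ (2:ℝ) = l ^ 2 := by norm_cast
  rw [this] at h1
  linarith

lemma T3'_c1 (ε : ℝ) : ContDiff ℝ 1 (T3' ε) := by
  rw [contDiff_one_iff_deriv]
  refine ⟨fun t => (T3'_deriv ε t).differentiableAt, ?_⟩
  rw [show deriv (T3' ε) = fun t => 6 * max (t - ε) 0 from funext fun t => (T3'_deriv ε t).deriv]
  fun_prop

lemma exists_bhat {n : ℕ} (hn : 3 ≤ n) {σ : ℝ} (hσ : σ = 1 ∨ σ = -1) :
    ∃ b : En n → ℝ, ContDiff ℝ 1 b ∧ (∀ x, B0 n x ≤ b x) ∧ (∀ x, b x ≤ 1) ∧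
      (∀ x, ∀ t : ℝ, 0 ≤ t → t ≤ 1 → fderiv ℝ b x x - t * σ * fderiv ℝ (B0 n) x x ≤ 0) := by
  rcases hσ with rfl | rfl
  · refine ⟨B0 n, (B0_contDiff hn).of_le (by norm_num), fun x => le_rfl, B0_le hn, fun x t h0 h1 => ?_⟩
    have := B0_fderiv_self hn x
    nlinarith
  · refine ⟨fun _ => 1, contDiff_const, B0_le hn, fun _ => le_rfl, fun x t h0 h1 => ?_⟩
    have := B0_fderiv_self hn x
    simp
    nlinarith

lemma Nb {n : ℕ} (hn : 3 ≤ n) {Ω : Set (En n)} (ho : IsOpen Ω) (hb : Bornology.IsBounded Ω)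
    {z : En n → ℝ} (hz : XX Ω z) {μ : ℝ} (hμ : 0 < μ) (x0 : En n) {σ : ℝ} (hσ : σ = 1 ∨ σ = -1)
    {ϑ : ℝ} (hϑ : 0 < ϑ)
    (hE : ∫ x in Ω, ‖fderiv ℝ z x - fderiv ℝ (bubble n μ x0) x‖ ^ 2 ≤ ϑ ^ 2) :
    ∃ F : En n → ℝ, Continuous F ∧ (∀ x, 0 ≤ F x) ∧
      (∀ x, F x ≤ 3 * max (1 - μ ^ pp n * tr Ω (T1 1) (fun y => σ * z y) (x0 + μ • x)) 0 ^ 2) ∧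
      (∀ x, (x0 + μ • x ∉ Ω ∨ z (x0 + μ • x) = 0) → 3 * B0 n x ^ 2 ≤ F x) ∧
      ∀ ρ R : ℝ, 0 < ρ → ρ ≤ R → ∫ x, F (R • x) * eta x ≤ (∫ x, F (ρ • x) * eta x) +
        R * (3 * ϑ * ((ρ ^ n)⁻¹ + ∫ x : En n, eta x)) := by
  obtain ⟨b, hb1, hbB, hb1', hbd⟩ := exists_bhat hn hσ
  have hz' : XX Ω (fun y => σ * z y) := hz.const_mul σ
  set τ := tr Ω (T1 1) (fun y => σ * z y) with hτ
  have hτc : ContDiff ℝ 1 τ := tr_contDiff ho hb hz'.cont (fun x hx => (hz'.at ho hx).of_le (by norm_num))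
    hz'.bd one_pos (T1_c1 one_pos) (fun t => T1_zero_abs one_pos t)
  have hτs : tsupport τ ⊆ Ω := tr_tsupport' ho hb hz'.cont hz'.bd one_pos (fun t => T1_zero_abs one_pos t)
  have hτ0 : ∀ x, 0 ≤ τ x := by
    intro x
    by_cases hx : x ∈ Ω
    · rw [hτ, tr_mem hx]; exact T1_nonneg one_pos _
    · rw [hτ, tr_not hx]
  have hμp : 0 < μ ^ pp n := by positivity
  set u := fun x : En n => b x - μ ^ pp n * τ (x0 + μ • x) with hu
  have huc : ContDiff ℝ 1 u := hb1.sub (contDiff_const.mul (hτc.comp (by fun_prop)))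
  have hu1 : ∀ x, u x ≤ 1 := fun x => by
    have := mul_nonneg hμp.le (hτ0 (x0 + μ • x))
    have := hb1' x
    simp only [hu]; linarith
  set F := fun x => T3' 0 (u x) with hF
  have hFc : ContDiff ℝ 1 F := (T3'_c1 0).comp huc
  set e2 := Ω.indicator (fun x => ‖fderiv ℝ z x - fderiv ℝ (bubble n μ x0) x‖) with he2
  have he20 : ∀ x, 0 ≤ e2 x := fun x => Set.indicator_nonneg (fun _ _ => norm_nonneg _) _
  have he2sq : (fun x => e2 x ^ 2) = Ω.indicator (fun x => ‖fderiv ℝ z x - fderiv ℝ (bubble n μ x0) x‖ ^ 2) := by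
    funext x
    by_cases hx : x ∈ Ω
    · simp [he2, hx]
    · simp [he2, hx]
  have he2i : Integrable (fun x => e2 x ^ 2) := by
    rw [he2sq, integrable_indicator_iff ho.measurableSet]
    exact (grad_int hn ho hb hz hμ x0).1
  have he2I : ∫ x, e2 x ^ 2 ≤ ϑ ^ 2 := by
    rw [he2sq, integral_indicator ho.measurableSet]; exact hE
  set g := fun x : En n => 3 * (μ ^ (pp n + 1) * e2 (x0 + μ • x)) with hg
  have hμn : (μ ^ (pp n + 1)) ^ 2 = μ ^ n := by
    rw [← Real.rpow_natCast, ← Real.rpow_mul hμ.le, ← Real.rpow_natCast]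
    congr 1
    have := pp_two (n := n)
    push_cast; linarith
  have hgsq : (fun x => g x ^ 2) = fun x => (9 * μ ^ n) * (fun x => e2 x ^ 2) (x0 + μ • x) := by
    funext x
    simp only [hg]
    rw [mul_pow, mul_pow, hμn]; ring
  have hgi : Integrable (fun x => g x ^ 2) := by
    rw [hgsq]
    exact (integrable_scale (f := fun x => e2 x ^ 2) x0 hμ he2i).const_mul _
  have hgI : ∫ x, g x ^ 2 ≤ (3 * ϑ) ^ 2 := by
    rw [hgsq, integral_const_mul, int_scale (fun x => e2 x ^ 2) x0 hμ]
    have : 9 * μ ^ n * ((μ ^ n)⁻¹ * ∫ x, e2 x ^ 2) = 9 * ∫ x, e2 x ^ 2 := by field_simp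
    rw [this]; nlinarith
  refine ⟨F, hFc.continuous, fun x => ?_, fun x => ?_, fun x hx => ?_, ?_⟩
  · simp only [hF, T3']; positivity
  · simp only [hF, T3', sub_zero]
    have h1 : u x ≤ 1 - μ ^ pp n * τ (x0 + μ • x) := by
      have := hb1' x
      simp only [hu]; linarith
    have h2 : max (u x) 0 ≤ max (1 - μ ^ pp n * τ (x0 + μ • x)) 0 := max_le_max h1 le_rfl
    have h3 : 0 ≤ max (u x) 0 := le_max_right _ _
    gcongr
  · have h0 : τ (x0 + μ • x) = 0 := by
      by_cases h : x0 + μ • x ∈ Ω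
      · rw [hτ, tr_mem h]
        have := hx.resolve_left (not_not.2 h)
        simp only [this, mul_zero]
        exact T1_zero one_pos zero_le_one
      · rw [hτ, tr_not h]
    simp only [hF, T3', sub_zero, hu, h0, mul_zero]
    have h1 := hbB x
    have h2 := B0_pos hn x
    rw [max_eq_left (by linarith)]
    gcongr
  · intro ρ R hρ hR
    refine transport hFc (g := g) (fun x => ?_) hgi (by positivity) hgI (fun x => ?_) hρ hR
    · have := he20 (x0 + μ • x)
      simp only [hg]; positivity
    · have hdu : HasFDerivAt u (fderiv ℝ u x) x := (huc.differentiable (by norm_num) x).hasFDerivAt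
      have hdF : fderiv ℝ F x = (6 * max (u x - 0) 0) • fderiv ℝ u x :=
        ((T3'_deriv 0 (u x)).comp_hasFDerivAt x hdu).fderiv
      rw [hdF, smul_apply, smul_eq_mul, sub_zero]
      have hm0 : 0 ≤ max (u x) 0 := le_max_right _ _
      have hm1 : max (u x) 0 ≤ 1 := max_le (hu1 x) zero_le_one
      have hdu2 : fderiv ℝ u x x = fderiv ℝ b x x - μ ^ pp n * (μ * fderiv ℝ τ (x0 + μ • x) x) := by
        have hd1 : DifferentiableAt ℝ b x := hb1.differentiable (by norm_num) x
        have hd2 : DifferentiableAt ℝ (fun x => τ (x0 + μ • x)) x :=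
          (hτc.comp (g := τ) (f := fun x : En n => x0 + μ • x) (by fun_prop)).differentiable (by norm_num) x
        have : fderiv ℝ u x = fderiv ℝ b x - μ ^ pp n • fderiv ℝ (fun x => τ (x0 + μ • x)) x := by
          rw [hu]
          rw [fderiv_fun_sub hd1 (hd2.const_mul _), fderiv_const_mul hd2]
        rw [this, sub_apply, smul_apply, smul_eq_mul,
          fderiv_affine (f := τ) x0 μ x x (hτc.differentiable (by norm_num) _)]
      have hmain : fderiv ℝ u x x ≤ μ ^ (pp n + 1) * e2 (x0 + μ • x) * ‖x‖ := by
        rw [hdu2]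
        by_cases hX : x0 + μ • x ∈ Ω
        · have hzd : DifferentiableAt ℝ z (x0 + μ • x) := (hz.at ho hX).differentiableAt (by norm_num)
          rw [hτ, tr_fderiv_mem ho hX (hzd.const_mul σ) (T1_deriv one_pos _), fderiv_const_mul hzd]
          set t := T1' 1 (σ * z (x0 + μ • x)) with ht
          have ht0 : 0 ≤ t := T1'_nonneg _
          have ht1 : t ≤ 1 := T1'_le_one _
          have hb2 := hbd x t ht0 ht1
          have he : e2 (x0 + μ • x) = ‖fderiv ℝ z (x0 + μ • x) - fderiv ℝ (bubble n μ x0) (x0 + μ • x)‖ := by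
            simp [he2, hX]
          set dz := fderiv ℝ z (x0 + μ • x)
          have hdB := bubble_fderiv_at hn hμ x0 x
          set dB := fderiv ℝ (bubble n μ x0) (x0 + μ • x)
          have hdB2 : μ ^ (pp n + 1) * dB x = fderiv ℝ (B0 n) x x := by
            rw [hdB, smul_apply, smul_eq_mul, ← mul_assoc, ← Real.rpow_add hμ,
              show pp n + 1 + (-pp n - 1) = 0 by ring, Real.rpow_zero, one_mul]
          rw [he]
          simp only [smul_apply, smul_eq_mul]
          have h3 : |(dz - dB) x| ≤ ‖dz - dB‖ * ‖x‖ := (dz - dB).le_opNorm x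
          have h4 : -(t * σ * (dz - dB) x) ≤ ‖dz - dB‖ * ‖x‖ := by
            have h5 : |t * σ * (dz - dB) x| ≤ ‖dz - dB‖ * ‖x‖ := by
              rw [abs_mul, abs_mul]
              have : |σ| = 1 := by rcases hσ with rfl | rfl <;> simp
              rw [this, mul_one, abs_of_nonneg ht0]
              nlinarith [abs_nonneg ((dz - dB) x)]
            exact (neg_le_abs _).trans h5
          have h6 : μ ^ pp n * (μ * (t * (σ * dz x))) = t * σ * fderiv ℝ (B0 n) x x + μ ^ (pp n + 1) * (t * σ * (dz - dB) x) := by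
            rw [← hdB2, Real.rpow_add_one hμ.ne', sub_apply]; ring
          rw [h6]
          have h7 := mul_le_mul_of_nonneg_left h4 (show 0 ≤ μ ^ (pp n + 1) by positivity)
          linarith
        · rw [fderiv_off hτs hX]
          have := hbd x 0 le_rfl zero_le_one
          have he : e2 (x0 + μ • x) = 0 := by simp [he2, hX]
          simp only [he, zero_apply]
          linarith
      have hq : 0 ≤ μ ^ (pp n + 1) * e2 (x0 + μ • x) * ‖x‖ := by
        have := he20 (x0 + μ • x)
        positivity
      have h8 : 6 * max (u x) 0 * fderiv ℝ u x x ≤ 6 * (μ ^ (pp n + 1) * e2 (x0 + μ • x) * ‖x‖) := by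
        nlinarith [mul_le_mul_of_nonneg_left hmain hm0]
      simp only [hg]
      linarith

/-- the part of the space where `z` (extended by zero) vanishes -/
def NN {n : ℕ} (Ω : Set (En n)) (z : En n → ℝ) : Set (En n) := {x | x ∉ Ω ∨ z x = 0}

lemma NN_meas {n : ℕ} {Ω : Set (En n)} (ho : IsOpen Ω) {z : En n → ℝ} (hz : XX Ω z) :
    MeasurableSet (NN Ω z) := by
  have h1 : IsOpen (Ω ∩ z ⁻¹' {0}ᶜ) :=
    (hz.cont.mono subset_closure).isOpen_inter_preimage ho isOpen_compl_singleton
  have : NN Ω z = (Ω ∩ z ⁻¹' {0}ᶜ)ᶜ := by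
    ext x
    simp only [NN, Set.mem_ofPred_eq, Set.mem_compl_iff, Set.mem_inter_iff, Set.mem_preimage, Set.mem_singleton_iff]
    tauto
  rw [this]
  exact h1.measurableSet.compl

lemma grad_tail {n : ℕ} (hn : 3 ≤ n) {κ : ℝ} (hκ : 0 < κ) :
    ∃ R : ℝ, 1 ≤ R ∧ ∫ x in (ball (0 : En n) (R / 2))ᶜ, ‖fderiv ℝ (B0 n) x‖ ^ 2 ≤ κ := by
  have h := tendsto_setIntegral_of_antitone (μ := (volume : Measure (En n)))
    (s := fun k : ℕ => (ball (0 : En n) ((k:ℝ) / 2))ᶜ) (f := fun x => ‖fderiv ℝ (B0 n) x‖ ^ 2)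
    (fun k => isOpen_ball.measurableSet.compl)
    (fun i j hij => Set.compl_subset_compl.2 (ball_subset_ball (by
      have : (i:ℝ) ≤ j := by exact_mod_cast hij
      linarith)))
    ⟨0, (B0_grad_int hn).integrableOn⟩
  have he : ⋂ k : ℕ, (ball (0 : En n) ((k:ℝ) / 2))ᶜ = ∅ := by
    ext x
    simp only [Set.mem_iInter, Set.mem_compl_iff, mem_ball_zero_iff, not_lt, Set.mem_empty_iff_false, iff_false, not_forall, not_le]
    obtain ⟨k, hk⟩ := exists_nat_gt (2 * ‖x‖)
    exact ⟨k, by linarith⟩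
  rw [he] at h
  simp only [Measure.restrict_empty, integral_zero_measure] at h
  obtain ⟨k, hk1, hk2⟩ := ((h.eventually (gt_mem_nhds hκ)).and (eventually_ge_atTop 1)).exists
  exact ⟨k, by exact_mod_cast hk2, hk1.le⟩

lemma Nc {n : ℕ} (hn : 3 ≤ n) {N : Set (En n)} (hN : MeasurableSet N) {μ : ℝ} (hμ : 0 < μ) (x0 : En n)
    {F : En n → ℝ} (hF : Continuous F) (hF0 : ∀ x, 0 ≤ F x)
    (hFN : ∀ x, x0 + μ • x ∈ N → 3 * B0 n x ^ 2 ≤ F x) {R : ℝ} (hR : 0 < R) :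
    ∫ x in N, ‖fderiv ℝ (bubble n μ x0) x‖ ^ 2 ≤
      (∫ x in (ball (0 : En n) (R / 2))ᶜ, ‖fderiv ℝ (B0 n) x‖ ^ 2) +
      (4 * pp n ^ 2 * aa n) * R ^ n * ∫ x, F (R • x) * eta x := by
  have hp := pp_pos hn
  have ha := aa_pos hn
  set C0 := 4 * pp n ^ 2 * aa n with hC0
  have hC0p : 0 < C0 := by positivity
  have hG : Continuous (fun x => ‖fderiv ℝ (B0 n) x‖ ^ 2) :=
    ((B0_contDiff hn).continuous_fderiv (by norm_num)).norm.pow 2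
  have hmB : MeasurableSet (ball (0 : En n) (R / 2))ᶜ := isOpen_ball.measurableSet.compl
  have e1 : ∫ x in N, ‖fderiv ℝ (bubble n μ x0) x‖ ^ 2 =
      ∫ x, {x | x0 + μ • x ∈ N}.indicator (fun x => ‖fderiv ℝ (B0 n) x‖ ^ 2) x := by
    rw [← integral_indicator hN]
    have h1 := int_scale (N.indicator fun x => ‖fderiv ℝ (bubble n μ x0) x‖ ^ 2) x0 hμ
    have h2 : ∀ x, N.indicator (fun x => ‖fderiv ℝ (bubble n μ x0) x‖ ^ 2) (x0 + μ • x) =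
        (μ ^ n)⁻¹ * {x | x0 + μ • x ∈ N}.indicator (fun x => ‖fderiv ℝ (B0 n) x‖ ^ 2) x := by
      intro x
      by_cases hx : x0 + μ • x ∈ N
      · rw [Set.indicator_of_mem hx, Set.indicator_of_mem (show x ∈ {x | x0 + μ • x ∈ N} from hx), grad_scale hn hμ]
      · rw [Set.indicator_of_notMem hx, Set.indicator_of_notMem (show x ∉ {x | x0 + μ • x ∈ N} from hx), mul_zero]
    simp only [h2] at h1
    rw [integral_const_mul] at h1
    exact (mul_left_cancel₀ (by positivity) h1).symm
  rw [e1, ← integral_indicator hmB]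
  have hmN : MeasurableSet {x | x0 + μ • x ∈ N} := by
    have : Measurable (fun x : En n => x0 + μ • x) := by fun_prop
    exact this hN
  have hI1 : Integrable (fun x => F x * eta (R⁻¹ • x)) := by
    refine Continuous.integrable_of_hasCompactSupport (hF.mul (eta_cont.comp (by fun_prop))) ?_
    refine HasCompactSupport.intro (isCompact_closedBall (0 : En n) R) fun x hx => ?_
    rw [eta_zero, mul_zero]
    intro h
    apply hx
    rw [mem_ball_zero_iff, norm_smul, Real.norm_of_nonneg (by positivity), inv_mul_lt_iff₀ hR] at h
    rw [mem_closedBall_zero_iff]; linarith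
  have e2 : ∫ x, F (R • x) * eta x = (R ^ n)⁻¹ * ∫ x, F x * eta (R⁻¹ • x) := by
    have := int_scale (fun x => F x * eta (R⁻¹ • x)) 0 hR
    rw [← this]
    congr 1
    funext x
    simp only [zero_add, smul_smul, inv_mul_cancel₀ hR.ne', one_smul]
  have e3 : C0 * R ^ n * ∫ x, F (R • x) * eta x = ∫ x, C0 * (F x * eta (R⁻¹ • x)) := by
    rw [e2, integral_const_mul]; field_simp
  rw [e3, ← integral_add ((B0_grad_int hn).indicator hmB) (hI1.const_mul C0)]
  refine integral_mono ((B0_grad_int hn).indicator hmN) (((B0_grad_int hn).indicator hmB).add (hI1.const_mul C0)) ?_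
  intro x
  simp only
  have hη := eta_nonneg (R⁻¹ • x)
  have hFx := hF0 x
  have hq : 0 ≤ C0 * (F x * eta (R⁻¹ • x)) := by positivity
  have hind : 0 ≤ (ball (0 : En n) (R / 2))ᶜ.indicator (fun x => ‖fderiv ℝ (B0 n) x‖ ^ 2) x :=
    Set.indicator_nonneg (fun _ _ => by positivity) _
  by_cases hx : x0 + μ • x ∈ N
  swap
  · rw [Set.indicator_of_notMem (show x ∉ {x | x0 + μ • x ∈ N} from hx)]
    linarith
  rw [Set.indicator_of_mem (show x ∈ {x | x0 + μ • x ∈ N} from hx)]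
  by_cases hxB : x ∈ ball (0 : En n) (R / 2)
  swap
  · rw [Set.indicator_of_mem (show x ∈ (ball (0 : En n) (R / 2))ᶜ from hxB)]
    linarith
  rw [Set.indicator_of_notMem (show x ∉ (ball (0 : En n) (R / 2))ᶜ from fun h => h hxB), zero_add]
  have h1 := B0_fderiv_le hn x
  have h2 := hFN x hx
  have h3 : 9 / 16 ≤ eta (R⁻¹ • x) := by
    unfold eta gg
    rw [sub_zero, norm_smul, Real.norm_of_nonneg (by positivity)]
    rw [mem_ball_zero_iff] at hxB
    have h4 : R⁻¹ * ‖x‖ ≤ 1 / 2 := by rw [inv_mul_le_iff₀ hR]; linarith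
    have h5 : 0 ≤ R⁻¹ * ‖x‖ := by positivity
    have h6 : 3 / 4 ≤ max (1 - (R⁻¹ * ‖x‖) ^ 2 / 1 ^ 2) 0 := by
      refine le_max_of_le_left ?_
      nlinarith
    nlinarith
  refine h1.trans ?_
  have h7 : B0 n x ^ 2 ≤ F x * eta (R⁻¹ • x) := by
    have := mul_le_mul_of_nonneg_left h3 hFx
    nlinarith [sq_nonneg (B0 n x)]
  gcongr

lemma pick_small (A : ℝ) {κ : ℝ} (hκ : 0 < κ) : ∃ δ : ℝ, 0 < δ ∧ δ ≤ 1 / 2 ∧ A * δ ≤ κ := by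
  refine ⟨min (1 / 2) (κ / (|A| + 1)), by positivity, min_le_left _ _, ?_⟩
  have h0 : 0 < min (1 / 2) (κ / (|A| + 1)) := by positivity
  have h1 : min (1 / 2) (κ / (|A| + 1)) ≤ κ / (|A| + 1) := min_le_right _ _
  rw [le_div_iff₀ (by positivity)] at h1
  nlinarith [le_abs_self A]

set_option maxHeartbeats 1000000 in
lemma Nsmall {n : ℕ} (hn : 3 ≤ n) {Ω : Set (En n)} (ho : IsOpen Ω) (hb : Bornology.IsBounded Ω)
    {ψ : En n → ℝ} {c1 C2 C4 : ℝ} (hψ : PsiD Ω ψ c1 C2) (hC4 : 0 < C4) {V : ℝ} (hV : 0 ≤ V)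
    {κ : ℝ} (hκ : 0 < κ) :
    ∃ δ : ℝ, 0 < δ ∧ ∀ h, Adm Ω ψ c1 C4 h → ∀ (μ : ℝ) (x0 : En n) (v z : En n → ℝ),
      0 < μ → μ ≤ 1 → μ ^ pp n * (V + 2) ≤ δ → x0 ∈ Ω → XX Ω v →
      (∃ K, 0 < K ∧ ∀ x ∈ closure Ω, |v x| ≤ K * ψ x) →
      (∀ x ∈ Ω, |v x| ≤ μ ^ (-pp n)) → |v x0| = μ ^ (-pp n) →
      (∀ x ∈ Ω, -lap v x + h x * v x = |v x| ^ (twoStar n - 2) * v x) →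
      XX Ω z → (∀ x ∈ Ω, |v x - z x| ≤ V) →
      ∫ x in Ω, ‖fderiv ℝ z x - fderiv ℝ (bubble n μ x0) x‖ ^ 2 ≤ δ ^ 2 →
      ∫ x in NN Ω z, ‖fderiv ℝ (bubble n μ x0) x‖ ^ 2 ≤ κ := by
  have hp := pp_pos hn
  have ha := aa_pos hn
  obtain ⟨R, hR1, hR⟩ := grad_tail hn (half_pos hκ)
  set c := ∫ x : En n, eta x with hc
  have hc0 : 0 < c := eta_integral_pos
  set Q := (4 * pp n ^ 2 * aa n) * R ^ n with hQ
  have hQp : 0 < Q := by positivity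
  obtain ⟨ε, hε, hε1, hεb⟩ := pick_small (Q * (9 * c)) (show 0 < κ / 8 by positivity)
  obtain ⟨C, hC, hE⟩ := Eprime ho hb hψ hC4 one_pos hε
  obtain ⟨ρ, hρ, hρ1, hρb⟩ := pick_small (Q * (3 * C)) (show 0 < κ / 8 by positivity)
  obtain ⟨δ, hδ, hδ1, hδb⟩ := pick_small (Q * (9 * c + R * (3 * ((ρ ^ n)⁻¹ + c)))) (show 0 < κ / 8 by positivity)
  refine ⟨δ, hδ, ?_⟩
  intro h hA μ x0 v z hμ hμ1 hk hx0 hv hdom hvb hvx hvL hz hvz hgr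
  obtain ⟨σ, hσ, hσv⟩ : ∃ σ : ℝ, (σ = 1 ∨ σ = -1) ∧ σ * v x0 = μ ^ (-pp n) := by
    rcases le_total 0 (v x0) with h0 | h0
    · exact ⟨1, Or.inl rfl, by rw [one_mul, ← hvx, abs_of_nonneg h0]⟩
    · exact ⟨-1, Or.inr rfl, by rw [neg_one_mul, ← hvx, abs_of_nonpos h0]⟩
  have hσa : |σ| = 1 := by rcases hσ with rfl | rfl <;> simp
  have hμp : 0 < μ ^ pp n := by positivity
  have hμpp : μ ^ pp n * μ ^ (-pp n) = 1 := by rw [← Real.rpow_add hμ, add_neg_cancel, Real.rpow_zero]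
  have hvb' : ∀ x ∈ Ω, μ ^ pp n * |v x| ≤ 1 := fun x hx => by
    rw [← hμpp]; exact mul_le_mul_of_nonneg_left (hvb x hx) hμp.le
  set w := fun x => (μ ^ pp n * σ) * v x with hw
  have hwa : ∀ x, |w x| = μ ^ pp n * |v x| := fun x => by
    simp only [hw, abs_mul, hσa, mul_one, abs_of_pos hμp]
  have hwx0 : w x0 = 1 := by simp only [hw]; rw [mul_assoc, hσv, hμpp]
  have hgood : Good Ω ψ h w x0 μ 1 := by
    refine ⟨hv.const_mul _, ?_, ?_⟩
    · obtain ⟨K, hK, hKb⟩ := hdom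
      refine ⟨μ ^ pp n * K, by positivity, fun x hx => ?_⟩
      rw [hwa, mul_assoc]
      exact mul_le_mul_of_nonneg_left (hKb x hx) hμp.le
    · intro x hx hwx
      have h1 : w x ≤ 1 := (le_abs_self _).trans ((hwa x).trans_le (hvb' x hx.1))
      refine ⟨h1, ?_⟩
      have h2 : -lap w x + h x * w x = |v x| ^ (twoStar n - 2) * w x := by
        simp only [hw]
        rw [lap_const_mul _ (hv.at ho hx.1)]
        have := hvL x hx.1
        linear_combination (μ ^ pp n * σ) * this
      rw [h2]
      have h3 := star_bound hn hμ (abs_nonneg (v x)) (hvb' x hx.1)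
      rw [Real.one_rpow] at h3
      have h4 : 0 ≤ |v x| ^ (twoStar n - 2) := by positivity
      nlinarith
  have hEw := hE h hA x0 μ hμ hμ1 w hgood (ρ * μ) (by positivity) (by nlinarith)
  rw [mul_div_cancel_right₀ _ hμ.ne', tr_mem hx0, hwx0] at hEw
  set W := tr Ω (T3 ε) w with hW
  have hWc : Continuous W := (tr3_contDiff ho hb hgood.xx hε).continuous
  have hT31 : 1 - 3 * ε ≤ T3 ε 1 := by
    unfold T3; rw [max_eq_left (by linarith)]
    nlinarith [mul_nonneg hε.le hε.le, pow_le_one₀ hε.le (by linarith : ε ≤ 1) (n := 2), mul_nonneg (sq_nonneg ε) (by linarith : 0 ≤ 3 - ε)]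
  obtain ⟨F, hFc, hF0, hFup, hFN, hFt⟩ := Nb hn ho hb hz hμ x0 hσ hδ hgr
  set k := μ ^ pp n * (V + 2) with hkd
  have hk0 : 0 ≤ k := by positivity
  have heta : Integrable (eta : En n → ℝ) :=
    eta_cont.integrable_of_hasCompactSupport (hcs_of_zero fun x => eta_zero)
  have hIW : Integrable (fun x => W (x0 + (ρ * μ) • x) * eta x) := by
    refine Continuous.integrable_of_hasCompactSupport ?_ (hcs_of_zero fun x hx => by rw [eta_zero hx, mul_zero])
    exact (hWc.comp (by fun_prop)).mul eta_cont
  have hinit : ∫ x, F (ρ • x) * eta x ≤ 3 * (c - (∫ x, W (x0 + (ρ * μ) • x) * eta x) + 3 * k * c) := by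
    have hI2 : Integrable (fun x : En n => 3 * (eta x - W (x0 + (ρ * μ) • x) * eta x + 3 * k * eta x)) :=
      ((heta.sub hIW).add (heta.const_mul (3 * k))).const_mul 3
    have hI3 : Integrable (fun x => F (ρ • x) * eta x) := by
      refine Continuous.integrable_of_hasCompactSupport ?_ (hcs_of_zero fun x hx => by rw [eta_zero hx, mul_zero])
      exact (hFc.comp (by fun_prop)).mul eta_cont
    have h1 : ∫ x, F (ρ • x) * eta x ≤ ∫ x : En n, 3 * (eta x - W (x0 + (ρ * μ) • x) * eta x + 3 * k * eta x) := by
      refine integral_mono hI3 hI2 fun x => ?_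
      have hη := eta_nonneg x
      have hFx := hFup (ρ • x)
      rw [smul_smul, mul_comm μ ρ] at hFx
      set X := x0 + (ρ * μ) • x with hX
      suffices hs : max (1 - μ ^ pp n * tr Ω (T1 1) (fun y => σ * z y) X) 0 ^ 2 ≤ 1 - W X + 3 * k by
        have h5 : F (ρ • x) ≤ 3 * (1 - W X + 3 * k) := by linarith
        have := mul_le_mul_of_nonneg_right h5 hη
        simp only
        linarith
      by_cases hXΩ : X ∈ Ω
      · rw [tr_mem hXΩ, hW, tr_mem hXΩ]
        set a := max (w X) 0 with ha'
        have ha0 : 0 ≤ a := le_max_right _ _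
        have ha1 : a ≤ 1 := max_le ((le_abs_self _).trans ((hwa X).trans_le (hvb' X hXΩ))) zero_le_one
        have h6 : T3 ε (w X) ≤ a := by
          unfold T3
          have h7 : max (w X - ε) 0 ≤ a := max_le_max (by linarith) le_rfl
          have h8 : 0 ≤ max (w X - ε) 0 := le_max_right _ _
          calc max (w X - ε) 0 ^ 3 ≤ a ^ 3 := by gcongr
            _ ≤ a := pow_le_of_le_one ha0 ha1 (by norm_num)
        have h9 := T1_ge one_pos (σ * z X)
        have h10 : a - k ≤ μ ^ pp n * T1 1 (σ * z X) := by
          have h11 : max (σ * v X) 0 ≤ max (σ * z X) 0 + V := by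
            refine max_le ?_ (by positivity)
            have h12 : |σ * (v X - z X)| ≤ V := by rw [abs_mul, hσa, one_mul]; exact hvz X hXΩ
            have := (le_abs_self _).trans h12
            have := le_max_left (σ * z X) 0
            linarith
          have h13 : a = μ ^ pp n * max (σ * v X) 0 := by
            rw [ha', mul_max_of_nonneg _ _ hμp.le, mul_zero]
            simp only [hw, mul_assoc]
          have := mul_le_mul_of_nonneg_left (show max (σ * v X) 0 - (V + 2) ≤ T1 1 (σ * z X) by linarith) hμp.le
          rw [h13, hkd]; linarith
        have h14 : max (1 - μ ^ pp n * T1 1 (σ * z X)) 0 ≤ 1 - a + k := max_le (by linarith) (by linarith)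
        have h15 : 0 ≤ max (1 - μ ^ pp n * T1 1 (σ * z X)) 0 := le_max_right _ _
        have h16 : max (1 - μ ^ pp n * T1 1 (σ * z X)) 0 ^ 2 ≤ (1 - a + k) ^ 2 := by gcongr
        have hk1 : k ≤ 1 := by linarith
        nlinarith [mul_nonneg ha0 (sub_nonneg.2 ha1), mul_nonneg hk0 ha0, mul_nonneg hk0 (sub_nonneg.2 hk1)]
      · rw [tr_not hXΩ, hW, tr_not hXΩ]
        norm_num
        exact hk0
    refine h1.trans (le_of_eq ?_)
    rw [integral_const_mul]
    have e1 : ∫ x : En n, (eta x - W (x0 + (ρ * μ) • x) * eta x + 3 * k * eta x) =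
      (∫ x : En n, (eta x - W (x0 + (ρ * μ) • x) * eta x)) + ∫ x : En n, 3 * k * eta x :=
      integral_add (heta.sub hIW) (heta.const_mul (3 * k))
    have e2 : ∫ x : En n, (eta x - W (x0 + (ρ * μ) • x) * eta x) = c - ∫ x : En n, W (x0 + (ρ * μ) • x) * eta x :=
      integral_sub heta hIW
    rw [e1, e2, integral_const_mul]
  have hNc := Nc hn (NN_meas ho hz) hμ x0 hFc hF0 (fun x hx => hFN x hx) (show 0 < R by linarith)
  have hFt' := hFt ρ R hρ (by linarith)
  have hfin : ∫ x, F (R • x) * eta x ≤ 9 * c * ε + 3 * C * ρ + (9 * c + R * (3 * ((ρ ^ n)⁻¹ + c))) * δ := by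
    have h1 : c * (1 - 3 * ε) ≤ c * T3 ε 1 := by gcongr
    have h2 : ρ ^ 2 ≤ ρ := by nlinarith
    have h3 : C * ρ ^ 2 ≤ C * ρ := by gcongr
    have h4 : k * c ≤ δ * c := by gcongr
    linarith
  have h5 := mul_le_mul_of_nonneg_left hfin hQp.le
  have h6 : Q * (9 * c * ε + 3 * C * ρ + (9 * c + R * (3 * ((ρ ^ n)⁻¹ + c))) * δ) ≤ κ / 8 + κ / 8 + κ / 8 := by
    linarith
  linarith

lemma T1'_tendsto (t : ℝ) :
    Tendsto (fun j : ℕ => T1' (1 / ((j:ℝ) + 1)) t) atTop (𝓝 (if 0 < t then 1 else 0)) := by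
  have hlim : Tendsto (fun j : ℕ => 1 / ((j:ℝ) + 1)) atTop (𝓝 0) :=
    tendsto_one_div_add_atTop_nhds_zero_nat
  split_ifs with ht
  · have h1 : Tendsto (fun ε : ℝ => T1' ε t) (𝓝 0) (𝓝 (T1' 0 t)) := by
      have : ContinuousAt (fun ε : ℝ => T1' ε t) 0 := by
        unfold T1'
        refine ContinuousAt.div (by fun_prop) (by fun_prop) ?_
        rw [sub_zero, max_eq_left ht.le]
        positivity
      exact this
    have h2 : T1' 0 t = 1 := by
      unfold T1'
      rw [sub_zero, max_eq_left ht.le, zero_pow two_ne_zero, add_zero, Real.sqrt_sq ht.le, div_self ht.ne']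
    rw [h2] at h1
    exact h1.comp hlim
  · have : ∀ j : ℕ, T1' (1 / ((j:ℝ) + 1)) t = 0 := fun j =>
      T1'_zero (by push Not at ht; exact ht.trans (by positivity))
    simp only [this]
    exact tendsto_const_nhds

lemma T1_tendsto (t : ℝ) :
    Tendsto (fun j : ℕ => T1 (1 / ((j:ℝ) + 1)) t) atTop (𝓝 (max t 0)) := by
  have := tr_T1_tendsto (n := 0) (Ω := Set.univ) (φ := fun _ => t) (x := 0) (Set.mem_univ _)
  simpa [tr] using this

lemma T1B_hcs {n : ℕ} (hn : 3 ≤ n) {μ : ℝ} (hμ : 0 < μ) (x0 : En n) {ε : ℝ} (hε : 0 < ε) :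
    HasCompactSupport (fun x => T1 ε (bubble n μ x0 x)) := by
  have hp := pp_pos hn
  have ha := aa_pos hn
  set C := (aa n / 2) ^ (-pp n) with hC
  have hCp : 0 < C := by positivity
  set R := (C / ε) ^ (1 / pp n) with hR
  have hRp : 0 < R := by positivity
  refine HasCompactSupport.intro (isCompact_closedBall x0 R) fun x hx => ?_
  refine T1_zero hε ?_
  refine (bubble_decay hn hμ x0 x).trans ?_
  rw [mem_closedBall, dist_eq_norm, not_le] at hx
  have h1 : (‖x - x0‖ + μ) ^ (-pp n) ≤ R ^ (-pp n) :=
    Real.rpow_le_rpow_of_nonpos hRp (by linarith) (by linarith)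
  have h2 : R ^ (-pp n) = (C / ε)⁻¹ := by
    rw [hR, ← Real.rpow_mul (by positivity), show 1 / pp n * -pp n = -1 by field_simp, Real.rpow_neg_one]
  rw [h2] at h1
  calc C * (‖x - x0‖ + μ) ^ (-pp n) ≤ C * (C / ε)⁻¹ := by gcongr
    _ = ε := by field_simp

lemma L7d {n : ℕ} (hn : 3 ≤ n) {Ω : Set (En n)} (ho : IsOpen Ω) (hb : Bornology.IsBounded Ω) :
    ∃ Cs : ℝ, 0 < Cs ∧ ∀ (z : En n → ℝ), XX Ω z → ∀ (μ : ℝ), 0 < μ → ∀ (x0 : En n),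
    (∫ x in Ω, |z x - bubble n μ x0 x| ^ twoStar n) ^ (2 / twoStar n) ≤
      Cs * ((∫ x in Ω, ‖fderiv ℝ z x - fderiv ℝ (bubble n μ x0) x‖ ^ 2) +
        ∫ x in NN Ω z, ‖fderiv ℝ (bubble n μ x0) x‖ ^ 2) := by
  obtain ⟨Cs, hCs, hS⟩ := sobolev hn
  refine ⟨Cs, hCs, fun z hz μ hμ x0 => ?_⟩
  have h2 := twoStar_pos hn
  set B := bubble n μ x0 with hB
  have hB2 : ContDiff ℝ 2 B := bubble_contDiff hn μ x0
  have hBp : ∀ x, 0 < B x := fun x => bubble_pos hn hμ x0 x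
  have hBd : ∀ x, DifferentiableAt ℝ B x := fun x => hB2.differentiable (by norm_num) x
  have hzn := hz.neg
  obtain ⟨K, hK, hKb⟩ := c2_bound ho hb hz.c2
  set ε := fun j : ℕ => 1 / ((j:ℝ) + 1) with hε
  have hεp : ∀ j, 0 < ε j := fun j => by simp only [hε]; positivity
  set k := fun (j : ℕ) (x : En n) => T1 (ε j) (B x) - tr Ω (T1 (ε j)) z x + tr Ω (T1 (ε j)) (fun x => -z x) x with hk
  have htz : ∀ j, ContDiff ℝ 1 (tr Ω (T1 (ε j)) z) := fun j =>
    tr_contDiff ho hb hz.cont (fun x hx => (hz.at ho hx).of_le (by norm_num)) hz.bd (hεp j) (T1_c1 (hεp j))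
      (fun t => T1_zero_abs (hεp j) t)
  have htzn : ∀ j, ContDiff ℝ 1 (tr Ω (T1 (ε j)) (fun x => -z x)) := fun j =>
    tr_contDiff ho hb hzn.cont (fun x hx => (hzn.at ho hx).of_le (by norm_num)) hzn.bd (hεp j) (T1_c1 (hεp j))
      (fun t => T1_zero_abs (hεp j) t)
  have hTB : ∀ j, ContDiff ℝ 1 (fun x => T1 (ε j) (B x)) := fun j =>
    (T1_c1 (hεp j)).comp (hB2.of_le (by norm_num))
  have hkc : ∀ j, ContDiff ℝ 1 (k j) := fun j => ((hTB j).sub (htz j)).add (htzn j)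
  have hks : ∀ j, HasCompactSupport (k j) := fun j => by
    have h1 := T1B_hcs hn hμ x0 (hεp j)
    have h3 := tr_hcs hb hz.cont (fun t => T1_zero_abs (hεp j) t)
    have h4 := tr_hcs hb hzn.cont (fun t => T1_zero_abs (hεp j) t)
    exact (h1.sub h3).add h4
  -- gradients
  set lim := fun x : En n => (NN Ω z).indicator (fun x => ‖fderiv ℝ B x‖ ^ 2) x +
    (NN Ω z)ᶜ.indicator (fun x => ‖fderiv ℝ z x - fderiv ℝ B x‖ ^ 2) x with hlim
  have hfd_in : ∀ j, ∀ x ∈ Ω, fderiv ℝ (k j) x = T1' (ε j) (B x) • fderiv ℝ B x -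
      (T1' (ε j) (z x) + T1' (ε j) (-z x)) • fderiv ℝ z x := by
    intro j x hx
    have hzd : DifferentiableAt ℝ z x := (hz.at ho hx).differentiableAt (by norm_num)
    have e1 : fderiv ℝ (fun x => T1 (ε j) (B x)) x = T1' (ε j) (B x) • fderiv ℝ B x :=
      ((T1_deriv (hεp j) (B x)).comp_hasFDerivAt x (hBd x).hasFDerivAt).fderiv
    have e2 := tr_fderiv_mem ho hx hzd (T1_deriv (hεp j) (z x))
    have e3 := tr_fderiv_mem ho hx hzd.neg (T1_deriv (hεp j) (-z x))
    have d1 := (hTB j).differentiable (by norm_num) x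
    have d2 := (htz j).differentiable (by norm_num) x
    have d3 := (htzn j).differentiable (by norm_num) x
    have e4 : fderiv ℝ (k j) x = fderiv ℝ (fun x => T1 (ε j) (B x)) x - fderiv ℝ (tr Ω (T1 (ε j)) z) x +
        fderiv ℝ (tr Ω (T1 (ε j)) (fun x => -z x)) x :=
      ((d1.hasFDerivAt.sub d2.hasFDerivAt).add d3.hasFDerivAt).fderiv
    have e5 : fderiv ℝ (tr Ω (T1 (ε j)) (fun x => -z x)) x = T1' (ε j) (-z x) • (-fderiv ℝ z x) := by
      rw [← fderiv_neg]; exact e3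
    rw [e4, e1, e2, e5, add_smul, smul_neg]
    abel
  have hfd_out : ∀ j, ∀ x, x ∉ Ω → fderiv ℝ (k j) x = T1' (ε j) (B x) • fderiv ℝ B x := by
    intro j x hx
    have e1 : fderiv ℝ (fun x => T1 (ε j) (B x)) x = T1' (ε j) (B x) • fderiv ℝ B x :=
      ((T1_deriv (hεp j) (B x)).comp_hasFDerivAt x (hBd x).hasFDerivAt).fderiv
    have e2 := fderiv_off (tr_tsupport' ho hb hz.cont hz.bd (hεp j) (fun t => T1_zero_abs (hεp j) t)) hx
    have e3 := fderiv_off (tr_tsupport' ho hb hzn.cont hzn.bd (hεp j) (fun t => T1_zero_abs (hεp j) t)) hx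
    have d1 := (hTB j).differentiable (by norm_num) x
    have d2 := (htz j).differentiable (by norm_num) x
    have d3 := (htzn j).differentiable (by norm_num) x
    have e4 : fderiv ℝ (k j) x = fderiv ℝ (fun x => T1 (ε j) (B x)) x - fderiv ℝ (tr Ω (T1 (ε j)) z) x +
        fderiv ℝ (tr Ω (T1 (ε j)) (fun x => -z x)) x :=
      ((d1.hasFDerivAt.sub d2.hasFDerivAt).add d3.hasFDerivAt).fderiv
    rw [e4, e1, e2, e3, sub_zero, add_zero]
  have hBlim : ∀ x, Tendsto (fun j => T1' (ε j) (B x)) atTop (𝓝 1) := fun x => by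
    have := T1'_tendsto (B x)
    rwa [if_pos (hBp x)] at this
  have hgi := grad_int hn ho hb hz hμ x0
  have hBgi := bubble_grad_int hn hμ x0
  have hptw : ∀ x, Tendsto (fun j => ‖fderiv ℝ (k j) x‖ ^ 2) atTop (𝓝 (lim x)) := by
    intro x
    by_cases hx : x ∈ NN Ω z
    · have e : lim x = ‖fderiv ℝ B x‖ ^ 2 := by
        simp only [hlim]
        rw [Set.indicator_of_mem hx, Set.indicator_of_notMem (show x ∉ (NN Ω z)ᶜ from fun h => h hx), add_zero]
      have e2 : ∀ j, fderiv ℝ (k j) x = T1' (ε j) (B x) • fderiv ℝ B x := by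
        intro j
        by_cases hxΩ : x ∈ Ω
        · have hz0 : z x = 0 := hx.resolve_left (not_not.2 hxΩ)
          rw [hfd_in j x hxΩ, hz0, neg_zero, T1'_zero (hεp j).le]; simp
        · exact hfd_out j x hxΩ
      simp only [e2, e]
      have := (((hBlim x).smul_const (fderiv ℝ B x)).norm).pow 2
      rwa [one_smul] at this
    · have hx' : x ∈ Ω ∧ z x ≠ 0 := by
        simp only [NN, Set.mem_ofPred_eq] at hx
        tauto
      have e : lim x = ‖fderiv ℝ B x - fderiv ℝ z x‖ ^ 2 := by
        simp only [hlim]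
        rw [Set.indicator_of_notMem hx, Set.indicator_of_mem (show x ∈ (NN Ω z)ᶜ from hx), zero_add, norm_sub_rev]
      rw [e]
      have h5 : Tendsto (fun j => T1' (ε j) (z x) + T1' (ε j) (-z x)) atTop (𝓝 1) := by
        have := (T1'_tendsto (z x)).add (T1'_tendsto (-z x))
        rcases lt_or_gt_of_ne hx'.2 with h | h
        · rw [if_neg (by linarith), if_pos (by linarith), zero_add] at this; exact this
        · rw [if_pos h, if_neg (by linarith), add_zero] at this; exact this
      simp only [hfd_in _ x hx'.1]
      have := ((((hBlim x).smul_const (fderiv ℝ B x)).sub (h5.smul_const (fderiv ℝ z x))).norm).pow 2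
      rwa [one_smul, one_smul] at this
  have hbound : ∀ j x, ‖fderiv ℝ (k j) x‖ ^ 2 ≤ 2 * ‖fderiv ℝ B x‖ ^ 2 + 8 * Ω.indicator (fun x => ‖fderiv ℝ z x‖ ^ 2) x := by
    intro j x
    have hb0 := T1'_nonneg (ε := ε j) (B x)
    have hb1 := T1'_le_one (ε := ε j) (B x)
    have hbB : ‖T1' (ε j) (B x) • fderiv ℝ B x‖ ≤ ‖fderiv ℝ B x‖ := by
      rw [norm_smul, Real.norm_of_nonneg hb0]
      exact mul_le_of_le_one_left (norm_nonneg _) hb1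
    by_cases hxΩ : x ∈ Ω
    · rw [hfd_in j x hxΩ, Set.indicator_of_mem hxΩ]
      have h6 : ‖(T1' (ε j) (z x) + T1' (ε j) (-z x)) • fderiv ℝ z x‖ ≤ 2 * ‖fderiv ℝ z x‖ := by
        have h7 := T1'_nonneg (ε := ε j) (z x)
        have h8 := T1'_nonneg (ε := ε j) (-z x)
        have h9 := T1'_le_one (ε := ε j) (z x)
        have h10 := T1'_le_one (ε := ε j) (-z x)
        rw [norm_smul, Real.norm_of_nonneg (by positivity)]
        gcongr; linarith
      have h11 := norm_sub_le (T1' (ε j) (B x) • fderiv ℝ B x) ((T1' (ε j) (z x) + T1' (ε j) (-z x)) • fderiv ℝ z x)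
      have h12 : ‖T1' (ε j) (B x) • fderiv ℝ B x - (T1' (ε j) (z x) + T1' (ε j) (-z x)) • fderiv ℝ z x‖ ≤ ‖fderiv ℝ B x‖ + 2 * ‖fderiv ℝ z x‖ := by linarith
      have h13 := pow_le_pow_left₀ (norm_nonneg _) h12 2
      nlinarith [sq_nonneg (‖fderiv ℝ B x‖ - 2 * ‖fderiv ℝ z x‖)]
    · rw [hfd_out j x hxΩ, Set.indicator_of_notMem hxΩ]
      have := pow_le_pow_left₀ (norm_nonneg _) hbB 2
      nlinarith [sq_nonneg ‖fderiv ℝ B x‖]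
  have hR : Tendsto (fun j => ∫ x, ‖fderiv ℝ (k j) x‖ ^ 2) atTop (𝓝 (∫ x, lim x)) := by
    refine tendsto_integral_of_dominated_convergence
      (fun x => 2 * ‖fderiv ℝ B x‖ ^ 2 + 8 * Ω.indicator (fun x => ‖fderiv ℝ z x‖ ^ 2) x) ?_ ?_ ?_ ?_
    · intro j
      exact (((hkc j).continuous_fderiv (by norm_num)).norm.pow 2).aestronglyMeasurable
    · exact (hBgi.const_mul 2).add (((integrable_indicator_iff ho.measurableSet).2 hgi.2).const_mul 8)
    · intro j
      refine Eventually.of_forall fun x => ?_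
      rw [Real.norm_of_nonneg (by positivity)]
      exact hbound j x
    · exact Eventually.of_forall hptw
  have hmN := NN_meas ho hz
  have hsubΩ : (NN Ω z)ᶜ ⊆ Ω := by
    intro x hx
    simp only [NN, Set.mem_compl_iff, Set.mem_ofPred_eq] at hx
    tauto
  have hlimI : ∫ x, lim x ≤ (∫ x in Ω, ‖fderiv ℝ z x - fderiv ℝ B x‖ ^ 2) + ∫ x in NN Ω z, ‖fderiv ℝ B x‖ ^ 2 := by
    have e1 : ∫ x, lim x = (∫ x in NN Ω z, ‖fderiv ℝ B x‖ ^ 2) + ∫ x in (NN Ω z)ᶜ, ‖fderiv ℝ z x - fderiv ℝ B x‖ ^ 2 := by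
      rw [← integral_indicator hmN, ← integral_indicator hmN.compl]
      exact integral_add (hBgi.indicator hmN) ((integrable_indicator_iff hmN.compl).2 (hgi.1.mono_set hsubΩ))
    rw [e1, add_comm]
    exact add_le_add (setIntegral_mono_set hgi.1 (Eventually.of_forall fun x => by positivity) (HasSubset.Subset.eventuallyLE hsubΩ)) le_rfl
  -- left side
  have hzc : ContinuousOn z Ω := hz.cont.mono subset_closure
  have hkb : ∀ j, ∀ x ∈ Ω, |k j x| ≤ μ ^ (-(((n : ℝ) - 2) / 2)) + K := by
    intro j x hx
    have h3 := T1_nonneg (hεp j) (B x)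
    have h4 := T1_le (hεp j) (B x)
    rw [max_eq_left (hBp x).le] at h4
    have h5 := bubble_le hn hμ x0 x
    have h6 := T1_nonneg (hεp j) (z x)
    have h7 := T1_le (hεp j) (z x)
    have h8 := T1_nonneg (hεp j) (-z x)
    have h9 := T1_le (hεp j) (-z x)
    have h10 := (hKb x hx).1
    have h11 : max (z x) 0 ≤ K := max_le ((le_abs_self _).trans h10) hK.le
    have h12 : max (-z x) 0 ≤ K := max_le ((neg_le_abs _).trans h10) hK.le
    simp only [hk]
    rw [tr_mem hx, tr_mem hx, abs_le]
    constructor <;> linarith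
  have hL : Tendsto (fun j => ∫ x in Ω, |k j x| ^ twoStar n) atTop (𝓝 (∫ x in Ω, |z x - B x| ^ twoStar n)) := by
    refine tendsto_integral_of_dominated_convergence
      (fun x => (μ ^ (-(((n : ℝ) - 2) / 2)) + K) ^ twoStar n) ?_ ?_ ?_ ?_
    · intro j
      exact ((hkc j).continuous.abs.rpow_const (fun x => Or.inr (by linarith))).aestronglyMeasurable
    · exact integrableOn_const hb.measure_lt_top.ne
    · intro j
      filter_upwards [ae_restrict_mem ho.measurableSet] with x hx
      rw [Real.norm_of_nonneg (by positivity)]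
      exact Real.rpow_le_rpow (abs_nonneg _) (hkb j x hx) (by linarith)
    · filter_upwards [ae_restrict_mem ho.measurableSet] with x hx
      have h3 : Tendsto (fun j => k j x) atTop (𝓝 (B x - z x)) := by
        have := ((T1_tendsto (B x)).sub (tr_T1_tendsto (φ := z) hx)).add (tr_T1_tendsto (φ := fun x => -z x) hx)
        rw [max_eq_left (hBp x).le] at this
        convert this using 2
        rcases le_total 0 (z x) with h | h
        · rw [max_eq_left h, max_eq_right (by linarith)]; ring
        · rw [max_eq_right h, max_eq_left (by linarith)]; ring
      have h4 := h3.abs.rpow_const (p := twoStar n) (Or.inr (by linarith))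
      rwa [abs_sub_comm] at h4
  have hL2 := hL.rpow_const (p := 2 / twoStar n) (Or.inr (by positivity))
  have hle : ∀ j, (∫ x in Ω, |k j x| ^ twoStar n) ^ (2 / twoStar n) ≤ Cs * ∫ x, ‖fderiv ℝ (k j) x‖ ^ 2 := by
    intro j
    refine le_trans ?_ (hS (k j) (hkc j) (hks j))
    have hi : Integrable (fun x => |k j x| ^ twoStar n) := by
      refine Continuous.integrable_of_hasCompactSupport
        ((hkc j).continuous.abs.rpow_const (fun x => Or.inr (by linarith))) ?_
      refine HasCompactSupport.intro (hks j).isCompact fun x hx => ?_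
      rw [image_eq_zero_of_notMem_tsupport hx, abs_zero, Real.zero_rpow (by linarith)]
    refine Real.rpow_le_rpow (integral_nonneg fun x => by positivity) ?_ (by positivity)
    exact setIntegral_le_integral hi (Eventually.of_forall fun x => by positivity)
  have := le_of_tendsto_of_tendsto' hL2 (hR.const_mul Cs) hle
  exact this.trans (mul_le_mul_of_nonneg_left hlimI hCs.le)

/-- the nonlinearity -/
def Nl (r t : ℝ) : ℝ := |t| ^ (r - 2) * t

lemma Nl_abs {r : ℝ} (hr : 2 < r) (t : ℝ) : |Nl r t| = |t| ^ (r - 1) := by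
  unfold Nl
  rw [abs_mul, abs_of_nonneg (Real.rpow_nonneg (abs_nonneg t) _)]
  rcases eq_or_ne t 0 with h | h
  · rw [h, abs_zero, mul_zero, Real.zero_rpow (by linarith)]
  · have : 0 < |t| := abs_pos.2 h
    rw [show r - 1 = (r - 2) + 1 by ring, Real.rpow_add this, Real.rpow_one]

lemma Nl_mul (r a b : ℝ) : Nl r (a * b) = Nl r a * Nl r b := by
  unfold Nl
  rw [abs_mul, Real.mul_rpow (abs_nonneg _) (abs_nonneg _)]
  ring

lemma Nl_nonneg {r : ℝ} (hr : 2 < r) {t : ℝ} (ht : 0 ≤ t) : Nl r t = t ^ (r - 1) := by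
  have h := Nl_abs hr t
  rw [abs_of_nonneg ht] at h
  rw [← h, abs_of_nonneg]
  unfold Nl; positivity

lemma Nl_continuous {r : ℝ} (hr : 2 < r) : Continuous (Nl r) := by
  unfold Nl
  exact (continuous_abs.rpow_const (fun x => Or.inr (by linarith))).mul continuous_id

lemma Nl_one (r : ℝ) : Nl r 1 = 1 := by simp [Nl]

lemma rpow_abs_add {q : ℝ} (hq : 0 < q) {a b : ℝ} (ha : 0 ≤ a) (hb : 0 ≤ b) :
    (a + b) ^ q ≤ 2 ^ q * (a ^ q + b ^ q) := by
  have h1 : (a + b) ^ q ≤ (2 * max a b) ^ q := by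
    apply Real.rpow_le_rpow (by positivity) _ hq.le
    have := le_max_left a b
    have := le_max_right a b
    linarith
  rw [Real.mul_rpow (by norm_num) (le_max_of_le_left ha)] at h1
  refine h1.trans (mul_le_mul_of_nonneg_left ?_ (by positivity))
  rcases max_cases a b with h | h <;> rw [h.1]
  · have : 0 ≤ b ^ q := by positivity
    linarith
  · have : 0 ≤ a ^ q := by positivity
    linarith

/-- almost additivity -/
lemma Nl_I1 {r : ℝ} (hr : 2 < r) {ε : ℝ} (hε : 0 < ε) :
    ∃ C : ℝ, 0 < C ∧ ∀ a b : ℝ, |Nl r (a + b) - Nl r a| ≤ ε * |a| ^ (r - 1) + C * |b| ^ (r - 1) := by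
  have hc := (Nl_continuous hr).tendsto 1
  rw [Metric.tendsto_nhds_nhds] at hc
  obtain ⟨δ, hδ, hδ'⟩ := hc ε hε
  have hq : 0 < r - 1 := by linarith
  refine ⟨2 ^ (r-1) * ((δ⁻¹) ^ (r - 1) + 1) + (δ⁻¹) ^ (r - 1), by positivity, fun a b => ?_⟩
  by_cases hab : |b| < δ * |a|
  · have ha : 0 < |a| := by
      by_contra h
      have : |a| = 0 := le_antisymm (not_lt.1 h) (abs_nonneg a)
      rw [this, mul_zero] at hab
      exact absurd hab (not_lt.2 (abs_nonneg b))
    have ha0 : a ≠ 0 := abs_pos.1 ha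
    have e1 : a + b = a * (1 + b / a) := by field_simp
    have h1 : dist (1 + b / a) 1 < δ := by
      rw [Real.dist_eq, add_sub_cancel_left, abs_div, div_lt_iff₀ ha]; exact hab
    have h2 := hδ' h1
    rw [Real.dist_eq, Nl_one] at h2
    rw [e1, Nl_mul, show Nl r a * Nl r (1 + b / a) - Nl r a = Nl r a * (Nl r (1 + b / a) - 1) by ring,
      abs_mul, Nl_abs hr a]
    have h3 : 0 ≤ |a| ^ (r - 1) := by positivity
    have h4 : 0 ≤ |b| ^ (r - 1) := by positivity
    have h5 : 0 ≤ (2 ^ (r-1) * ((δ⁻¹) ^ (r - 1) + 1) + (δ⁻¹) ^ (r - 1)) * |b| ^ (r - 1) := by positivity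
    nlinarith [mul_le_mul_of_nonneg_left h2.le h3]
  · push Not at hab
    have h1 : |a| ≤ δ⁻¹ * |b| := by
      rw [inv_mul_eq_div, le_div_iff₀ hδ]; linarith
    have h2 : |a| ^ (r - 1) ≤ (δ⁻¹) ^ (r - 1) * |b| ^ (r - 1) := by
      rw [← Real.mul_rpow (by positivity) (abs_nonneg b)]
      exact Real.rpow_le_rpow (abs_nonneg a) h1 hq.le
    have h3 : |a + b| ^ (r - 1) ≤ 2 ^ (r - 1) * (|a| ^ (r - 1) + |b| ^ (r - 1)) :=
      (Real.rpow_le_rpow (abs_nonneg _) (abs_add_le a b) hq.le).trans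
        (rpow_abs_add hq (abs_nonneg a) (abs_nonneg b))
    have h4 := abs_sub (Nl r (a + b)) (Nl r a)
    rw [Nl_abs hr, Nl_abs hr] at h4
    have h5 : 0 ≤ ε * |a| ^ (r - 1) := by positivity
    have h6 : (2:ℝ) ^ (r - 1) * (|a| ^ (r - 1) + |b| ^ (r - 1)) ≤
      2 ^ (r - 1) * ((δ⁻¹) ^ (r - 1) * |b| ^ (r - 1) + |b| ^ (r - 1)) := by gcongr
    linarith

/-- three-term splitting -/
lemma Nl_I2 {r : ℝ} (hr : 2 < r) {V : ℝ} (hV : 0 ≤ V) {ε : ℝ} (hε : 0 < ε) :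
    ∃ C η : ℝ, 0 < C ∧ 0 < η ∧ ∀ a b e : ℝ, 0 ≤ a → |b| ≤ V →
      |Nl r (a + b + e) - Nl r a - Nl r b| ≤ ε * a ^ (r - 1) + ε + C * |e| ^ (r - 1) +
        C * (if η ≤ a then 1 else 0) := by
  have hq : 0 < r - 1 := by linarith
  set A : ℝ := 2 ^ (r - 1) * (V ^ (r - 1) + 1) + V ^ (r - 1) + 1 with hA
  have hApos : 0 < A := by positivity
  have hA2 : 2 ^ (r - 1) + 1 ≤ A := by
    have : 0 ≤ (2:ℝ) ^ (r-1) * V ^ (r - 1) := by positivity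
    have : 0 ≤ V ^ (r - 1) := by positivity
    nlinarith
  have hA3 : 2 ^ (r - 1) * V ^ (r - 1) + V ^ (r-1) ≤ A := by
    have : 0 ≤ (2:ℝ) ^ (r-1) := by positivity
    have : 0 ≤ V ^ (r - 1) := by positivity
    nlinarith
  obtain ⟨C, hC, hCI⟩ := Nl_I1 hr (show 0 < ε / (2 * A) by positivity)
  -- eta
  obtain ⟨η, hη, hη2⟩ : ∃ η : ℝ, 0 < η ∧ (C + 1) * η ^ (r - 1) ≤ ε / 2 := by
    refine ⟨(ε / 2 / (C + 1)) ^ (1 / (r - 1)), by positivity, ?_⟩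
    rw [← Real.rpow_mul (by positivity), one_div_mul_cancel hq.ne', Real.rpow_one]
    apply le_of_eq; field_simp
  refine ⟨C * (V ^ (r - 1) + 1) + V ^ (r - 1), η, by positivity, hη, fun a b e ha hb => ?_⟩
  have hVq : 0 ≤ V ^ (r - 1) := by positivity
  have hbq : |b| ^ (r - 1) ≤ V ^ (r - 1) := Real.rpow_le_rpow (abs_nonneg b) hb hq.le
  have haq : 0 ≤ a ^ (r - 1) := by positivity
  have heq : 0 ≤ |e| ^ (r - 1) := by positivity
  have h1 := hCI (a + b) e
  have h2 : |a + b| ^ (r - 1) ≤ 2 ^ (r - 1) * (a ^ (r - 1) + V ^ (r - 1)) := by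
    have h := (Real.rpow_le_rpow (abs_nonneg _) (abs_add_le a b) hq.le).trans
        (rpow_abs_add hq (abs_nonneg a) (abs_nonneg b))
    rw [abs_of_nonneg ha] at h
    refine h.trans ?_
    gcongr
  have h2' := mul_le_mul_of_nonneg_left h2 (show 0 ≤ ε / (2 * A) by positivity)
  have hkey : ε / (2 * A) * A = ε / 2 := by field_simp
  have hx1 := mul_le_mul_of_nonneg_left hA2 (show 0 ≤ ε / (2 * A) * a ^ (r - 1) by positivity)
  have hx2 := mul_le_mul_of_nonneg_left hA3 (show 0 ≤ ε / (2 * A) by positivity)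
  have hx3 : ε / (2 * A) * a ^ (r - 1) * A = ε / 2 * a ^ (r - 1) := by rw [← hkey]; ring
  have hCe : C * |e| ^ (r - 1) ≤ (C * (V ^ (r - 1) + 1) + V ^ (r - 1)) * |e| ^ (r - 1) := by
    apply mul_le_mul_of_nonneg_right _ heq
    nlinarith
  have tri : |Nl r (a + b + e) - Nl r a - Nl r b| ≤
      |Nl r (a + b + e) - Nl r (a + b)| + |Nl r (a + b) - Nl r a - Nl r b| := by
    refine le_trans (le_of_eq ?_) (abs_add_le _ _)
    congr 1; ring
  split_ifs with hηa
  · have h3 := hCI a b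
    rw [abs_of_nonneg ha] at h3
    have h4 : |Nl r (a + b) - Nl r a - Nl r b| ≤ |Nl r (a + b) - Nl r a| + |Nl r b| := abs_sub _ _
    rw [Nl_abs hr b] at h4
    have h5 := mul_le_mul_of_nonneg_left hbq hC.le
    have h8 : 0 ≤ ε / (2 * A) * V ^ (r - 1) := by positivity
    have h9 : 0 ≤ ε * a ^ (r - 1) := by positivity
    rw [hkey] at hx2
    rw [hx3] at hx1
    generalize ε / (2 * A) = t at *
    generalize A = A' at *
    linarith [mul_comm (t * a ^ (r - 1)) (2 ^ (r - 1)), hC.le]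
  · push Not at hηa
    have h3 := hCI b a
    rw [add_comm b a, abs_of_nonneg ha] at h3
    have h4 : |Nl r (a + b) - Nl r a - Nl r b| ≤ |Nl r (a + b) - Nl r b| + |Nl r a| := by
      rw [show Nl r (a + b) - Nl r a - Nl r b = (Nl r (a + b) - Nl r b) - Nl r a by ring]
      exact abs_sub _ _
    rw [Nl_abs hr a, abs_of_nonneg ha] at h4
    have h5 : a ^ (r - 1) ≤ η ^ (r - 1) := Real.rpow_le_rpow ha hηa.le hq.le
    have h6 := mul_le_mul_of_nonneg_left h5 (show 0 ≤ C + 1 by positivity)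
    have h7 := mul_le_mul_of_nonneg_left hbq (show 0 ≤ ε / (2 * A) by positivity)
    nlinarith [mul_nonneg hε.le haq]

lemma bdd_pow_int {n : ℕ} {Ω : Set (En n)} (hb : Bornology.IsBounded Ω)
    (ho : IsOpen Ω) {f : En n → ℝ} (hm : AEStronglyMeasurable f (volume.restrict Ω))
    (hK : ∃ K, ∀ x ∈ Ω, |f x| ≤ K) : Integrable f (volume.restrict Ω) := by
  obtain ⟨K, hK⟩ := hK
  haveI : IsFiniteMeasure (volume.restrict Ω) := ⟨by
    rw [Measure.restrict_apply_univ]; exact hb.measure_lt_top⟩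
  exact Integrable.of_bound hm K ((ae_restrict_iff' ho.measurableSet).2 (Eventually.of_forall hK))

/-- Hoelder -/
lemma holder_q {n : ℕ} {Ω : Set (En n)} (hb : Bornology.IsBounded Ω) (ho : IsOpen Ω)
    {r : ℝ} (hr : 2 < r) {g w : En n → ℝ}
    (hg : AEStronglyMeasurable g (volume.restrict Ω)) (hgb : ∃ K, ∀ x ∈ Ω, |g x| ≤ K)
    (hg0 : ∀ x, 0 ≤ g x) (hw : AEStronglyMeasurable w (volume.restrict Ω))
    (hwb : ∃ K, ∀ x ∈ Ω, |w x| ≤ K) (hw0 : ∀ x, 0 ≤ w x) :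
    ∫ x in Ω, g x ^ (r - 1) * w x ≤
      (∫ x in Ω, g x ^ r) ^ ((r - 1) / r) * (∫ x in Ω, w x ^ r) ^ (1 / r) := by
  have hq : 0 < r - 1 := by linarith
  haveI : IsFiniteMeasure (volume.restrict Ω) := ⟨by
    rw [Measure.restrict_apply_univ]; exact hb.measure_lt_top⟩
  have hconj : (r / (r - 1)).HolderConjugate r := by
    rw [Real.holderConjugate_iff]
    refine ⟨?_, ?_⟩
    · rw [one_lt_div hq]; linarith
    · field_simp; ring
  obtain ⟨K, hK⟩ := hgb
  obtain ⟨K', hK'⟩ := hwb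
  have hmg : AEStronglyMeasurable (fun x => g x ^ (r - 1)) (volume.restrict Ω) :=
    (hg.aemeasurable.pow_const _).aestronglyMeasurable
  have m1 : MemLp (fun x => g x ^ (r - 1)) (ENNReal.ofReal (r / (r - 1))) (volume.restrict Ω) := by
    refine MemLp.of_bound hmg (K ^ (r - 1)) ((ae_restrict_iff' ho.measurableSet).2
      (Eventually.of_forall fun x hx => ?_))
    rw [Real.norm_of_nonneg (Real.rpow_nonneg (hg0 x) _)]
    exact Real.rpow_le_rpow (hg0 x) ((le_abs_self _).trans (hK x hx)) hq.le
  have m2 : MemLp w (ENNReal.ofReal r) (volume.restrict Ω) :=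
    MemLp.of_bound hw K' ((ae_restrict_iff' ho.measurableSet).2
      (Eventually.of_forall fun x hx => hK' x hx))
  have := integral_mul_le_Lp_mul_Lq_of_nonneg hconj
    (Eventually.of_forall fun x => Real.rpow_nonneg (hg0 x) (r - 1))
    (Eventually.of_forall hw0) m1 m2
  refine this.trans (le_of_eq ?_)
  congr 2
  · congr 1; ext x
    rw [← Real.rpow_mul (hg0 x)]; congr 1; field_simp
  · field_simp

lemma superlevel {n : ℕ} (hn : 3 ≤ n) {η κ : ℝ} (hη : 0 < η) (hκ : 0 < κ) :
    ∃ δ : ℝ, 0 < δ ∧ ∀ μ : ℝ, 0 < μ → μ ≤ δ → ∀ x0 : En n,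
      volume {x : En n | η ≤ bubble n μ x0 x} ≠ ⊤ ∧
      volume.real {x : En n | η ≤ bubble n μ x0 x} ≤ κ := by
  haveI : Nonempty (Fin n) := ⟨⟨0, by omega⟩⟩
  have ha := aa_pos hn
  have hp := pp_pos hn
  set ω := volume.real (ball (0 : En n) 1) with hω
  have hωp : 0 ≤ ω := measureReal_nonneg
  -- radius
  obtain ⟨ρ, hρ, hρ2⟩ : ∃ ρ : ℝ, 0 < ρ ∧ ρ ^ n * ω ≤ κ := by
    refine ⟨min 1 (κ / (ω + 1)), by positivity, ?_⟩
    have h1 : (min 1 (κ / (ω + 1))) ^ n ≤ κ / (ω + 1) := by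
      refine le_trans ?_ (min_le_right 1 _)
      exact pow_le_of_le_one (by positivity) (min_le_left _ _) (by omega)
    calc _ ≤ κ / (ω + 1) * ω := mul_le_mul_of_nonneg_right h1 hωp
      _ ≤ κ := by
        rw [div_mul_eq_mul_div, div_le_iff₀ (by positivity)]; nlinarith
  -- choose delta
  set c := η ^ (1 / pp n) * (aa n * ρ ^ 2) / 2 with hc
  have hcp : 0 < c := by positivity
  refine ⟨c, hcp, fun μ hμ hμc x0 => ?_⟩
  have hsub : {x : En n | η ≤ bubble n μ x0 x} ⊆ ball x0 ρ := by
    intro x hx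
    simp only [Set.mem_ofPred_eq] at hx
    rw [mem_ball, dist_eq_norm]
    by_contra hcon
    push Not at hcon
    have e : bubble n μ x0 x = μ ^ (-pp n) * B0 n (μ⁻¹ • (x - x0)) := rfl
    rw [e, B0_eq, ← Real.mul_rpow hμ.le (by positivity), norm_smul, Real.norm_of_nonneg (by positivity)] at hx
    have h1 : aa n * ρ ^ 2 / μ ≤ μ * (1 + aa n * (μ⁻¹ * ‖x - x0‖) ^ 2) := by
      have : μ * (1 + aa n * (μ⁻¹ * ‖x - x0‖) ^ 2) = μ + aa n * ‖x - x0‖ ^ 2 / μ := by field_simp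
      rw [this]
      have : aa n * ρ ^ 2 / μ ≤ aa n * ‖x - x0‖ ^ 2 / μ := by gcongr
      linarith
    have h2 : (μ * (1 + aa n * (μ⁻¹ * ‖x - x0‖) ^ 2)) ^ (-pp n) ≤ (aa n * ρ ^ 2 / μ) ^ (-pp n) :=
      Real.rpow_le_rpow_of_nonpos (by positivity) h1 (by linarith)
    have h3 := hx.trans h2
    rw [Real.rpow_neg (by positivity), ← Real.inv_rpow (by positivity)] at h3
    have h4 := Real.rpow_le_rpow hη.le h3 (show 0 ≤ 1 / pp n by positivity)
    rw [← Real.rpow_mul (by positivity), mul_one_div_cancel hp.ne', Real.rpow_one, inv_div,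
      le_div_iff₀ (by positivity)] at h4
    rw [hc] at hμc hcp
    linarith
  refine ⟨(lt_of_le_of_lt (measure_mono hsub) measure_ball_lt_top).ne, ?_⟩
  calc volume.real {x : En n | η ≤ bubble n μ x0 x} ≤ volume.real (ball x0 ρ) :=
        measureReal_mono hsub measure_ball_lt_top.ne
    _ = ρ ^ n * ω := by
        rw [hω, Measure.real, Measure.real, Measure.addHaar_ball _ _ hρ.le, ENNReal.toReal_mul,
          ENNReal.toReal_ofReal (by positivity)]
        simp
    _ ≤ κ := hρ2

/-- one-sided duality estimate -/
lemma L8one {n : ℕ} (hn : 3 ≤ n) {Ω : Set (En n)} (ho : IsOpen Ω) (hb : Bornology.IsBounded Ω)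
    {h : En n → ℝ} {C0 : ℝ} (hC0 : 0 < C0) (hLP : ∀ φ : En n → ℝ, XX Ω φ →
    ∀ Gb : En n → ℝ, AEStronglyMeasurable Gb (volume.restrict Ω) →
    (∃ K, ∀ x ∈ Ω, |Gb x| ≤ K) → (∃ K, ∀ x ∈ Ω, |-lap φ x + h x * φ x| ≤ K) →
    (∀ x ∈ Ω, 0 < φ x → -lap φ x + h x * φ x ≤ Gb x) →
    (∫ x in Ω, (max (φ x) 0) ^ twoStar n) ^ (2 / twoStar n) ≤ C0 * ∫ x in Ω, Gb x * max (φ x) 0)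
    {φ : En n → ℝ} (hφ : XX Ω φ) {μ : ℝ} (hμ : 0 < μ) (x0 : En n) {e : En n → ℝ}
    (he : ContinuousOn e (closure Ω)) {c1 c2 C η : ℝ} (hfin : volume {x : En n | η ≤ bubble n μ x0 x} ≠ ⊤) (hc1 : 0 ≤ c1) (hc2 : 0 ≤ c2) (hC : 0 ≤ C)
    (hF : ∀ x ∈ Ω, |-lap φ x + h x * φ x| ≤ c1 * bubble n μ x0 x ^ (twoStar n - 1) + c2 +
      C * |e x| ^ (twoStar n - 1) + C * (if η ≤ bubble n μ x0 x then 1 else 0)) :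
    (∫ x in Ω, (max (φ x) 0) ^ twoStar n) ^ (1 / twoStar n) ≤
      C0 * (c1 * (∫ x : En n, B0 n x ^ twoStar n) ^ ((twoStar n - 1) / twoStar n) +
        c2 * (volume.real Ω) ^ ((twoStar n - 1) / twoStar n) +
        C * (∫ x in Ω, |e x| ^ twoStar n) ^ ((twoStar n - 1) / twoStar n) +
        C * (volume.real {x : En n | η ≤ bubble n μ x0 x}) ^ ((twoStar n - 1) / twoStar n)) := by
  have hr := twoStar_pos hn
  set r := twoStar n with hrd
  have hq : 0 < r - 1 := by linarith
  have hBc : Continuous (bubble n μ x0) := (bubble_contDiff hn μ x0).continuous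
  have hBp := fun x => bubble_pos hn hμ x0 x
  have hK := hb.isCompact_closure
  have hmeas : MeasurableSet {x : En n | η ≤ bubble n μ x0 x} :=
    (isClosed_le continuous_const hBc).measurableSet
  set g4 : En n → ℝ := fun x => if η ≤ bubble n μ x0 x then 1 else 0 with hg4
  have hg4m : Measurable g4 := Measurable.ite hmeas measurable_const measurable_const
  have hg40 : ∀ x, 0 ≤ g4 x := fun x => by simp only [hg4]; split_ifs <;> norm_num
  have hg41 : ∀ x, g4 x ≤ 1 := fun x => by simp only [hg4]; split_ifs <;> norm_num
  have hg4r : ∀ x, ∀ t : ℝ, 0 < t → g4 x ^ t = g4 x := fun x t ht => by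
    simp only [hg4]; split_ifs
    · exact Real.one_rpow _
    · exact Real.zero_rpow ht.ne'
  set w : En n → ℝ := fun x => max (φ x) 0 with hw
  have hw0 : ∀ x, 0 ≤ w x := fun x => le_max_right _ _
  have hwc : ContinuousOn w (closure Ω) := ContinuousOn.sup hφ.cont continuousOn_const
  have cm : ∀ f : En n → ℝ, ContinuousOn f (closure Ω) →
      AEStronglyMeasurable f (volume.restrict Ω) ∧ ∃ K, ∀ x ∈ Ω, |f x| ≤ K := fun f hf => by
    refine ⟨(hf.mono subset_closure).aestronglyMeasurable ho.measurableSet, ?_⟩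
    obtain ⟨K, hK⟩ := hK.exists_bound_of_continuousOn hf
    exact ⟨K, fun x hx => hK x (subset_closure hx)⟩
  have hea : ContinuousOn (fun x => |e x|) (closure Ω) := he.abs
  have bm := cm w hwc
  have bB := cm _ hBc.continuousOn
  have be := cm _ hea
  have bBq := cm (fun x => bubble n μ x0 x ^ (r - 1)) (hBc.continuousOn.rpow_const (fun x _ => Or.inr hq.le))
  have beq := cm (fun x => |e x| ^ (r - 1)) (hea.rpow_const (fun x _ => Or.inr hq.le))
  have h1 := holder_q hb ho hr bB.1 bB.2 (fun x => (hBp x).le) bm.1 bm.2 hw0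
  have h2 := holder_q hb ho hr (g := fun _ => 1) aestronglyMeasurable_const ⟨1, fun x _ => by simp⟩
    (fun x => zero_le_one) bm.1 bm.2 hw0
  have h3 := holder_q hb ho hr be.1 be.2 (fun x => abs_nonneg _) bm.1 bm.2 hw0
  have b4 : ∃ K, ∀ x ∈ Ω, |g4 x| ≤ K := ⟨1, fun x _ => by rw [abs_of_nonneg (hg40 x)]; exact hg41 x⟩
  have h4 := holder_q hb ho hr hg4m.aestronglyMeasurable b4 hg40 bm.1 bm.2 hw0
  simp only [hg4r _ _ hq, hg4r _ r (by linarith)] at h4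
  simp only [Real.one_rpow, one_mul] at h2
  -- compare the g-integrals
  have i1 : ∫ x in Ω, bubble n μ x0 x ^ r ≤ ∫ x : En n, B0 n x ^ r := by
    have := bubble_star_int hn hμ x0
    rw [← this.2]
    exact setIntegral_le_integral this.1 (Eventually.of_forall fun x => Real.rpow_nonneg (hBp x).le _)
  have i2 : ∫ x in Ω, (1:ℝ) = volume.real Ω := by simp
  have i4 : ∫ x in Ω, g4 x ≤ volume.real {x : En n | η ≤ bubble n μ x0 x} := by
    have e1 : g4 = Set.indicator {x : En n | η ≤ bubble n μ x0 x} (fun _ => (1:ℝ)) := by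
      ext x; simp [hg4, Set.indicator]
    rw [e1, integral_indicator_const _ hmeas, smul_eq_mul, mul_one]
    rw [Measure.real, Measure.real, Measure.restrict_apply hmeas]
    exact ENNReal.toReal_mono hfin (measure_mono Set.inter_subset_left)
  set G : En n → ℝ := fun x => c1 * bubble n μ x0 x ^ (r - 1) + c2 + C * |e x| ^ (r - 1) + C * g4 x with hG
  have hGm : AEStronglyMeasurable G (volume.restrict Ω) :=
    (((bBq.1.const_mul c1).add aestronglyMeasurable_const).add (beq.1.const_mul C)).add
      (hg4m.aestronglyMeasurable.const_mul C)
  obtain ⟨K1, hK1⟩ := bBq.2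
  obtain ⟨K3, hK3⟩ := beq.2
  have hGabs : ∀ x ∈ Ω, |G x| ≤ c1 * K1 + c2 + C * K3 + C * 1 := by
    intro x hx
    have a1 : 0 ≤ bubble n μ x0 x ^ (r - 1) := Real.rpow_nonneg (hBp x).le _
    have a3 : 0 ≤ |e x| ^ (r - 1) := by positivity
    have a4 := hg40 x
    rw [abs_of_nonneg (by simp only [hG]; positivity)]
    simp only [hG]
    have := (le_abs_self _).trans (hK1 x hx)
    have := (le_abs_self _).trans (hK3 x hx)
    have := hg41 x
    gcongr
  have hlp := hLP φ hφ G hGm ⟨_, hGabs⟩ ⟨_, fun x hx => (hF x hx).trans ((le_abs_self _).trans (hGabs x hx))⟩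
    (fun x hx _ => (le_abs_self _).trans (hF x hx))
  -- split the integral
  have iw : Integrable w (volume.restrict Ω) := bdd_pow_int hb ho bm.1 bm.2
  obtain ⟨Kw, hKw⟩ := bm.2
  have prodint : ∀ f : En n → ℝ, AEStronglyMeasurable f (volume.restrict Ω) → (∃ K, ∀ x ∈ Ω, |f x| ≤ K) →
      Integrable (fun x => f x * w x) (volume.restrict Ω) := by
    intro f hf hfK
    obtain ⟨K, hK⟩ := hfK
    refine bdd_pow_int hb ho (hf.mul bm.1) ⟨K * Kw, fun x hx => ?_⟩
    rw [abs_mul]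
    exact mul_le_mul (hK x hx) (hKw x hx) (abs_nonneg _) ((abs_nonneg _).trans (hK x hx))
  have j1 := (prodint _ bBq.1 bBq.2).const_mul c1
  have j2 := iw.const_mul c2
  have j3 := (prodint _ beq.1 beq.2).const_mul C
  have j4 := (prodint _ hg4m.aestronglyMeasurable b4).const_mul C
  have j12 : Integrable (fun x => c1 * (bubble n μ x0 x ^ (r - 1) * w x) + c2 * w x)
    (volume.restrict Ω) := j1.add j2
  have j123 : Integrable (fun x => c1 * (bubble n μ x0 x ^ (r - 1) * w x) + c2 * w x +
    C * (|e x| ^ (r - 1) * w x)) (volume.restrict Ω) := j12.add j3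
  have hsplit : ∫ x in Ω, G x * w x = c1 * (∫ x in Ω, bubble n μ x0 x ^ (r - 1) * w x) +
      c2 * (∫ x in Ω, w x) + C * (∫ x in Ω, |e x| ^ (r - 1) * w x) + C * (∫ x in Ω, g4 x * w x) := by
    rw [← integral_const_mul, ← integral_const_mul, ← integral_const_mul, ← integral_const_mul,
      ← integral_add j1 j2, ← integral_add j12 j3, ← integral_add j123 j4]
    congr 1; ext x; simp only [hG]; ring
  set U := ∫ x in Ω, w x ^ r with hU
  have hU0 : 0 ≤ U := integral_nonneg fun x => Real.rpow_nonneg (hw0 x) _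
  rcases hU0.eq_or_lt with hz | hUp
  · rw [← hz, Real.zero_rpow (by positivity)]
    have a1 : 0 ≤ ∫ x : En n, B0 n x ^ r := integral_nonneg fun x => Real.rpow_nonneg (B0_pos hn x).le _
    have a3 : 0 ≤ ∫ x in Ω, |e x| ^ r := integral_nonneg fun x => by positivity
    positivity
  have hs : 0 < U ^ (1 / r) := Real.rpow_pos_of_pos hUp _
  have e2 : U ^ (2 / r) = U ^ (1 / r) * U ^ (1 / r) := by
    rw [← Real.rpow_add hUp]; congr 1; ring
  rw [e2, hsplit] at hlp
  set s := U ^ (1 / r) with hsd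
  have hθ : 0 ≤ (r - 1) / r := by apply div_nonneg <;> linarith
  have p1 : (∫ x in Ω, bubble n μ x0 x ^ r) ^ ((r - 1) / r) ≤ (∫ x : En n, B0 n x ^ r) ^ ((r - 1) / r) :=
    Real.rpow_le_rpow (integral_nonneg fun x => Real.rpow_nonneg (hBp x).le _) i1 hθ
  have p4 : (∫ x in Ω, g4 x) ^ ((r - 1) / r) ≤ (volume.real {x : En n | η ≤ bubble n μ x0 x}) ^ ((r - 1) / r) :=
    Real.rpow_le_rpow (integral_nonneg hg40) i4 hθ
  rw [i2] at h2
  have q1 := mul_le_mul_of_nonneg_left (h1.trans (mul_le_mul_of_nonneg_right p1 hs.le)) hc1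
  have q2 := mul_le_mul_of_nonneg_left h2 hc2
  have q3 := mul_le_mul_of_nonneg_left h3 hC
  have q4 := mul_le_mul_of_nonneg_left (h4.trans (mul_le_mul_of_nonneg_right p4 hs.le)) hC
  have q := mul_le_mul_of_nonneg_left (add_le_add (add_le_add (add_le_add q1 q2) q3) q4) hC0.le
  refine le_of_mul_le_mul_right (hlp.trans (q.trans (le_of_eq ?_))) hs
  ring

lemma L8two {n : ℕ} (hn : 3 ≤ n) {Ω : Set (En n)} (ho : IsOpen Ω) (hb : Bornology.IsBounded Ω)
    {hinf : En n → ℝ} {C0 : ℝ} (hC0 : 0 < C0) {vinf : En n → ℝ} (hvx : XX Ω vinf)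
    (hvs : ∀ x ∈ Ω, -lap vinf x + hinf x * vinf x = Nl (twoStar n) (vinf x))
    {s : ℝ} (hsgn : s = 1 ∨ s = -1) {V : ℝ} (hV : 0 < V) (hvV : ∀ x ∈ Ω, |vinf x| ≤ V)
    {κ : ℝ} (hκ : 0 < κ) :
    ∃ δ : ℝ, 0 < δ ∧ ∀ h : En n → ℝ, (∀ φ : En n → ℝ, XX Ω φ →
    ∀ Gb : En n → ℝ, AEStronglyMeasurable Gb (volume.restrict Ω) →
    (∃ K, ∀ x ∈ Ω, |Gb x| ≤ K) → (∃ K, ∀ x ∈ Ω, |-lap φ x + h x * φ x| ≤ K) →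
    (∀ x ∈ Ω, 0 < φ x → -lap φ x + h x * φ x ≤ Gb x) →
    (∫ x in Ω, (max (φ x) 0) ^ twoStar n) ^ (2 / twoStar n) ≤ C0 * ∫ x in Ω, Gb x * max (φ x) 0) →
    (∀ x ∈ Ω, |h x - hinf x| ≤ δ) → ∀ μ : ℝ, 0 < μ → μ ≤ δ → ∀ x0 : En n, ∀ v P : En n → ℝ,
    XX Ω v → (∀ x ∈ Ω, -lap v x + h x * v x = Nl (twoStar n) (v x)) → IsBubbleProj Ω h μ x0 P →
    ∫ x in Ω, |v x - s * vinf x - bubble n μ x0 x| ^ twoStar n ≤ δ →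
    ∫ x in Ω, |v x - P x - s * vinf x| ^ twoStar n ≤ κ := by
  have hr := twoStar_pos hn
  set r := twoStar n with hrd
  have hq : 0 < r - 1 := by linarith
  have hr0 : 0 < r := by linarith
  have hθ : 0 < (r - 1) / r := by positivity
  have hs1 : |s| = 1 := by rcases hsgn with h | h <;> rw [h] <;> simp
  set b := (∫ x : En n, B0 n x ^ r) ^ ((r - 1) / r) with hbd
  have hb0 : 0 ≤ b := Real.rpow_nonneg (integral_nonneg fun x => Real.rpow_nonneg (B0_pos hn x).le _) _
  set o := (volume.real Ω) ^ ((r - 1) / r) with hod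
  have ho0 : 0 ≤ o := Real.rpow_nonneg measureReal_nonneg _
  set k := (κ / 2) ^ (1 / r) with hk
  have hk0 : 0 < k := by positivity
  set ε := k / (2 * C0 * (b + 2 * o + 1)) with hε
  have hε0 : 0 < ε := by positivity
  obtain ⟨C, η, hC, hη, hI⟩ := Nl_I2 hr hV.le hε0
  set t := k / (4 * C0 * C) with ht
  have ht0 : 0 < t := by positivity
  obtain ⟨δ1, hδ1, hδ1'⟩ := superlevel hn hη (show 0 < t ^ (r / (r - 1)) by positivity)
  refine ⟨min (min δ1 (t ^ (r / (r - 1)))) (ε / V), by positivity, ?_⟩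
  intro h hLP hh μ hμ hμδ x0 v P hv hvsol hP hes
  have hPx : XX Ω P := ⟨hP.1, hP.2.2⟩
  have hux : XX Ω (fun x => v x - P x - s * vinf x) := (hv.sub hPx).sub (hvx.const_mul s)
  set u : En n → ℝ := fun x => v x - P x - s * vinf x with hu
  set e : En n → ℝ := fun x => v x - s * vinf x - bubble n μ x0 x with he
  have hec : ContinuousOn e (closure Ω) :=
    (hv.cont.sub (continuousOn_const.mul hvx.cont)).sub (bubble_contDiff hn μ x0).continuous.continuousOn
  obtain ⟨hfin, hvol⟩ := hδ1' μ hμ (hμδ.trans ((min_le_left _ _).trans (min_le_left _ _))) x0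
  have hF : ∀ x ∈ Ω, |-lap u x + h x * u x| ≤ ε * bubble n μ x0 x ^ (r - 1) + 2 * ε +
      C * |e x| ^ (r - 1) + C * (if η ≤ bubble n μ x0 x then 1 else 0) := by
    intro x hx
    have hBp := bubble_pos hn hμ x0 x
    have hl : lap u x = lap v x - lap P x - s * lap vinf x := by
      rw [hu, lap_sub ((hv.at ho hx).sub (hPx.at ho hx)) (contDiffAt_const.mul (hvx.at ho hx)),
        lap_sub (hv.at ho hx) (hPx.at ho hx), lap_const_mul s (hvx.at ho hx)]
    have hNs : Nl r (s * vinf x) = s * Nl r (vinf x) := by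
      rw [Nl_mul]; congr 1; unfold Nl; rw [hs1, Real.one_rpow, one_mul]
    have hFe : -lap u x + h x * u x = (Nl r (bubble n μ x0 x + s * vinf x + e x) - Nl r (bubble n μ x0 x)
        - Nl r (s * vinf x)) - s * ((h x - hinf x) * vinf x) := by
      rw [hl, hNs, Nl_nonneg hr hBp.le, ← hvs x hx,
        show bubble n μ x0 x + s * vinf x + e x = v x by simp only [he]; ring, ← hvsol x hx, ← hP.2.1 x hx]
      simp only [hu]; ring
    have h1 := hI (bubble n μ x0 x) (s * vinf x) (e x) hBp.le (by rw [abs_mul, hs1, one_mul]; exact hvV x hx)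
    have h2 : |s * ((h x - hinf x) * vinf x)| ≤ ε := by
      rw [abs_mul, hs1, one_mul, abs_mul]
      calc _ ≤ ε / V * V := mul_le_mul ((hh x hx).trans (min_le_right _ _)) (hvV x hx) (abs_nonneg _) (by positivity)
        _ = ε := by field_simp
    rw [hFe]
    have h3 := abs_sub (Nl r (bubble n μ x0 x + s * vinf x + e x) - Nl r (bubble n μ x0 x)
        - Nl r (s * vinf x)) (s * ((h x - hinf x) * vinf x))
    linarith
  have hFneg : ∀ x ∈ Ω, |-lap (fun y => - u y) x + h x * (- u x)| ≤ ε * bubble n μ x0 x ^ (r - 1) + 2 * ε +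
      C * |e x| ^ (r - 1) + C * (if η ≤ bubble n μ x0 x then 1 else 0) := by
    intro x hx
    rw [lap_neg (hux.at ho hx), show -(-lap u x) + h x * (-u x) = -(-lap u x + h x * u x) by ring, abs_neg]
    exact hF x hx
  have k1 := L8one hn ho hb hC0 hLP hux hμ x0 hec hfin hε0.le (by positivity) hC.le hF
  have k2 := L8one hn ho hb hC0 hLP hux.neg hμ x0 hec hfin hε0.le (by positivity) hC.le hFneg
  have he0 : 0 ≤ ∫ x in Ω, |e x| ^ r := integral_nonneg fun x => by positivity
  have tt : (t ^ (r / (r - 1))) ^ ((r - 1) / r) = t := by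
    rw [← Real.rpow_mul ht0.le, show r / (r - 1) * ((r - 1) / r) = 1 by field_simp, Real.rpow_one]
  have b3 : (∫ x in Ω, |e x| ^ r) ^ ((r - 1) / r) ≤ t := by
    rw [← tt]
    exact Real.rpow_le_rpow he0 (hes.trans ((min_le_left _ _).trans (min_le_right _ _))) hθ.le
  have b4 : (volume.real {x : En n | η ≤ bubble n μ x0 x}) ^ ((r - 1) / r) ≤ t := by
    rw [← tt]
    exact Real.rpow_le_rpow measureReal_nonneg hvol hθ.le
  have hrhs : C0 * (ε * b + 2 * ε * o + C * (∫ x in Ω, |e x| ^ r) ^ ((r - 1) / r) +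
      C * (volume.real {x : En n | η ≤ bubble n μ x0 x}) ^ ((r - 1) / r)) ≤ k := by
    calc _ ≤ C0 * (ε * b + 2 * ε * o + C * t + C * t) := by gcongr
      _ ≤ C0 * (ε * (b + 2 * o + 1) + 2 * (C * t)) := by
        apply mul_le_mul_of_nonneg_left _ hC0.le; linarith
      _ = k := by rw [hε, ht]; field_simp; norm_num
  have fin : ∀ U : ℝ, 0 ≤ U → U ^ (1 / r) ≤ k → U ≤ κ / 2 := by
    intro U hU h
    have := Real.rpow_le_rpow (Real.rpow_nonneg hU _) h hr0.le
    rwa [hk, ← Real.rpow_mul hU, ← Real.rpow_mul (by positivity), one_div_mul_cancel hr0.ne', Real.rpow_one,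
      Real.rpow_one] at this
  have m1 := fin _ (integral_nonneg fun x => Real.rpow_nonneg (le_max_right _ _) _) (k1.trans hrhs)
  have m2 := fin _ (integral_nonneg fun x => Real.rpow_nonneg (le_max_right _ _) _) (k2.trans hrhs)
  have ci : ∀ f : En n → ℝ, ContinuousOn f (closure Ω) → Integrable f (volume.restrict Ω) := fun f hf => by
    obtain ⟨K, hK⟩ := hb.isCompact_closure.exists_bound_of_continuousOn hf
    exact bdd_pow_int hb ho ((hf.mono subset_closure).aestronglyMeasurable ho.measurableSet)
      ⟨K, fun x hx => hK x (subset_closure hx)⟩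
  have c1 : ContinuousOn (fun x => max (u x) 0 ^ r) (closure Ω) :=
    (ContinuousOn.sup hux.cont continuousOn_const).rpow_const (fun x _ => Or.inr hr0.le)
  have c2 : ContinuousOn (fun x => max (-u x) 0 ^ r) (closure Ω) :=
    (ContinuousOn.sup hux.cont.neg continuousOn_const).rpow_const (fun x _ => Or.inr hr0.le)
  have : ∫ x in Ω, |u x| ^ r = (∫ x in Ω, max (u x) 0 ^ r) + ∫ x in Ω, max (-u x) 0 ^ r := by
    rw [← integral_add (ci _ c1) (ci _ c2)]
    congr 1; ext x
    rcases le_total 0 (u x) with h | h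
    · rw [max_eq_left h, max_eq_right (by linarith), abs_of_nonneg h, Real.zero_rpow hr0.ne', add_zero]
    · rw [max_eq_right h, max_eq_left (by linarith), abs_of_nonpos h, Real.zero_rpow hr0.ne', zero_add]
  rw [this]
  linarith

/-- two-sided version of the epsilon-regularity lemma -/
lemma Etwo {n : ℕ} (hn : 3 ≤ n) {Ω : Set (En n)} (ho : IsOpen Ω) (hb : Bornology.IsBounded Ω)
    {ψ : En n → ℝ} {c1 C2 C4 : ℝ} (hψ : PsiD Ω ψ c1 C2) (hC4 : 0 < C4) {M : ℝ} (hM : 0 < M)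
    {ε : ℝ} (hε : 0 < ε) : ∃ δ : ℝ, 0 < δ ∧ ∀ h : En n → ℝ, Adm Ω ψ c1 C4 h → ∀ (y : En n) (l : ℝ),
      y ∈ Ω → 0 < l → l ≤ 1 → ∀ f : En n → ℝ, XX Ω f →
      (∃ K, 0 < K ∧ ∀ x ∈ closure Ω, |f x| ≤ K * ψ x) →
      (∀ x ∈ Ω ∩ ball y l, l ^ pp n * |f x| ≤ M ∧ l ^ pp n * |-lap f x + h x * f x| ≤ M / l ^ 2) →
      (∫ x in Ω ∩ ball y l, |f x| ^ twoStar n) ≤ δ → l ^ pp n * |f y| ≤ 2 * ε := by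
  have hr := twoStar_pos hn
  obtain ⟨δ, hδ, H⟩ := Eone hn ho hb hψ hC4 hM hε
  refine ⟨δ, hδ, fun h hA y l hy hl hl1 f hf hdom hsub hintg => ?_⟩
  set c := l ^ pp n with hc
  have hcp : 0 < c := by positivity
  have hcr : c ^ twoStar n = l ^ n := by
    rw [hc, ← Real.rpow_mul hl.le, pp_star hn, Real.rpow_natCast]
  obtain ⟨K, hK, hKb⟩ := hdom
  have main : ∀ t : ℝ, |t| = c → t * f y ≤ 2 * ε := by
    intro t ht
    apply H h hA y l hy hl hl1 (fun x => t * f x) ⟨hf.const_mul t, ⟨c * K, by positivity, fun x hx => ?_⟩, ?_⟩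
    · have : ∀ x, |t * f x| ^ twoStar n = l ^ n * |f x| ^ twoStar n := by
        intro x
        rw [abs_mul, ht, Real.mul_rpow hcp.le (abs_nonneg _), hcr]
      simp only [this]
      rw [integral_const_mul, mul_comm]
      exact mul_le_mul_of_nonneg_right hintg (by positivity)
    · intro x hx _
      obtain ⟨h1, h2⟩ := hsub x hx
      constructor
      · refine (le_abs_self _).trans ?_
        rw [abs_mul, ht]; exact h1
      · rw [lap_const_mul t (hf.at ho hx.1), show -(t * lap f x) + h x * (t * f x) =
          t * (-lap f x + h x * f x) by ring]
        refine (le_abs_self _).trans ?_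
        rw [abs_mul, ht]; exact h2
    · rw [abs_mul, ht, mul_assoc]
      exact mul_le_mul_of_nonneg_left (hKb x hx) hcp.le
  rcases abs_cases (f y) with h | h
  · rw [h.1]; exact main c (abs_of_pos hcp)
  · rw [h.1]
    have := main (-c) (by rw [abs_neg, abs_of_pos hcp])
    linarith

lemma exists_wmax {n : ℕ} (hn : 3 ≤ n) {Ω : Set (En n)} (ho : IsOpen Ω) (hb : Bornology.IsBounded Ω)
    {f : En n → ℝ} (hf : XX Ω f) {μ : ℝ} (hμ : 0 < μ) (x0 : En n) {T : ℝ} (hT : 0 ≤ T)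
    (hex : ∃ x ∈ closure Ω, T < (‖x - x0‖ + μ) ^ pp n * |f x|) :
    ∃ y ∈ Ω, T < (‖y - x0‖ + μ) ^ pp n * |f y| ∧
      ∀ x ∈ Ω, (‖x - x0‖ + μ) ^ pp n * |f x| ≤ (‖y - x0‖ + μ) ^ pp n * |f y| := by
  obtain ⟨x, hx, hxT⟩ := hex
  have hc : ContinuousOn (fun x => (‖x - x0‖ + μ) ^ pp n * |f x|) (closure Ω) := by
    refine ContinuousOn.mul ?_ hf.cont.abs
    refine ContinuousOn.rpow_const (by fun_prop) (fun x _ => Or.inr (pp_pos hn).le)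
  obtain ⟨y, hy, hym⟩ := hb.isCompact_closure.exists_isMaxOn ⟨x, hx⟩ hc
  have h1 : T < (‖y - x0‖ + μ) ^ pp n * |f y| := lt_of_lt_of_le hxT (hym hx)
  refine ⟨y, ?_, h1, fun z hz => hym (subset_closure hz)⟩
  by_contra hyn
  have : y ∈ frontier Ω := by
    rw [frontier, ho.interior_eq]; exact ⟨hy, hyn⟩
  rw [hf.bd y this, abs_zero, mul_zero] at h1
  exact absurd h1 (not_lt.2 hT)

/-- weight comparison on a small ball -/
lemma weight_half {n : ℕ} {x y x0 : En n} {μ l : ℝ} (hμ : 0 < μ)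
    (hl : l ≤ (‖y - x0‖ + μ) / 2) (hx : x ∈ ball y l) :
    (‖y - x0‖ + μ) / 2 ≤ ‖x - x0‖ + μ := by
  rw [mem_ball, dist_eq_norm] at hx
  have h : ‖y - x0‖ ≤ ‖x - x0‖ + ‖x - y‖ := by
    have := norm_sub_le (x - x0) (x - y)
    rwa [show x - x0 - (x - y) = y - x0 by abel] at this
  linarith

lemma weight_neg {n : ℕ} (hn : 3 ≤ n) {D D' : ℝ} (hD : 0 < D) (h : D / 2 ≤ D') :
    D' ^ (-pp n) ≤ 2 ^ pp n * D ^ (-pp n) := by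
  have hp := pp_pos hn
  refine (Real.rpow_le_rpow_of_nonpos (by positivity) h (by linarith)).trans (le_of_eq ?_)
  rw [Real.div_rpow hD.le (by norm_num), Real.rpow_neg (show (0:ℝ) ≤ 2 by norm_num), div_inv_eq_mul, mul_comm]

lemma diam_weight {n : ℕ} {Ω : Set (En n)} (hb : Bornology.IsBounded Ω) :
    ∃ R : ℝ, 0 < R ∧ ∀ x ∈ Ω, ∀ x0 ∈ Ω, ∀ μ : ℝ, μ ≤ 1 → ‖x - x0‖ + μ ≤ R := by
  refine ⟨Metric.diam Ω + 1, by positivity, fun x hx x0 hx0 μ hμ => ?_⟩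
  have := Metric.dist_le_diam_of_mem hb hx hx0
  rw [dist_eq_norm] at this
  linarith

lemma bubble_decay' {n : ℕ} (hn : 3 ≤ n) : ∃ Cd : ℝ, 0 < Cd ∧ ∀ μ : ℝ, 0 < μ → ∀ x0 x : En n,
    bubble n μ x0 x ≤ Cd * (‖x - x0‖ + μ) ^ (-pp n) := by
  have ha := aa_pos hn
  exact ⟨(aa n / 2) ^ (-pp n), by positivity, fun μ hμ x0 x => bubble_decay hn hμ x0 x⟩

/-- the weighted bound for the solutions -/
lemma run1 {n : ℕ} (hn : 3 ≤ n) {Ω : Set (En n)} (ho : IsOpen Ω) (hb : Bornology.IsBounded Ω)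
    {ψ : En n → ℝ} {c1 C2 C4 : ℝ} (hψ : PsiD Ω ψ c1 C2) (hC4 : 0 < C4) {V : ℝ} (hV : 0 < V) :
    ∃ Λ δ : ℝ, 0 < Λ ∧ 0 < δ ∧ ∀ h : En n → ℝ, Adm Ω ψ c1 C4 h → ∀ (μ : ℝ) (x0 : En n) (v z : En n → ℝ),
      0 < μ → μ ≤ 1 → x0 ∈ Ω → XX Ω v → (∃ K, 0 < K ∧ ∀ x ∈ closure Ω, |v x| ≤ K * ψ x) →
      (∀ x ∈ Ω, -lap v x + h x * v x = Nl (twoStar n) (v x)) → XX Ω z → (∀ x ∈ Ω, |v x - z x| ≤ V) →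
      ∫ x in Ω, |z x - bubble n μ x0 x| ^ twoStar n ≤ δ →
      ∀ x ∈ closure Ω, (‖x - x0‖ + μ) ^ pp n * |v x| ≤ Λ := by
  have hr := twoStar_pos hn
  have hp := pp_pos hn
  set r := twoStar n with hrd
  set p := pp n with hpd
  have hr0 : 0 < r := by linarith
  have hq : 0 < r - 1 := by linarith
  have hp1 : p * (r - 1) = p + 2 := pp_star1 hn
  have hpr : p * r = n := pp_star hn
  obtain ⟨R, hR, hRb⟩ := diam_weight hb
  obtain ⟨Cd, hCd, hdec⟩ := bubble_decay' hn
  obtain ⟨δ, hδ, H⟩ := Etwo hn ho hb hψ hC4 (M := 2 ^ (p + 2)) (by positivity) (ε := 1 / 4) (by norm_num)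
  set ω := volume.real (ball (0 : En n) 1) with hω
  have hω0 : 0 ≤ ω := measureReal_nonneg
  set CQ := Cd * 2 ^ p + V * R ^ p with hCQ
  have hCQ0 : 0 < CQ := by positivity
  obtain ⟨τ, hτ, hτ2⟩ : ∃ τ : ℝ, 0 < τ ∧ τ ^ r * ω ≤ δ / (2 * 2 ^ r) := by
    refine ⟨(δ / (2 * 2 ^ r) / (ω + 1)) ^ (1 / r), by positivity, ?_⟩
    rw [← Real.rpow_mul (by positivity), one_div_mul_cancel hr0.ne', Real.rpow_one, div_mul_eq_mul_div,
      div_le_iff₀ (by positivity)]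
    nlinarith [show 0 < δ / (2 * 2 ^ r) by positivity]
  set Λ := max ((2 * (R + 1)) ^ p) (CQ / τ) with hΛ
  have hΛ0 : 0 < Λ := lt_max_of_lt_right (by positivity)
  refine ⟨Λ, δ / (2 * 2 ^ r), hΛ0, by positivity, ?_⟩
  intro h hA μ x0 v z hμ hμ1 hx0 hv hdom hsol hz hvz hes
  by_contra hcon
  push Not at hcon
  obtain ⟨y, hy, hyΛ, hym⟩ := exists_wmax hn ho hb hv hμ x0 hΛ0.le hcon
  set D := ‖y - x0‖ + μ with hD
  have hD0 : 0 < D := by positivity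
  have hDR : D ≤ R := hRb y hy x0 hx0 μ hμ1
  set m := D ^ p * |v y| with hm
  have hm0 : 0 < m := hΛ0.trans hyΛ
  set k := m ^ (-(1 / p)) with hk
  have hk0 : 0 < k := by positivity
  have hkp : k ^ p = m⁻¹ := by
    rw [hk, ← Real.rpow_mul hm0.le, show -(1 / p) * p = -1 by field_simp, Real.rpow_neg_one]
  have hkR : k ≤ 1 / (2 * (R + 1)) := by
    have h1 : (2 * (R + 1)) ^ p ≤ m := (le_max_left _ _).trans hyΛ.le
    have h2 := Real.rpow_le_rpow_of_nonpos (by positivity) h1 (show -(1 / p) ≤ 0 by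
      have : 0 < 1 / p := by positivity
      linarith)
    rwa [← Real.rpow_mul (by positivity), show p * -(1 / p) = -1 by field_simp, Real.rpow_neg_one,
      ← one_div] at h2
  have hk12 : k ≤ 1 / 2 := hkR.trans (by
    apply one_div_le_one_div_of_le (by norm_num); linarith)
  set l := k * D with hl
  have hl0 : 0 < l := by positivity
  have hlD : l ≤ D / 2 := by rw [hl]; nlinarith
  have hl1 : l ≤ 1 := by
    calc l ≤ 1 / (2 * (R + 1)) * R := mul_le_mul hkR hDR hD0.le (by positivity)
      _ ≤ 1 := by rw [div_mul_eq_mul_div, div_le_one (by positivity)]; linarith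
  have hlp : l ^ p = m⁻¹ * D ^ p := by rw [hl, Real.mul_rpow hk0.le hD0.le, hkp]
  have hbd : ∀ x ∈ Ω ∩ ball y l, l ^ p * |v x| ≤ 2 ^ p := by
    intro x hx
    have h1 := weight_half hμ hlD hx.2
    have h2 := hym x hx.1
    have h3 : (D / 2) ^ p * |v x| ≤ m :=
      (mul_le_mul_of_nonneg_right (Real.rpow_le_rpow (by positivity) h1 hp.le) (abs_nonneg _)).trans h2
    rw [Real.div_rpow hD0.le (by norm_num), div_mul_eq_mul_div, div_le_iff₀ (by positivity)] at h3
    rw [hlp, mul_assoc, inv_mul_le_iff₀ hm0]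
    exact h3
  have key := H h hA y l hy hl0 hl1 v hv hdom ?_ ?_
  · rw [hlp, mul_assoc, ← hm, inv_mul_cancel₀ hm0.ne'] at key
    norm_num at key
  · intro x hx
    have h1 := hbd x hx
    refine ⟨h1.trans (Real.rpow_le_rpow_of_exponent_le (by norm_num) (by linarith)), ?_⟩
    rw [hsol x hx.1, Nl_abs hr, le_div_iff₀ (by positivity)]
    have h2 := Real.rpow_le_rpow (by positivity) h1 hq.le
    rw [Real.mul_rpow (by positivity) (abs_nonneg _), ← Real.rpow_mul hl0.le, ← Real.rpow_mul (by norm_num), hp1,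
      Real.rpow_add hl0] at h2
    rw [Real.rpow_two] at h2
    linarith
  · set Q := Cd * 2 ^ p * D ^ (-p) + V with hQ
    have hQ0 : 0 < Q := by positivity
    have hpt : ∀ x ∈ Ω ∩ ball y l, |v x| ^ r ≤ 2 ^ r * (Q ^ r + |z x - bubble n μ x0 x| ^ r) := by
      intro x hx
      have h1 := weight_half hμ hlD hx.2
      have h2 := hdec μ hμ x0 x
      have h3 := weight_neg hn hD0 h1
      have h4 : bubble n μ x0 x ≤ Cd * 2 ^ p * D ^ (-p) := by
        rw [mul_assoc]; exact h2.trans (mul_le_mul_of_nonneg_left h3 hCd.le)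
      have h5 := hvz x hx.1
      have h6 := bubble_pos hn hμ x0 x
      have h7 : |v x| ≤ Q + |z x - bubble n μ x0 x| := by
        have : v x = (v x - z x) + (bubble n μ x0 x) + (z x - bubble n μ x0 x) := by ring
        have t1 := abs_add_le ((v x - z x) + (bubble n μ x0 x)) (z x - bubble n μ x0 x)
        have t2 := abs_add_le (v x - z x) (bubble n μ x0 x)
        rw [← this] at t1
        rw [abs_of_pos h6] at t2
        linarith
      exact (Real.rpow_le_rpow (abs_nonneg _) h7 hr0.le).trans (rpow_abs_add hr0 hQ0.le (abs_nonneg _))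
    have hec : ContinuousOn (fun x => |z x - bubble n μ x0 x| ^ r) (closure Ω) :=
      ((hz.cont.sub (bubble_contDiff hn μ x0).continuous.continuousOn).abs).rpow_const (fun x _ => Or.inr hr0.le)
    have ci : ∀ f : En n → ℝ, ContinuousOn f (closure Ω) → IntegrableOn f Ω := fun f hf => by
      obtain ⟨K, hK⟩ := hb.isCompact_closure.exists_bound_of_continuousOn hf
      exact bdd_pow_int hb ho ((hf.mono subset_closure).aestronglyMeasurable ho.measurableSet)
        ⟨K, fun x hx => hK x (subset_closure hx)⟩
    have hms : MeasurableSet (Ω ∩ ball y l) := ho.measurableSet.inter measurableSet_ball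
    have hQr : Q ^ r * volume.real (Ω ∩ ball y l) ≤ δ / (2 * 2 ^ r) := by
      haveI : Nonempty (Fin n) := ⟨⟨0, by omega⟩⟩
      have h1 : volume.real (Ω ∩ ball y l) ≤ l ^ n * ω := by
        refine (measureReal_mono Set.inter_subset_right measure_ball_lt_top.ne).trans (le_of_eq ?_)
        rw [hω, Measure.real, Measure.real, Measure.addHaar_ball _ _ hl0.le, ENNReal.toReal_mul,
          ENNReal.toReal_ofReal (by positivity)]
        simp
      have h2 : Q * l ^ p ≤ CQ / m := by
        rw [hQ, hlp, hCQ]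
        have : D ^ (-p) * D ^ p = 1 := by rw [← Real.rpow_add hD0]; simp
        have e1 : (Cd * 2 ^ p * D ^ (-p) + V) * (m⁻¹ * D ^ p) = (Cd * 2 ^ p * (D ^ (-p) * D ^ p) + V * D ^ p) / m := by
          field_simp
        rw [e1, this, mul_one]
        gcongr
      have h3 : CQ / m ≤ τ := by
        have : CQ / τ ≤ m := (le_max_right _ _).trans hyΛ.le
        rw [div_le_iff₀ hτ] at this
        rw [div_le_iff₀ hm0]; linarith
      have h4 := Real.rpow_le_rpow (by positivity) (h2.trans h3) hr0.le
      rw [Real.mul_rpow hQ0.le (by positivity), ← Real.rpow_mul hl0.le, hpr, Real.rpow_natCast] at h4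
      calc _ ≤ Q ^ r * (l ^ n * ω) := mul_le_mul_of_nonneg_left h1 (by positivity)
        _ = Q ^ r * l ^ n * ω := by ring
        _ ≤ τ ^ r * ω := mul_le_mul_of_nonneg_right h4 hω0
        _ ≤ _ := hτ2
    have hE : ∫ x in Ω ∩ ball y l, |z x - bubble n μ x0 x| ^ r ≤ δ / (2 * 2 ^ r) :=
      (setIntegral_mono_set (ci _ hec) (Eventually.of_forall fun x => by positivity)
        (Eventually.of_forall Set.inter_subset_left)).trans hes
    have hsubI : volume (Ω ∩ ball y l) ≠ ⊤ :=
      (lt_of_le_of_lt (measure_mono Set.inter_subset_right) measure_ball_lt_top).ne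
    have i1 : IntegrableOn (fun x => Q ^ r) (Ω ∩ ball y l) := integrableOn_const hsubI
    have i2 : IntegrableOn (fun x => |z x - bubble n μ x0 x| ^ r) (Ω ∩ ball y l) :=
      (ci _ hec).mono_set Set.inter_subset_left
    calc ∫ x in Ω ∩ ball y l, |v x| ^ r ≤ ∫ x in Ω ∩ ball y l, 2 ^ r * (Q ^ r + |z x - bubble n μ x0 x| ^ r) := by
          refine setIntegral_mono_on ?_ ((i1.add i2).const_mul _) hms hpt
          exact (ci _ (hv.cont.abs.rpow_const (fun x _ => Or.inr hr0.le))).mono_set Set.inter_subset_left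
      _ = 2 ^ r * (Q ^ r * volume.real (Ω ∩ ball y l) + ∫ x in Ω ∩ ball y l, |z x - bubble n μ x0 x| ^ r) := by
          rw [integral_const_mul, integral_add i1 i2]
          simp [mul_comm]
      _ ≤ 2 ^ r * (δ / (2 * 2 ^ r) + δ / (2 * 2 ^ r)) := by gcongr
      _ = δ := by field_simp; norm_num

/-- the weighted smallness of the remainder -/
lemma run2 {n : ℕ} (hn : 3 ≤ n) {Ω : Set (En n)} (ho : IsOpen Ω) (hb : Bornology.IsBounded Ω)
    {ψ : En n → ℝ} {c1 C2 C4 : ℝ} (hψ : PsiD Ω ψ c1 C2) (hC4 : 0 < C4) {A V' : ℝ} (hA0 : 0 < A)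
    (hV' : 0 < V') {t : ℝ} (ht : 0 < t) :
    ∃ δ : ℝ, 0 < δ ∧ ∀ h : En n → ℝ, Adm Ω ψ c1 C4 h → ∀ (μ : ℝ) (x0 : En n) (u : En n → ℝ),
      0 < μ → μ ≤ 1 → x0 ∈ Ω → XX Ω u → (∃ K, 0 < K ∧ ∀ x ∈ closure Ω, |u x| ≤ K * ψ x) →
      (∀ x ∈ Ω, |-lap u x + h x * u x| ≤ A * (‖x - x0‖ + μ) ^ (-(pp n + 2)) + V') →
      ∫ x in Ω, |u x| ^ twoStar n ≤ δ →
      ∀ x ∈ closure Ω, (‖x - x0‖ + μ) ^ pp n * |u x| ≤ t := by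
  have hr := twoStar_pos hn
  have hp := pp_pos hn
  set r := twoStar n with hrd
  set p := pp n with hpd
  have hr0 : 0 < r := by linarith
  obtain ⟨R, hR, hRb⟩ := diam_weight hb
  set k0 := 1 / (2 * (R + 1)) with hk0d
  have hk00 : 0 < k0 := by positivity
  have hk012 : k0 ≤ 1 / 2 := by
    apply one_div_le_one_div_of_le (by norm_num); linarith
  set ε := min (1 / 4) (t * k0 ^ p / 2) with hε
  have hε0 : 0 < ε := by positivity
  set M := 2 ^ p + A * 2 ^ (p + 2) + V' with hM
  obtain ⟨δ, hδ, H⟩ := Etwo hn ho hb hψ hC4 (M := M) (by positivity) hε0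
  refine ⟨δ, hδ, ?_⟩
  intro h hA μ x0 u hμ hμ1 hx0 hu hdom hL hintg
  by_contra hcon
  push Not at hcon
  obtain ⟨y, hy, hyt, hym⟩ := exists_wmax hn ho hb hu hμ x0 ht.le hcon
  set D := ‖y - x0‖ + μ with hD
  have hD0 : 0 < D := by positivity
  have hDR : D ≤ R := hRb y hy x0 hx0 μ hμ1
  set m := D ^ p * |u y| with hm
  have hm0 : 0 < m := ht.trans hyt
  set k1 := m ^ (-(1 / p)) with hk1
  have hk10 : 0 < k1 := by positivity
  have hk1p : k1 ^ p = m⁻¹ := by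
    rw [hk1, ← Real.rpow_mul hm0.le, show -(1 / p) * p = -1 by field_simp, Real.rpow_neg_one]
  set k := min k0 k1 with hk
  have hk0 : 0 < k := by positivity
  have hkp : k ^ p * m ≤ 1 := by
    have := Real.rpow_le_rpow hk0.le (min_le_right k0 k1) hp.le
    rw [hk1p] at this
    calc _ ≤ m⁻¹ * m := mul_le_mul_of_nonneg_right this hm0.le
      _ = 1 := inv_mul_cancel₀ hm0.ne'
  have hk12 : k ≤ 1 / 2 := (min_le_left _ _).trans hk012
  set l := k * D with hl
  have hl0 : 0 < l := by positivity
  have hlD : l ≤ D / 2 := by rw [hl]; nlinarith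
  have hl1 : l ≤ 1 := by
    calc l ≤ 1 / (2 * (R + 1)) * R := mul_le_mul (min_le_left _ _) hDR hD0.le (by positivity)
      _ ≤ 1 := by rw [div_mul_eq_mul_div, div_le_one (by positivity)]; linarith
  have hlp : l ^ p = k ^ p * D ^ p := by rw [hl, Real.mul_rpow hk0.le hD0.le]
  have key := H h hA y l hy hl0 hl1 u hu hdom ?_ ?_
  · rw [hlp, mul_assoc, ← hm] at key
    rcases min_choice k0 k1 with hc | hc
    · rw [← hk] at hc
      rw [hc] at key
      have h1 : ε ≤ t * k0 ^ p / 2 := min_le_right _ _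
      have h2 : 0 < k0 ^ p := by positivity
      nlinarith [mul_lt_mul_of_pos_left hyt h2]
    · rw [← hk] at hc
      rw [hc, hk1p, inv_mul_cancel₀ hm0.ne'] at key
      have h1 : ε ≤ 1 / 4 := min_le_left _ _
      linarith
  · intro x hx
    have h1 := weight_half hμ hlD hx.2
    have h2 := hym x hx.1
    have h3 : (D / 2) ^ p * |u x| ≤ m :=
      (mul_le_mul_of_nonneg_right (Real.rpow_le_rpow (by positivity) h1 hp.le) (abs_nonneg _)).trans h2
    rw [Real.div_rpow hD0.le (by norm_num), div_mul_eq_mul_div, div_le_iff₀ (by positivity)] at h3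
    have hp2 : 0 < (2:ℝ) ^ p := by positivity
    have hA2 : 0 < A * (2:ℝ) ^ (p + 2) := by positivity
    constructor
    · rw [hlp, mul_assoc]
      calc _ ≤ k ^ p * (m * 2 ^ p) := mul_le_mul_of_nonneg_left h3 (by positivity)
        _ = (k ^ p * m) * 2 ^ p := by ring
        _ ≤ 1 * 2 ^ p := mul_le_mul_of_nonneg_right hkp hp2.le
        _ ≤ M := by rw [hM]; linarith
    · rw [le_div_iff₀ (by positivity)]
      have h4 := hL x hx.1
      have h5 : (‖x - x0‖ + μ) ^ (-(p + 2)) ≤ (D / 2) ^ (-(p + 2)) :=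
        Real.rpow_le_rpow_of_nonpos (by positivity) h1 (by linarith)
      have h6 : (D / 2) ^ (-(p + 2)) * l ^ (p + 2) ≤ 2 ^ (p + 2) := by
        have : (l / (D / 2)) ^ (p + 2) ≤ 2 ^ (p + 2) := by
          apply Real.rpow_le_rpow (by positivity) _ (by linarith)
          rw [div_le_iff₀ (by positivity)]; linarith
        rw [Real.div_rpow hl0.le (by positivity)] at this
        rw [Real.rpow_neg (by positivity), inv_mul_eq_div]
        exact this
      have h7 : l ^ (p + 2) ≤ 1 := Real.rpow_le_one hl0.le hl1 (by linarith)
      have h8 : l ^ p * l ^ 2 = l ^ (p + 2) := by rw [Real.rpow_add hl0, Real.rpow_two]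
      have h9 : 0 < l ^ (p + 2) := by positivity
      calc l ^ p * |-lap u x + h x * u x| * l ^ 2 = |-lap u x + h x * u x| * l ^ (p + 2) := by rw [← h8]; ring
        _ ≤ (A * (D / 2) ^ (-(p + 2)) + V') * l ^ (p + 2) :=
          mul_le_mul_of_nonneg_right (h4.trans (by gcongr)) h9.le
        _ = A * ((D / 2) ^ (-(p + 2)) * l ^ (p + 2)) + V' * l ^ (p + 2) := by ring
        _ ≤ A * 2 ^ (p + 2) + V' * 1 := by gcongr
        _ ≤ M := by rw [hM]; linarith
  · have hc : ContinuousOn (fun x => |u x| ^ r) (closure Ω) :=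
      hu.cont.abs.rpow_const (fun x _ => Or.inr hr0.le)
    obtain ⟨K, hK⟩ := hb.isCompact_closure.exists_bound_of_continuousOn hc
    have hi : IntegrableOn (fun x => |u x| ^ r) Ω :=
      bdd_pow_int hb ho ((hc.mono subset_closure).aestronglyMeasurable ho.measurableSet)
        ⟨K, fun x hx => hK x (subset_closure hx)⟩
    exact (setIntegral_mono_set hi (Eventually.of_forall fun x => by positivity)
        (Eventually.of_forall Set.inter_subset_left)).trans hintg

lemma le_supNorm {n : ℕ} {Ω : Set (En n)} (hb : Bornology.IsBounded Ω) {f : En n → ℝ}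
    (hf : ContinuousOn f (closure Ω)) {x : En n} (hx : x ∈ closure Ω) : |f x| ≤ supNorm Ω f := by
  obtain ⟨K, hK⟩ := hb.isCompact_closure.exists_bound_of_continuousOn hf
  unfold supNorm
  have hbd : BddAbove (Set.range fun x => ⨆ (_ : x ∈ closure Ω), |f x|) := by
    refine ⟨max K 0, ?_⟩
    rintro _ ⟨z, rfl⟩
    by_cases hz : z ∈ closure Ω
    · simp only [hz, ciSup_unique]
      exact (hK z hz).trans (le_max_left _ _)
    · simp [hz]
  have := le_ciSup hbd x
  simpa only [hx, ciSup_unique] using this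

lemma norm_gradient {n : ℕ} (f : En n → ℝ) (x : En n) : ‖gradient f x‖ = ‖fderiv ℝ f x‖ := by
  unfold gradient
  exact LinearIsometryEquiv.norm_map _ _

lemma dom_psi {n : ℕ} {Ω : Set (En n)} (ho : IsOpen Ω) (hb : Bornology.IsBounded Ω)
    {h0 : En n → ℝ} (hw : WMP Ω h0) {ψ : En n → ℝ} {c1 C2 : ℝ} (hψ : PsiD Ω ψ c1 C2)
    (low : ∀ x ∈ Ω, c1 ≤ -lap ψ x + h0 x * ψ x) (hup : ∃ K, ∀ x ∈ Ω, -lap ψ x + h0 x * ψ x ≤ K)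
    {h : En n → ℝ} (hh : ∀ x ∈ Ω, |h x - h0 x| ≤ 2)
    {w : En n → ℝ} (hwx : XX Ω w) (hwb : ∃ A, ∀ x ∈ Ω, |-lap w x + h x * w x| ≤ A) :
    ∃ K, 0 < K ∧ ∀ x ∈ closure Ω, |w x| ≤ K * ψ x := by
  obtain ⟨A, hA⟩ := hwb
  obtain ⟨K, hK, hKb⟩ := c2_bound ho hb hwx.c2
  refine compare_psi ho hw hψ low hup hwx ⟨A + 2 * K, fun x hx => ?_⟩
  have e : -lap w x + h0 x * w x = (-lap w x + h x * w x) - (h x - h0 x) * w x := by ring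
  rw [e]
  refine (abs_sub _ _).trans (add_le_add (hA x hx) ?_)
  rw [abs_mul]
  exact mul_le_mul (hh x hx) (hKb x hx).1 (abs_nonneg _) (by norm_num)

lemma final {n : ℕ} (hn : 3 ≤ n)
    (Ω : Set (En n)) (hΩo : IsOpen Ω) (hΩb : Bornology.IsBounded Ω)
    (hinf : En n → ℝ) (ha : ℕ → En n → ℝ)
    (hconv : TendstoC0On ha hinf (closure Ω))
    (hcoer : Coercive Ω hinf)
    (v : ℕ → En n → ℝ) (hsol : ∀ α, IsSolution Ω (ha α) (v α))
    (hblow : Tendsto (fun α => supNorm Ω (v α)) atTop atTop)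
    (xa : ℕ → En n) (hxa : ∀ α, xa α ∈ Ω)
    (hmax : ∀ α, |v α (xa α)| = supNorm Ω (v α))
    (mua : ℕ → ℝ) (hmua : ∀ α, mua α = |v α (xa α)| ^ (-(2 / ((n : ℝ) - 2))))
    (hmu0 : Tendsto mua atTop (𝓝 0))
    (vinf : En n → ℝ) (s : ℝ) (hsgn : s = 1 ∨ s = -1)
    (hvx : XX Ω vinf) (hvs : ∀ x ∈ Ω, -lap vinf x + hinf x * vinf x = Nl (twoStar n) (vinf x))
    (hdecomp : Tendsto (fun α => ∫ x in Ω,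
        ‖gradient (fun y => v α y - bubble n (mua α) (xa α) y - s * vinf y) x‖ ^ 2)
      atTop (𝓝 0))
    (Pb : ℕ → En n → ℝ)
    (hPb : ∀ α, IsBubbleProj Ω (ha α) (mua α) (xa α) (Pb α)) :
    TendstoUniformlyOn
      (fun α x => (‖x - xa α‖ + mua α) ^ (((n : ℝ) - 2) / 2) *
        |v α x - Pb α x - s * vinf x|)
      0 atTop (closure Ω) := by
  have hr := twoStar_pos hn
  have hp := pp_pos hn
  set r := twoStar n with hrd
  have hr0 : 0 < r := by linarith
  have hq : 0 < r - 1 := by linarith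
  have hs1 : |s| = 1 := by rcases hsgn with h | h <;> rw [h] <;> simp
  have hx : ∀ α, XX Ω (v α) := fun α => ⟨(hsol α).1, (hsol α).2.2⟩
  have hvsol : ∀ α, ∀ x ∈ Ω, -lap (v α) x + ha α x * v α x = Nl r (v α x) := fun α => (hsol α).2.1
  have hPx : ∀ α, XX Ω (Pb α) := fun α => ⟨(hPb α).1, (hPb α).2.2⟩
  obtain ⟨C0, ε1, hC0, hε1, hε11, hLP⟩ := LP hn hΩo hΩb hcoer
  obtain ⟨V, hV, hVb⟩ := c2_bound hΩo hΩb hvx.c2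
  have hclose : ∀ τ : ℝ, 0 < τ → ∀ᶠ α in atTop, ∀ x ∈ Ω, |ha α x - hinf x| ≤ τ := by
    intro τ hτ
    filter_upwards [Metric.tendstoUniformlyOn_iff.1 hconv τ hτ] with α hα x hx
    have := hα x (subset_closure hx)
    rw [dist_comm, Real.dist_eq] at this
    exact this.le
  have hmupos : ∀ᶠ α in atTop, 0 < mua α := by
    filter_upwards [hblow.eventually_gt_atTop 0] with α hα
    rw [← hmax α] at hα
    rw [hmua α]; positivity
  have hsmall : ∀ τ : ℝ, 0 < τ → ∀ᶠ α in atTop, mua α ≤ τ := fun τ hτ =>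
    hmu0.eventually_le_const hτ
  have hmuv : ∀ α, 0 < mua α → mua α ^ (-pp n) = |v α (xa α)| := by
    intro α hα
    have h0 : 0 ≤ |v α (xa α)| := abs_nonneg _
    rw [hmua α, ← Real.rpow_mul h0]
    have h3 : (3:ℝ) ≤ n := by exact_mod_cast hn
    have : -(2 / ((n : ℝ) - 2)) * -pp n = 1 := by
      unfold pp
      have : (n:ℝ) - 2 ≠ 0 := by linarith
      field_simp
    rw [this, Real.rpow_one]
  -- base index
  obtain ⟨N, hN⟩ := ((hclose ε1 hε1).and hmupos).exists_forall_of_atTop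
  have hwmp : WMP Ω (ha N) := wmp_of_LP hn hΩo hΩb (hLP (ha N) (hN N le_rfl).1)
  obtain ⟨c1, C2, C4, hψ, hC4, hlow, hadm⟩ := exists_psi hn hΩo hΩb ⟨xa 0, hxa 0⟩ hwmp (hN N le_rfl).2 (hPb N)
  set ψ := Pb N with hψd
  have hh2 : ∀ α, N ≤ α → ∀ x ∈ Ω, |ha α x - ha N x| ≤ 2 := by
    intro α hα x hx
    have h1 := (hN α hα).1 x hx
    have h2 := (hN N le_rfl).1 x hx
    rw [abs_le] at *
    constructor <;> linarith
  have hup : ∃ K, ∀ x ∈ Ω, -lap ψ x + ha N x * ψ x ≤ K := by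
    refine ⟨(mua N ^ (-(((n : ℝ) - 2) / 2))) ^ (r - 1), fun x hx => ?_⟩
    rw [(hPb N).2.1 x hx]
    exact Real.rpow_le_rpow (bubble_pos hn (hN N le_rfl).2 _ _).le (bubble_le hn (hN N le_rfl).2 _ _) hq.le
  have hvsup : ∀ α, ∀ x ∈ Ω, |v α x| ≤ |v α (xa α)| := fun α x hxx => by
    rw [hmax α]; exact le_supNorm hΩb (hx α).cont (subset_closure hxx)
  have hvdom : ∀ α, N ≤ α → ∃ K, 0 < K ∧ ∀ x ∈ closure Ω, |v α x| ≤ K * ψ x := by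
    intro α hα
    refine dom_psi hΩo hΩb hwmp hψ hlow hup (hh2 α hα) (hx α) ⟨|v α (xa α)| ^ (r - 1), fun x hxx => ?_⟩
    rw [hvsol α x hxx, Nl_abs hr]
    exact Real.rpow_le_rpow (abs_nonneg _) (hvsup α x hxx) hq.le
  set z : ℕ → En n → ℝ := fun α x => v α x - s * vinf x with hz
  have hzx : ∀ α, XX Ω (z α) := fun α => (hx α).sub (hvx.const_mul s)
  have hvz : ∀ α, ∀ x ∈ Ω, |v α x - z α x| ≤ V := fun α x hxx => by
    simp only [hz]
    rw [sub_sub_cancel, abs_mul, hs1, one_mul]; exact (hVb x hxx).1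
  have hgrad : ∀ τ : ℝ, 0 < τ → ∀ᶠ α in atTop,
      ∫ x in Ω, ‖fderiv ℝ (z α) x - fderiv ℝ (bubble n (mua α) (xa α)) x‖ ^ 2 ≤ τ := by
    intro τ hτ
    filter_upwards [hdecomp.eventually_le_const hτ] with α hα
    refine le_trans (le_of_eq ?_) hα
    refine setIntegral_congr_fun hΩo.measurableSet fun x hxx => ?_
    simp only [norm_gradient]
    have e : (fun y => v α y - bubble n (mua α) (xa α) y - s * vinf y) =
        fun y => z α y - bubble n (mua α) (xa α) y := by
      funext y; simp only [hz]; ring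
    rw [e, fderiv_fun_sub (((hzx α).at hΩo hxx).differentiableAt (by norm_num))
      ((bubble_contDiff hn _ _).contDiffAt.differentiableAt (by norm_num))]
  -- the remainder tends to zero in the critical norm
  obtain ⟨Cs, hCs, hL7⟩ := L7d hn hΩo hΩb
  have hE : ∀ δ : ℝ, 0 < δ → ∀ᶠ α in atTop,
      ∫ x in Ω, |z α x - bubble n (mua α) (xa α) x| ^ r ≤ δ := by
    intro δ hδ
    set κ := δ ^ (2 / r) / (2 * Cs) with hκ
    have hκ0 : 0 < κ := by positivity
    obtain ⟨δ', hδ', hNs⟩ := Nsmall hn hΩo hΩb hψ hC4 hV.le hκ0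
    have hmp : ∀ᶠ α in atTop, mua α ^ pp n * (V + 2) ≤ δ' := by
      have h1 : Tendsto (fun α => mua α ^ pp n * (V + 2)) atTop (𝓝 (0 ^ pp n * (V + 2))) :=
        ((Real.continuousAt_rpow_const 0 (pp n) (Or.inr hp.le)).tendsto.comp hmu0).mul_const _
      rw [Real.zero_rpow hp.ne', zero_mul] at h1
      exact h1.eventually_le_const hδ'
    filter_upwards [eventually_ge_atTop N, hmupos, hsmall 1 one_pos, hmp, hgrad (δ' ^ 2) (by positivity),
      hgrad κ hκ0] with α hα hμ hμ1 hμp hg1 hg2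
    have a1 := hNs (ha α) (hadm _ (hh2 α hα)) (mua α) (xa α) (v α) (z α) hμ hμ1 hμp (hxa α) (hx α)
      (hvdom α hα) (fun x hxx => by rw [hmuv α hμ]; exact hvsup α x hxx) (hmuv α hμ).symm (hvsol α) (hzx α)
      (hvz α) hg1
    have a2 := hL7 (z α) (hzx α) (mua α) hμ (xa α)
    have a3 : (∫ x in Ω, |z α x - bubble n (mua α) (xa α) x| ^ r) ^ (2 / r) ≤ δ ^ (2 / r) := by
      refine a2.trans ?_
      calc _ ≤ Cs * (κ + κ) := mul_le_mul_of_nonneg_left (add_le_add hg2 a1) hCs.le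
        _ = δ ^ (2 / r) := by rw [hκ]; field_simp; norm_num
    exact (Real.rpow_le_rpow_iff (integral_nonneg fun x => by positivity) hδ.le (by positivity)).1 a3
  -- second norm estimate
  have hU : ∀ κ : ℝ, 0 < κ → ∀ᶠ α in atTop, ∫ x in Ω, |v α x - Pb α x - s * vinf x| ^ r ≤ κ := by
    intro κ hκ
    obtain ⟨δ, hδ, H⟩ := L8two hn hΩo hΩb (hinf := hinf) hC0 hvx hvs hsgn hV (fun x hxx => (hVb x hxx).1) hκ
    filter_upwards [hclose ε1 hε1, hclose δ hδ, hmupos, hsmall δ hδ, hE δ hδ] with α h1 h2 h3 h4 h5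
    exact H (ha α) (hLP (ha α) h1) h2 (mua α) h3 h4 (xa α) (v α) (Pb α) (hx α) (hvsol α) (hPb α) h5
  -- weighted bound
  obtain ⟨Λ, δ1, hΛ, hδ1, hrun1⟩ := run1 hn hΩo hΩb hψ hC4 hV
  have hW : ∀ᶠ α in atTop, ∀ x ∈ closure Ω, (‖x - xa α‖ + mua α) ^ pp n * |v α x| ≤ Λ := by
    filter_upwards [eventually_ge_atTop N, hmupos, hsmall 1 one_pos, hE δ1 hδ1] with α hα hμ hμ1 hes
    exact hrun1 (ha α) (hadm _ (hh2 α hα)) (mua α) (xa α) (v α) (z α) hμ hμ1 (hxa α) (hx α) (hvdom α hα)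
      (hvsol α) (hzx α) (hvz α) hes
  obtain ⟨Cd, hCd, hdec⟩ := bubble_decay' hn
  set A := Λ ^ (r - 1) + Cd ^ (r - 1) with hA
  set V' := V ^ (r - 1) + V with hV'
  rw [Metric.tendstoUniformlyOn_iff]
  intro ε hε
  obtain ⟨δ2, hδ2, hrun2⟩ := run2 hn hΩo hΩb hψ hC4 (A := A) (V' := V') (by positivity) (by positivity)
    (half_pos hε)
  filter_upwards [eventually_ge_atTop N, hmupos, hsmall 1 one_pos, hW, hU δ2 hδ2, hclose 1 one_pos] with
    α hα hμ hμ1 hw hu hc1 x hxx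
  have hux : XX Ω (fun x => v α x - Pb α x - s * vinf x) := ((hx α).sub (hPx α)).sub (hvx.const_mul s)
  have hLu : ∀ y ∈ Ω, |-lap (fun x => v α x - Pb α x - s * vinf x) y + ha α y *
      (v α y - Pb α y - s * vinf y)| ≤ A * (‖y - xa α‖ + mua α) ^ (-(pp n + 2)) + V' := by
    intro y hy
    have hBp := bubble_pos hn hμ (xa α) y
    set D := ‖y - xa α‖ + mua α with hD
    have hD0 : 0 < D := by positivity
    have hl : lap (fun x => v α x - Pb α x - s * vinf x) y = lap (v α) y - lap (Pb α) y - s * lap vinf y := by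
      rw [lap_sub (((hx α).at hΩo hy).sub ((hPx α).at hΩo hy)) (contDiffAt_const.mul (hvx.at hΩo hy)),
        lap_sub ((hx α).at hΩo hy) ((hPx α).at hΩo hy), lap_const_mul s (hvx.at hΩo hy)]
    have hFe : -lap (fun x => v α x - Pb α x - s * vinf x) y + ha α y * (v α y - Pb α y - s * vinf y) =
        Nl r (v α y) - bubble n (mua α) (xa α) y ^ (r - 1) - s * Nl r (vinf y)
          - s * ((ha α y - hinf y) * vinf y) := by
      rw [hl, ← hvsol α y hy, ← (hPb α).2.1 y hy, ← hvs y hy]; ring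
    have hDq : (D ^ (-pp n)) ^ (r - 1) = D ^ (-(pp n + 2)) := by
      rw [← Real.rpow_mul hD0.le, ← pp_star1 hn]; congr 1; ring
    have b1 : |Nl r (v α y)| ≤ Λ ^ (r - 1) * D ^ (-(pp n + 2)) := by
      rw [Nl_abs hr, ← hDq, ← Real.mul_rpow hΛ.le (by positivity)]
      refine Real.rpow_le_rpow (abs_nonneg _) ?_ hq.le
      have := hw y (subset_closure hy)
      rw [Real.rpow_neg hD0.le, ← div_eq_mul_inv, le_div_iff₀ (by positivity)]
      linarith
    have b2 : |bubble n (mua α) (xa α) y ^ (r - 1)| ≤ Cd ^ (r - 1) * D ^ (-(pp n + 2)) := by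
      rw [abs_of_nonneg (Real.rpow_nonneg hBp.le _), ← hDq, ← Real.mul_rpow hCd.le (by positivity)]
      exact Real.rpow_le_rpow hBp.le (hdec _ hμ _ _) hq.le
    have b3 : |s * Nl r (vinf y)| ≤ V ^ (r - 1) := by
      rw [abs_mul, hs1, one_mul, Nl_abs hr]
      exact Real.rpow_le_rpow (abs_nonneg _) (hVb y hy).1 hq.le
    have b4 : |s * ((ha α y - hinf y) * vinf y)| ≤ V := by
      rw [abs_mul, hs1, one_mul, abs_mul]
      calc _ ≤ 1 * V := mul_le_mul (hc1 y hy) (hVb y hy).1 (abs_nonneg _) zero_le_one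
        _ = V := one_mul _
    rw [hFe]
    have t1 := abs_sub (Nl r (v α y) - bubble n (mua α) (xa α) y ^ (r - 1) - s * Nl r (vinf y))
      (s * ((ha α y - hinf y) * vinf y))
    have t2 := abs_sub (Nl r (v α y) - bubble n (mua α) (xa α) y ^ (r - 1)) (s * Nl r (vinf y))
    have t3 := abs_sub (Nl r (v α y)) (bubble n (mua α) (xa α) y ^ (r - 1))
    rw [hA, hV', add_mul]
    linarith
  have hudom := dom_psi hΩo hΩb hwmp hψ hlow hup (hh2 α hα) hux
    ⟨A * mua α ^ (-(pp n + 2)) + V', fun y hy => (hLu y hy).trans (by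
      have : (‖y - xa α‖ + mua α) ^ (-(pp n + 2)) ≤ mua α ^ (-(pp n + 2)) :=
        Real.rpow_le_rpow_of_nonpos hμ (by linarith [norm_nonneg (y - xa α)]) (by linarith)
      have hA0 : 0 < A := by positivity
      gcongr)⟩
  have := hrun2 (ha α) (hadm _ (hh2 α hα)) (mua α) (xa α) _ hμ hμ1 (hxa α) hux hudom hLu hu x hxx
  rw [Pi.zero_apply, dist_comm, Real.dist_eq, sub_zero, abs_of_nonneg (by positivity)]
  change (‖x - xa α‖ + mua α) ^ pp n * |v α x - Pb α x - s * vinf x| < ε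
  linarith

/-- **Proposition (weighted uniform convergence).**
Under the blow-up setup, with `D_α(x) := |x − x_α| + μ_α`, one has
`D_α(x)^{(n−2)/2} |v_α(x) − ΠB_α(x) ∓ v_∞(x)| → 0` uniformly on `Ω̄`. -/
theorem statement5
    (n : ℕ) (hn : 3 ≤ n)
    (Ω : Set (En n)) (hΩo : IsOpen Ω) (hΩb : Bornology.IsBounded Ω)
    (hinf : En n → ℝ) (ha : ℕ → En n → ℝ)
    (hconv : TendstoC0On ha hinf (closure Ω))
    (hcoer : Coercive Ω hinf) (hI : Ih Ω hinf < KnInvSq n)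
    (v : ℕ → En n → ℝ) (hsol : ∀ α, IsSolution Ω (ha α) (v α))
    (henergy : limsup (fun α => ∫ x in Ω, |v α x| ^ twoStar n) atTop
      ≤ KnInvSq n ^ ((n : ℝ) / 2) + Ih Ω hinf ^ ((n : ℝ) / 2))
    (hblow : Tendsto (fun α => supNorm Ω (v α)) atTop atTop)
    (xa : ℕ → En n) (hxa : ∀ α, xa α ∈ Ω)
    (hmax : ∀ α, |v α (xa α)| = supNorm Ω (v α))
    (mua : ℕ → ℝ) (hmua : ∀ α, mua α = |v α (xa α)| ^ (-(2 / ((n : ℝ) - 2))))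
    (hmu0 : Tendsto mua atTop (𝓝 0))
    (vinf : En n → ℝ) (s : ℝ) (hsgn : s = 1 ∨ s = -1)
    (hvinf : vinf = (fun _ => 0) ∨
      ((∀ x ∈ Ω, 0 < vinf x) ∧ IsSolution Ω hinf vinf ∧ rayleigh Ω hinf vinf = Ih Ω hinf))
    (hdecomp : Tendsto (fun α => ∫ x in Ω,
        ‖gradient (fun y => v α y - bubble n (mua α) (xa α) y - s * vinf y) x‖ ^ 2)
      atTop (𝓝 0))
    (Pb : ℕ → En n → ℝ)
    (hPb : ∀ α, IsBubbleProj Ω (ha α) (mua α) (xa α) (Pb α)) :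
    TendstoUniformlyOn
      (fun α x => (‖x - xa α‖ + mua α) ^ (((n : ℝ) - 2) / 2) *
        |v α x - Pb α x - s * vinf x|)
      0 atTop (closure Ω) := by
  have key : XX Ω vinf ∧
      ∀ x ∈ Ω, -lap vinf x + hinf x * vinf x = Nl (twoStar n) (vinf x) := by
    rcases hvinf with h | ⟨_, h, _⟩
    · subst h
      refine ⟨⟨contDiffOn_const, fun _ _ => rfl⟩, fun x _ => ?_⟩
      simp [lap, Nl]
    · exact ⟨⟨h.1, h.2.2⟩, h.2.1⟩
  exact final hn Ω hΩo hΩb hinf ha hconv hcoer v hsol hblow xa hxa hmax mua hmua hmu0 vinf s hsgn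
    key.1 key.2 hdecomp Pb hPb
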